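/- There exists ℓ₀ such that for every ℓ ≥ ℓ₀ there exists n₀ such that the following holds for all n ≥ n₀. Let H be a 3-uniform hypergraph on n vertices that contains no pseudocycle of length m for any m ≤ ℓ with m not divisible by 3, and which has the maximum number of edges among all 3-uniform hypergraphs on n vertices with this property. Then there is a partition of the vertex set of H into two nonempty sets A and B such that every 3-element set with exactly two vertices in A and one vertex in B is an edge of H, no edge of H is contained in A, and no edge of H has exactly one vertex in A and two vertices in B. -/

import Mathlib

/-- `H` has a pseudocycle of length `ℓ`: a sequence of vertices indexed by `ZMod ℓ`
such that every three cyclically consecutive vertices form an edge of `H`. -/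
def HasPseudocycle {V : Type} [DecidableEq V] (H : Finset (Finset V)) (ℓ : ℕ) : Prop :=
  ∃ v : ZMod ℓ → V, ∀ i : ZMod ℓ, ({v i, v (i + 1), v (i + 2)} : Finset V) ∈ H

/-- `H` has no pseudocycle of length `m` for any `m ≤ ℓ` with `3 ∤ m`. -/
def NoShortOddPseudocycle {V : Type} [DecidableEq V] (H : Finset (Finset V)) (ℓ : ℕ) :
    Prop :=
  ∀ m : ℕ, 3 ≤ m → m ≤ ℓ → ¬ (3 ∣ m) → ¬ HasPseudocycle H m

namespace PCyc
open Finset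

/-- Real-valued indicator of a proposition. -/
noncomputable def ind (p : Prop) : ℝ := by classical exact if p then 1 else 0

lemma ind_pos {p : Prop} (h : p) : ind p = 1 := by simp [ind, h]
lemma ind_neg {p : Prop} (h : ¬ p) : ind p = 0 := by simp [ind, h]
lemma ind_nonneg (p : Prop) : 0 ≤ ind p := by unfold ind; split_ifs <;> norm_num
lemma ind_le_one (p : Prop) : ind p ≤ 1 := by unfold ind; split_ifs <;> norm_num
lemma ind_mono {p q : Prop} (h : p → q) : ind p ≤ ind q := by
  by_cases hp : p
  · rw [ind_pos hp, ind_pos (h hp)]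
  · rw [ind_neg hp]; exact ind_nonneg q
lemma ind_congr {p q : Prop} (h : p ↔ q) : ind p = ind q := by rw [propext h]
lemma ind_or_le {p q r : Prop} (h : p → q ∨ r) : ind p ≤ ind q + ind r := by
  by_cases hp : p
  · rw [ind_pos hp]
    rcases h hp with hq | hr
    · rw [ind_pos hq]; linarith [ind_nonneg r]
    · rw [ind_pos hr]; linarith [ind_nonneg q]
  · rw [ind_neg hp]; linarith [ind_nonneg q, ind_nonneg r]
lemma ind_not (p : Prop) : ind (¬ p) = 1 - ind p := by
  by_cases hp : p
  · rw [ind_pos hp, ind_neg (not_not.mpr hp)]; norm_num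
  · rw [ind_neg hp, ind_pos hp]; norm_num
lemma ind_and (p q : Prop) : ind (p ∧ q) = ind p * ind q := by
  by_cases hp : p <;> by_cases hq : q <;> simp [ind, hp, hq]
lemma of_ind_pos {p : Prop} (h : 0 < ind p) : p := by
  by_contra hp; rw [ind_neg hp] at h; exact lt_irrefl _ h

section sums
variable {V : Type}

lemma card_eq_sum_ind (S : Finset V) (p : V → Prop) [DecidablePred p] :
    ((S.filter p).card : ℝ) = ∑ x ∈ S, ind (p x) := by
  rw [Finset.card_filter]
  push_cast
  refine Finset.sum_congr rfl fun x _ => ?_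
  by_cases h : p x <;> simp [ind, h]

lemma sum_ind_nonneg (S : Finset V) (p : V → Prop) : 0 ≤ ∑ x ∈ S, ind (p x) :=
  Finset.sum_nonneg fun x _ => ind_nonneg _

lemma sum_ind_le (S : Finset V) (p : V → Prop) : ∑ x ∈ S, ind (p x) ≤ S.card := by
  calc _ ≤ ∑ x ∈ S, (1 : ℝ) := Finset.sum_le_sum fun x _ => ind_le_one _
    _ = _ := by simp
end sums

/-- The constant `μ = λ / 3` with `λ = 2 √3 - 3`. -/
noncomputable def mu : ℝ := (2 * Real.sqrt 3 - 3) / 3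
/-- The optimal proportion of the first part. -/
noncomputable def al : ℝ := (3 - Real.sqrt 3) / 2

lemma s3_sq : Real.sqrt 3 * Real.sqrt 3 = 3 := Real.mul_self_sqrt (by norm_num)
lemma s3_lo : 1.732050 < Real.sqrt 3 := by
  apply Real.lt_sqrt_of_sq_lt; norm_num
lemma s3_hi : Real.sqrt 3 < 1.732051 := by
  rw [Real.sqrt_lt' (by norm_num)]; norm_num
lemma al_lo : 0.633974 < al := by unfold al; linarith [s3_hi]
lemma al_hi : al < 0.633976 := by unfold al; linarith [s3_lo]
lemma mu_lo : 0.154700 ≤ mu := by unfold mu; linarith [s3_lo]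
lemma mu_hi : mu < 0.154701 := by unfold mu; linarith [s3_hi]
lemma mu_eq : 3 * mu = 2 * (al * (1 - al)) := by
  unfold mu al; nlinarith [s3_sq]
lemma al_eq1 : al ^ 2 * (1 + mu) = 3 * mu := by
  unfold mu al; nlinarith [s3_sq]
lemma al_eq2 : 2 * al * (1 + mu) = 1 + 3 * mu := by
  unfold mu al; nlinarith [s3_sq]

/-- The key polynomial identity. -/
lemma key_poly (a b : ℝ) :
    a ^ 2 * b + mu * b ^ 3 = mu * (a + b) ^ 3 - (1 + mu) * a * (a - al * (a + b)) ^ 2 := by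
  have h1 := al_eq1
  have h2 := al_eq2
  linear_combination (a * (a + b) ^ 2) * h1 - (a ^ 2 * (a + b)) * h2

lemma key_poly_le {a b : ℝ} (ha : 0 ≤ a) :
    a ^ 2 * b + mu * b ^ 3 ≤ mu * (a + b) ^ 3 := by
  rw [key_poly]
  have : 0 ≤ (1 + mu) * a * (a - al * (a + b)) ^ 2 := by
    have := mu_lo
    positivity
  linarith

end PCyc

namespace PCyc
open Finset
section colourings
variable {V : Type} [DecidableEq V]

/-- Antisymmetric colouring of ordered pairs by `ZMod 3`. -/
def Anti (f : V → V → ZMod 3) : Prop := ∀ x y, f y x = - f x y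

lemma Anti.self {f : V → V → ZMod 3} (hf : Anti f) (x : V) : f x x = 0 := by
  have h := hf x x
  revert h; generalize f x x = t; revert t; decide

/-- `(x, y, z)` is a cherry (possibly `x = y`): `x y` blue, `x → z`, `y → z`. -/
def Ch (f : V → V → ZMod 3) (x y z : V) : Prop := f x y = 0 ∧ f x z = 1 ∧ f y z = 1

/-- Number of cherries in `S`. -/
noncomputable def T (f : V → V → ZMod 3) (S : Finset V) : ℝ :=
  ∑ x ∈ S, ∑ y ∈ S, ∑ z ∈ S, ind (Ch f x y z)

lemma T_nonneg (f : V → V → ZMod 3) (S : Finset V) : 0 ≤ T f S :=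
  Finset.sum_nonneg fun _ _ => Finset.sum_nonneg fun _ _ => Finset.sum_nonneg fun _ _ => ind_nonneg _

/-- `x`, `y` are twins with respect to `S`. -/
def Twin (f : V → V → ZMod 3) (S : Finset V) (x y : V) : Prop := ∀ z ∈ S, f x z = f y z

noncomputable def cl (f : V → V → ZMod 3) (S : Finset V) (x : V) : ℝ := ∑ y ∈ S, ind (Twin f S x y)

noncomputable def tw (f : V → V → ZMod 3) (S : Finset V) : ℝ := ∑ x ∈ S, cl f S x

/-- Replace `u` by a clone of `v`. -/
def clone (f : V → V → ZMod 3) (u v : V) : V → V → ZMod 3 :=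
  fun x y => f (Function.update id u v x) (Function.update id u v y)

lemma clone_anti {f : V → V → ZMod 3} (hf : Anti f) (u v : V) : Anti (clone f u v) :=
  fun _ _ => hf _ _

lemma clone_of_ne (f : V → V → ZMod 3) {u v x y : V} (hx : x ≠ u) (hy : y ≠ u) :
    clone f u v x y = f x y := by
  simp [clone, Function.update_of_ne hx, Function.update_of_ne hy]

lemma triple_expand (t : V → V → V → ℝ) {u v : V} {S : Finset V} (hu : u ∉ insert v S) (hv : v ∉ S)
    (h1 : ∀ x, t x u v = 0) (h2 : ∀ x, t x v u = 0) (h3 : ∀ x, t x u u = 0) (h4 : ∀ x, t x v v = 0)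
    (h1' : ∀ x, t u x v = 0) (h2' : ∀ x, t v x u = 0) (h3' : ∀ x, t u x u = 0)
    (h4' : ∀ x, t v x v = 0) :
    ∑ x ∈ insert u (insert v S), ∑ y ∈ insert u (insert v S), ∑ z ∈ insert u (insert v S), t x y z
    = (∑ x ∈ S, ∑ y ∈ S, ∑ z ∈ S, t x y z)
      + ((∑ y ∈ S, ∑ z ∈ S, t u y z) + (∑ y ∈ S, ∑ z ∈ S, t y u z) + (∑ y ∈ S, ∑ z ∈ S, t y z u)
          + ∑ z ∈ S, t u u z)
      + ((∑ y ∈ S, ∑ z ∈ S, t v y z) + (∑ y ∈ S, ∑ z ∈ S, t y v z) + (∑ y ∈ S, ∑ z ∈ S, t y z v)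
          + ∑ z ∈ S, t v v z)
      + ((∑ z ∈ S, t u v z) + ∑ z ∈ S, t v u z) := by
  simp only [Finset.sum_insert hu, Finset.sum_insert hv, Finset.sum_add_distrib, h1, h2, h3, h4,
    h1', h2', h3', h4', Finset.sum_const_zero]
  ring

/-- Part of the count attached to one vertex. -/
noncomputable def gg (f : V → V → ZMod 3) (S : Finset V) (u : V) : ℝ :=
  (∑ y ∈ S, ∑ z ∈ S, ind (Ch f u y z)) + (∑ y ∈ S, ∑ z ∈ S, ind (Ch f y u z))
    + (∑ y ∈ S, ∑ z ∈ S, ind (Ch f y z u)) + ∑ z ∈ S, ind (Ch f u u z)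

lemma one_ne_zero3 : (0 : ZMod 3) ≠ 1 := by decide

lemma T_expand {f : V → V → ZMod 3} (hf : Anti f) {u v : V} {S : Finset V}
    (hu : u ∉ insert v S) (hv : v ∉ S) (huv : f u v = 0) :
    T f (insert u (insert v S)) = T f S + gg f S u + gg f S v
      + ((∑ z ∈ S, ind (Ch f u v z)) + ∑ z ∈ S, ind (Ch f v u z)) := by
  have hvu : f v u = 0 := by rw [hf, huv, neg_zero]
  have huu := hf.self u
  have hvv := hf.self v
  unfold T gg
  rw [triple_expand (fun x y z => ind (Ch f x y z)) hu hv] <;>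
    intro x <;> exact ind_neg (by simp [Ch, huv, hvu, huu, hvv])

lemma ch_congr {f g : V → V → ZMod 3} {x y z x' y' z' : V} (h1 : f x y = g x' y')
    (h2 : f x z = g x' z') (h3 : f y z = g y' z') : ind (Ch f x y z) = ind (Ch g x' y' z') := by
  simp [Ch, h1, h2, h3]

lemma T_clone {f : V → V → ZMod 3} (hf : Anti f) {u v : V} {S : Finset V}
    (hu : u ∉ insert v S) (hv : v ∉ S) (huv : f u v = 0) :
    T (clone f u v) (insert u (insert v S)) = T f S + 2 * gg f S v
      + 2 * ∑ z ∈ S, ind (Ch f v v z) := by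
  have hne : u ≠ v := fun h => hu (by simp [h])
  have huS : u ∉ S := fun h => hu (by simp [h])
  have hvv := hf.self v
  have e0 : ∀ x ∈ S, Function.update id u v x = x := fun x hx =>
    Function.update_of_ne (fun h : x = u => huS (h ▸ hx)) _ _
  have e1 : Function.update id u v u = v := by simp
  have e2 : Function.update id u v v = v := by simp [Function.update_of_ne hne.symm]
  have c1 : T (clone f u v) S = T f S := by
    unfold T
    refine sum_congr rfl fun x hx => sum_congr rfl fun y hy => sum_congr rfl fun z hz => ?_
    simp only [Ch, clone, e0 x hx, e0 y hy, e0 z hz]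
  have c2 : ∀ p ∈ ({u, v} : Finset V), gg (clone f u v) S p = gg f S v := by
    intro p hp
    have ep : Function.update id u v p = v := by
      simp only [mem_insert, mem_singleton] at hp
      rcases hp with rfl | rfl
      · exact e1
      · exact e2
    unfold gg
    congr 1
    · congr 1
      · congr 1 <;>
        · refine sum_congr rfl fun y hy => sum_congr rfl fun z hz => ?_
          simp only [Ch, clone, e0 y hy, e0 z hz, ep]
      · refine sum_congr rfl fun y hy => sum_congr rfl fun z hz => ?_
        simp only [Ch, clone, e0 y hy, e0 z hz, ep]
    · refine sum_congr rfl fun z hz => ?_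
      simp only [Ch, clone, e0 z hz, ep]
  have c3 : ∑ z ∈ S, ind (Ch (clone f u v) u v z) = ∑ z ∈ S, ind (Ch f v v z) := by
    refine sum_congr rfl fun z hz => ?_
    simp only [Ch, clone, e0 z hz, e1, e2]
  have c4 : ∑ z ∈ S, ind (Ch (clone f u v) v u z) = ∑ z ∈ S, ind (Ch f v v z) := by
    refine sum_congr rfl fun z hz => ?_
    simp only [Ch, clone, e0 z hz, e1, e2]
  rw [T_expand (clone_anti hf u v) hu hv (by simp only [clone, e1, e2, hvv]), c1,
    c2 u (by simp), c2 v (by simp), c3, c4]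
  ring

lemma T_clone_ge {f : V → V → ZMod 3} (hf : Anti f) {u v : V} {S : Finset V}
    (hu : u ∉ insert v S) (hv : v ∉ S) (huv : f u v = 0) :
    T f (insert u (insert v S)) + (gg f S v - gg f S u) ≤ T (clone f u v) (insert u (insert v S)) := by
  rw [T_clone hf hu hv huv, T_expand hf hu hv huv]
  have h1 : ∑ z ∈ S, ind (Ch f u v z) ≤ ∑ z ∈ S, ind (Ch f v v z) :=
    sum_le_sum fun z _ => ind_mono fun h => ⟨hf.self v, h.2.2, h.2.2⟩
  have h2 : ∑ z ∈ S, ind (Ch f v u z) ≤ ∑ z ∈ S, ind (Ch f v v z) :=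
    sum_le_sum fun z _ => ind_mono fun h => ⟨hf.self v, h.2.1, h.2.1⟩
  linarith

lemma tw_clone {f : V → V → ZMod 3} {u v : V} {S : Finset V} (hu : u ∈ S) (hv : v ∈ S)
    (hne : u ≠ v) (hnt : ¬ Twin f S u v) (hcl : cl f S u ≤ cl f S v) :
    tw f S < tw (clone f u v) S := by
  have huS' : u ∉ S.erase u := by simp
  have hS : S = insert u (S.erase u) := (insert_erase hu).symm
  have hsym : ∀ {x y}, Twin f S x y → Twin f S y x := fun h z hz => (h z hz).symm
  have e1 : Function.update id u v u = v := by simp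
  have e0 : ∀ x ∈ S.erase u, Function.update id u v x = x := fun x hx =>
    Function.update_of_ne (ne_of_mem_erase hx) _ _
  -- lower bound for the new count
  have key : ∀ x y, Twin f S (Function.update id u v x) (Function.update id u v y) →
      Twin (clone f u v) S x y := by
    intro x y h z hz
    apply h
    by_cases hzu : z = u
    · subst hzu; simpa using hv
    · rwa [Function.update_of_ne hzu]
  have low : (∑ x ∈ S, ∑ y ∈ S,
      ind (Twin f S (Function.update id u v x) (Function.update id u v y)))
      ≤ tw (clone f u v) S :=
    sum_le_sum fun x _ => sum_le_sum fun y _ => ind_mono (key x y)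
  refine lt_of_lt_of_le ?_ low
  have expand : ∀ g : V → V → ℝ, ∑ x ∈ S, ∑ y ∈ S, g x y
      = g u u + (∑ y ∈ S.erase u, g u y) + (∑ y ∈ S.erase u, g y u)
        + ∑ x ∈ S.erase u, ∑ y ∈ S.erase u, g x y := by
    intro g
    have h := hS
    calc ∑ x ∈ S, ∑ y ∈ S, g x y
        = ∑ x ∈ insert u (S.erase u), ∑ y ∈ insert u (S.erase u), g x y := by rw [← hS]
      _ = _ := by
        simp only [sum_insert huS', sum_add_distrib]
        ring
  unfold tw cl
  rw [expand, expand]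
  have s1 : ∑ x ∈ S.erase u, ∑ y ∈ S.erase u,
      ind (Twin f S (Function.update id u v x) (Function.update id u v y))
      = ∑ x ∈ S.erase u, ∑ y ∈ S.erase u, ind (Twin f S x y) := by
    refine sum_congr rfl fun x hx => sum_congr rfl fun y hy => ?_
    rw [e0 x hx, e0 y hy]
  have s2 : ∑ y ∈ S.erase u, ind (Twin f S (Function.update id u v u) (Function.update id u v y))
      = cl f S v := by
    rw [cl, hS, sum_insert huS', ← hS, ind_neg (fun h => hnt (hsym h)), zero_add]
    refine sum_congr rfl fun y hy => ?_
    rw [e0 y hy, e1]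
  have s3 : ∑ y ∈ S.erase u, ind (Twin f S (Function.update id u v y) (Function.update id u v u))
      = cl f S v := by
    rw [← s2]
    exact sum_congr rfl fun y hy => ind_congr ⟨hsym, hsym⟩
  have s4 : cl f S u = 1 + ∑ y ∈ S.erase u, ind (Twin f S u y) := by
    rw [cl]
    conv_lhs => rw [hS, sum_insert huS', ← hS]
    rw [ind_pos (show Twin f S u u from fun _ _ => rfl)]
  have s5 : ∑ y ∈ S.erase u, ind (Twin f S y u) = ∑ y ∈ S.erase u, ind (Twin f S u y) :=
    sum_congr rfl fun y hy => ind_congr ⟨hsym, hsym⟩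
  have s6 : ind (Twin f S u u) = 1 := ind_pos (fun _ _ => rfl)
  have s7 : ind (Twin f S (Function.update id u v u) (Function.update id u v u)) = 1 :=
    ind_pos (fun _ _ => rfl)
  rw [s1, s2, s3, s5, s6, s7]
  linarith

/-- Fully symmetrised. -/
def Symm (f : V → V → ZMod 3) (S : Finset V) : Prop :=
  ∀ u ∈ S, ∀ v ∈ S, f u v = 0 → Twin f S u v

/-- Zykov induction principle. -/
theorem zykov [Fintype V] (S : Finset V) (Q : (V → V → ZMod 3) → Prop)
    (base : ∀ f, Anti f → Symm f S → Q f)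
    (step : ∀ f, Anti f → ∀ u ∈ S, ∀ v ∈ S, T f S ≤ T (clone f u v) S → Q (clone f u v) → Q f) :
    ∀ f, Anti f → Q f := by
  let m : (V → V → ZMod 3) → ℝ ×ₗ ℝ := fun f => toLex (T f S, tw f S)
  have wf : WellFounded (fun f g => m g < m f) := by
    have : IsTrans (V → V → ZMod 3) (fun f g => m g < m f) := ⟨fun a b c h1 h2 => h2.trans h1⟩
    have : Std.Irrefl (fun f g => m g < m f) := ⟨fun a => lt_irrefl _⟩
    exact Finite.wellFounded_of_trans_of_irrefl _
  intro f
  induction f using wf.induction with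
  | _ f ih =>
    intro hf
    by_cases hs : Symm f S
    · exact base f hf hs
    · simp only [Symm, not_forall] at hs
      obtain ⟨u, hu, v, hv, huv, hnt⟩ := hs
      have hne : u ≠ v := by
        rintro rfl; exact hnt (fun _ _ => rfl)
      have hvu : f v u = 0 := by rw [hf, huv, neg_zero]
      -- general step
      have gen : ∀ u ∈ S, ∀ v ∈ S, u ≠ v → f u v = 0 → ¬ Twin f S u v →
          (gg f ((S.erase u).erase v) u < gg f ((S.erase u).erase v) v ∨
            (gg f ((S.erase u).erase v) u = gg f ((S.erase u).erase v) v ∧ cl f S u ≤ cl f S v)) →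
          Q f := by
        intro u hu v hv hne huv hnt hcase
        have hv' : v ∈ S.erase u := mem_erase.mpr ⟨hne.symm, hv⟩
        have hS : insert u (insert v ((S.erase u).erase v)) = S := by
          rw [insert_erase hv', insert_erase hu]
        have h1 : u ∉ insert v ((S.erase u).erase v) := by rw [insert_erase hv']; simp
        have h2 : v ∉ (S.erase u).erase v := by simp
        have hge := T_clone_ge hf h1 h2 huv
        rw [hS] at hge
        rcases hcase with hlt | ⟨heq, hcl⟩
        · refine step f hf u hu v hv (by linarith) (ih _ ?_ (clone_anti hf u v))
          exact Prod.Lex.toLex_lt_toLex.mpr (Or.inl (by simp only; linarith))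
        · refine step f hf u hu v hv (by linarith) (ih _ ?_ (clone_anti hf u v))
          have ht := tw_clone hu hv hne hnt hcl
          rcases (show T f S ≤ T (clone f u v) S by linarith).lt_or_eq with h | h
          · exact Prod.Lex.toLex_lt_toLex.mpr (Or.inl h)
          · exact Prod.Lex.toLex_lt_toLex.mpr (Or.inr ⟨h, ht⟩)
      have hnt' : ¬ Twin f S v u := fun h => hnt (fun z hz => (h z hz).symm)
      rcases lt_trichotomy (gg f ((S.erase u).erase v) u) (gg f ((S.erase u).erase v) v) with h | h | h
      · exact gen u hu v hv hne huv hnt (Or.inl h)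
      · rcases le_total (cl f S u) (cl f S v) with h' | h'
        · exact gen u hu v hv hne huv hnt (Or.inr ⟨h, h'⟩)
        · refine gen v hv u hu hne.symm hvu hnt' (Or.inr ⟨?_, h'⟩)
          rw [erase_right_comm]; exact h.symm
      · refine gen v hv u hu hne.symm hvu hnt' (Or.inl ?_)
        rw [erase_right_comm]; exact h

end colourings
end PCyc

namespace PCyc
open Finset
section symm
variable {V : Type} [DecidableEq V]

lemma sum3_split {A B S : Finset V} (hd : Disjoint A B) (hS : A ∪ B = S) (t : V → V → V → ℝ) :
    ∑ x ∈ S, ∑ y ∈ S, ∑ z ∈ S, t x y z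
    = (∑ x ∈ A, ∑ y ∈ A, ∑ z ∈ A, t x y z) + (∑ x ∈ A, ∑ y ∈ A, ∑ z ∈ B, t x y z)
    + (∑ x ∈ A, ∑ y ∈ B, ∑ z ∈ A, t x y z) + (∑ x ∈ A, ∑ y ∈ B, ∑ z ∈ B, t x y z)
    + (∑ x ∈ B, ∑ y ∈ A, ∑ z ∈ A, t x y z) + (∑ x ∈ B, ∑ y ∈ A, ∑ z ∈ B, t x y z)
    + (∑ x ∈ B, ∑ y ∈ B, ∑ z ∈ A, t x y z) + (∑ x ∈ B, ∑ y ∈ B, ∑ z ∈ B, t x y z) := by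
  subst hS
  simp only [sum_union hd, sum_add_distrib]
  ring

lemma zmod3_cases {t : ZMod 3} (h0 : t ≠ 0) (h1 : t ≠ 1) : -t = 1 := by
  revert t; decide

lemma not_both3 {t : ZMod 3} (h : t = 1) : -t ≠ 1 := by
  revert t; decide

lemma symm_bound {f : V → V → ZMod 3} (hf : Anti f) {S : Finset V} (hs : Symm f S) {x0 : V}
    (hx0 : x0 ∈ S) (q : ℝ)
    (hq : ∀ x ∈ S \ S.filter (fun y => f x0 y = 0),
      ∑ y ∈ S \ S.filter (fun y => f x0 y = 0), ind (f x y = 0) ≤ q) :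
    T f S ≤ ((S.filter (fun y => f x0 y = 0)).card : ℝ) ^ 2 *
        (((S \ S.filter (fun y => f x0 y = 0)).card : ℝ)
          - ∑ x ∈ S \ S.filter (fun y => f x0 y = 0), ind (f x x0 = 1))
      + (S.filter (fun y => f x0 y = 0)).card * q *
          (∑ x ∈ S \ S.filter (fun y => f x0 y = 0), ind (f x x0 = 1))
      + T f (S \ S.filter (fun y => f x0 y = 0)) := by
  set C := S.filter (fun y => f x0 y = 0) with hC
  set R := S \ C with hR
  have hCS : C ⊆ S := filter_subset _ _
  have hRS : R ⊆ S := sdiff_subset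
  have hd : Disjoint C R := disjoint_sdiff
  have hu : C ∪ R = S := union_sdiff_of_subset hCS
  have mC : ∀ x ∈ C, x ∈ S ∧ f x0 x = 0 := fun x hx => mem_filter.mp hx
  have mR : ∀ x ∈ R, x ∈ S ∧ f x0 x ≠ 0 := fun x hx => by
    have := mem_sdiff.mp hx
    exact ⟨this.1, fun h => this.2 (mem_filter.mpr ⟨this.1, h⟩)⟩
  have tC : ∀ x ∈ C, ∀ z ∈ S, f x0 z = f x z := fun x hx z hz =>
    hs x0 hx0 x (mC x hx).1 (mC x hx).2 z hz
  have z1 : ∑ x ∈ C, ∑ y ∈ C, ∑ z ∈ C, ind (Ch f x y z) = 0 := by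
    refine sum_eq_zero fun x hx => sum_eq_zero fun y hy => sum_eq_zero fun z hz => ind_neg ?_
    rintro ⟨_, h, _⟩
    rw [← tC x hx z (mC z hz).1, (mC z hz).2] at h
    exact one_ne_zero3 h
  have z2 : ∀ D : Finset V, ∑ x ∈ C, ∑ y ∈ R, ∑ z ∈ D, ind (Ch f x y z) = 0 := by
    intro D
    refine sum_eq_zero fun x hx => sum_eq_zero fun y hy => sum_eq_zero fun z hz => ind_neg ?_
    rintro ⟨h, _, _⟩
    rw [← tC x hx y (mR y hy).1] at h
    exact (mR y hy).2 h
  have z3 : ∀ D : Finset V, ∑ x ∈ R, ∑ y ∈ C, ∑ z ∈ D, ind (Ch f x y z) = 0 := by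
    intro D
    refine sum_eq_zero fun x hx => sum_eq_zero fun y hy => sum_eq_zero fun z hz => ind_neg ?_
    rintro ⟨h, _, _⟩
    rw [hf y x, neg_eq_zero, ← tC y hy x (mR x hx).1] at h
    exact (mR x hx).2 h
  set m := ∑ x ∈ R, ind (f x x0 = 1) with hm
  have b1 : ∑ x ∈ C, ∑ y ∈ C, ∑ z ∈ R, ind (Ch f x y z) ≤ (C.card : ℝ) ^ 2 * (R.card - m) := by
    have : ∀ x ∈ C, ∀ y ∈ C, ∑ z ∈ R, ind (Ch f x y z) ≤ R.card - m := by
      intro x hx y hy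
      have e : (R.card : ℝ) - m = ∑ z ∈ R, (1 - ind (f z x0 = 1)) := by
        rw [sum_sub_distrib]; simp [hm]
      rw [e]
      refine sum_le_sum fun z hz => ?_
      rw [← ind_not]
      refine ind_mono ?_
      rintro ⟨_, h, _⟩
      rw [← tC x hx z (mR z hz).1] at h
      rw [hf x0 z]
      exact not_both3 h
    calc _ ≤ ∑ x ∈ C, ∑ y ∈ C, ((R.card : ℝ) - m) :=
          sum_le_sum fun x hx => sum_le_sum fun y hy => this x hx y hy
      _ = _ := by simp; ring
  have b2 : ∑ x ∈ R, ∑ y ∈ R, ∑ z ∈ C, ind (Ch f x y z) ≤ C.card * q * m := by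
    calc _ ≤ ∑ x ∈ R, ∑ y ∈ R, ∑ z ∈ C, ind (f x x0 = 1) * ind (f x y = 0) := by
          refine sum_le_sum fun x hx => sum_le_sum fun y hy => sum_le_sum fun z hz => ?_
          rw [← ind_and]
          refine ind_mono ?_
          rintro ⟨h1, h2, _⟩
          refine ⟨?_, h1⟩
          rw [hf x0 x, tC z hz x (mR x hx).1, ← hf z x]; exact h2
      _ = ∑ x ∈ R, C.card * ind (f x x0 = 1) * (∑ y ∈ R, ind (f x y = 0)) := by
          refine sum_congr rfl fun x _ => ?_
          rw [mul_sum]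
          refine sum_congr rfl fun y _ => ?_
          simp; ring
      _ ≤ ∑ x ∈ R, C.card * ind (f x x0 = 1) * q := by
          refine sum_le_sum fun x hx => ?_
          exact mul_le_mul_of_nonneg_left (hq x hx) (mul_nonneg (by positivity) (ind_nonneg _))
      _ = _ := by rw [hm, mul_sum]; exact sum_congr rfl fun x _ => by ring
  have := sum3_split hd hu (fun x y z => ind (Ch f x y z))
  simp only [z1, z2, z3] at this
  unfold T
  linarith

lemma Symm.mono {f : V → V → ZMod 3} {S R : Finset V} (h : Symm f S) (hR : R ⊆ S) : Symm f R :=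
  fun u hu v hv huv z hz => h u (hR hu) v (hR hv) huv z (hR hz)

lemma T_le_symm {f : V → V → ZMod 3} (hf : Anti f) : ∀ (S : Finset V), Symm f S →
    T f S ≤ mu * (S.card : ℝ) ^ 3 := by
  intro S
  induction S using Finset.strongInduction with
  | H S ih =>
  intro hs
  rcases S.eq_empty_or_nonempty with rfl | hne
  · simp [T]
  obtain ⟨x0, hx0, hmax⟩ := S.exists_max_image (fun x => (S.filter (fun y => f x y = 0)).card) hne
  have hCS : S.filter (fun y => f x0 y = 0) ⊆ S := filter_subset _ _
  have hxC : x0 ∈ S.filter (fun y => f x0 y = 0) := mem_filter.mpr ⟨hx0, hf.self x0⟩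
  have h := symm_bound hf hs hx0 ((S.filter (fun y => f x0 y = 0)).card : ℝ) (by
    intro x hx
    have hxS := (mem_sdiff.mp hx).1
    calc _ ≤ ∑ y ∈ S, ind (f x y = 0) :=
          sum_le_sum_of_subset_of_nonneg sdiff_subset fun _ _ _ => ind_nonneg _
      _ = ((S.filter (fun y => f x y = 0)).card : ℝ) := (card_eq_sum_ind S (fun y => f x y = 0)).symm
      _ ≤ _ := by exact_mod_cast hmax x hxS)
  have h2 := ih (S \ S.filter (fun y => f x0 y = 0))
    (sdiff_ssubset hCS ⟨x0, hxC⟩) (hs.mono sdiff_subset)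
  have hcard : ((S \ S.filter (fun y => f x0 y = 0)).card : ℝ)
      + (S.filter (fun y => f x0 y = 0)).card = S.card := by
    exact_mod_cast card_sdiff_add_card_eq_card hCS
  have h3 := key_poly_le (a := ((S.filter (fun y => f x0 y = 0)).card : ℝ))
    (b := ((S \ S.filter (fun y => f x0 y = 0)).card : ℝ)) (by positivity)
  rw [← hcard, add_comm ((S \ S.filter (fun y => f x0 y = 0)).card : ℝ)]
  nlinarith [h, h2, h3]

theorem T_le [Fintype V] {f : V → V → ZMod 3} (hf : Anti f) (S : Finset V) :
    T f S ≤ mu * (S.card : ℝ) ^ 3 := by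
  refine zykov S (fun f => T f S ≤ mu * (S.card : ℝ) ^ 3) ?_ ?_ f hf
  · intro f hf hs; exact T_le_symm hf S hs
  · intro f hf u _ v _ h1 h2; exact h1.trans h2

lemma symm_stable {f : V → V → ZMod 3} (hf : Anti f) {S : Finset V} (hs : Symm f S)
    (hne : S.Nonempty) (hT : (mu - 0.000000000000000001) * (S.card : ℝ) ^ 3 ≤ T f S) :
    ∃ A ⊆ S, |(A.card : ℝ) - al * S.card| ≤ 0.00000001 * S.card ∧
      ∑ x ∈ A, ∑ y ∈ A, ∑ z ∈ S \ A, ind (¬ Ch f x y z) ≤ 0.0000000000000001 * (S.card : ℝ) ^ 3 := by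
  obtain ⟨x0, hx0, hmax⟩ := S.exists_max_image (fun x => (S.filter (fun y => f x y = 0)).card) hne
  have hCS : S.filter (fun y => f x0 y = 0) ⊆ S := filter_subset _ _
  refine ⟨S.filter (fun y => f x0 y = 0), hCS, ?_⟩
  have hq1 : ∀ x ∈ S, ∑ y ∈ S, ind (f x y = 0) ≤ ((S.filter (fun y => f x0 y = 0)).card : ℝ) := by
    intro x hx
    rw [← card_eq_sum_ind S (fun y => f x y = 0)]
    exact_mod_cast hmax x hx
  have hq : ∀ x ∈ S \ S.filter (fun y => f x0 y = 0),
      ∑ y ∈ S \ S.filter (fun y => f x0 y = 0), ind (f x y = 0) ≤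
        min ((S.filter (fun y => f x0 y = 0)).card : ℝ) (S \ S.filter (fun y => f x0 y = 0)).card := by
    intro x hx
    refine le_min ?_ (sum_ind_le _ _)
    exact le_trans (sum_le_sum_of_subset_of_nonneg sdiff_subset fun _ _ _ => ind_nonneg _)
      (hq1 x (mem_sdiff.mp hx).1)
  have h := symm_bound hf hs hx0 _ hq
  have hcard : ((S \ S.filter (fun y => f x0 y = 0)).card : ℝ)
      + (S.filter (fun y => f x0 y = 0)).card = S.card := by
    exact_mod_cast card_sdiff_add_card_eq_card hCS
  have h2 := T_le_symm hf (S \ S.filter (fun y => f x0 y = 0)) (hs.mono sdiff_subset)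
  have hcrude : T f S ≤ (S.filter (fun y => f x0 y = 0)).card * (S.card : ℝ) ^ 2 := by
    calc T f S ≤ ∑ x ∈ S, ∑ y ∈ S, ∑ z ∈ S, ind (f x y = 0) :=
          sum_le_sum fun x _ => sum_le_sum fun y _ => sum_le_sum fun z _ => ind_mono fun h => h.1
      _ = ∑ x ∈ S, (S.card : ℝ) * ∑ y ∈ S, ind (f x y = 0) := by
          refine sum_congr rfl fun x _ => ?_
          rw [mul_sum]; refine sum_congr rfl fun y _ => by simp
      _ ≤ ∑ x ∈ S, (S.card : ℝ) * (S.filter (fun y => f x0 y = 0)).card :=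
          sum_le_sum fun x hx => mul_le_mul_of_nonneg_left (hq1 x hx) (by positivity)
      _ = _ := by simp; ring
  have hM : ∑ x ∈ S.filter (fun y => f x0 y = 0), ∑ y ∈ S.filter (fun y => f x0 y = 0),
      ∑ z ∈ S \ S.filter (fun y => f x0 y = 0), ind (¬ Ch f x y z)
      ≤ ((S.filter (fun y => f x0 y = 0)).card : ℝ) ^ 2 *
        ∑ x ∈ S \ S.filter (fun y => f x0 y = 0), ind (f x x0 = 1) := by
    calc _ ≤ ∑ x ∈ S.filter (fun y => f x0 y = 0), ∑ y ∈ S.filter (fun y => f x0 y = 0),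
        ∑ z ∈ S \ S.filter (fun y => f x0 y = 0), ind (f z x0 = 1) := by
          refine sum_le_sum fun x hx => sum_le_sum fun y hy => sum_le_sum fun z hz => ind_mono ?_
          intro hn
          by_contra hz1
          have hzS := (mem_sdiff.mp hz).1
          have hz0 : f x0 z ≠ 0 := fun h => (mem_sdiff.mp hz).2 (mem_filter.mpr ⟨hzS, h⟩)
          have hx' := mem_filter.mp hx
          have hy' := mem_filter.mp hy
          have hz' : f x0 z = 1 := by
            by_contra h1
            exact hz1 (by rw [hf x0 z]; exact zmod3_cases hz0 h1)
          apply hn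
          have tx := hs x0 hx0 x hx'.1 hx'.2
          have ty := hs x0 hx0 y hy'.1 hy'.2
          exact ⟨by rw [← tx y hy'.1]; exact hy'.2, by rw [← tx z hzS]; exact hz',
            by rw [← ty z hzS]; exact hz'⟩
      _ = _ := by simp; ring
  have hm0 : 0 ≤ ∑ x ∈ S \ S.filter (fun y => f x0 y = 0), ind (f x x0 = 1) := sum_ind_nonneg _ _
  have hmR : ∑ x ∈ S \ S.filter (fun y => f x0 y = 0), ind (f x x0 = 1)
    ≤ (S \ S.filter (fun y => f x0 y = 0)).card := sum_ind_le _ _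
  have hs0 : (0 : ℝ) < S.card := by exact_mod_cast hne.card_pos
  have hr0 : (0 : ℝ) ≤ (S \ S.filter (fun y => f x0 y = 0)).card := by positivity
  have hc0 : (0 : ℝ) ≤ (S.filter (fun y => f x0 y = 0)).card := by positivity
  generalize (∑ x ∈ S \ S.filter (fun y => f x0 y = 0), ind (f x x0 = 1)) = m at *
  generalize T f (S \ S.filter (fun y => f x0 y = 0)) = T1 at *
  generalize ((S \ S.filter (fun y => f x0 y = 0)).card : ℝ) = r at *
  generalize ((S.filter (fun y => f x0 y = 0)).card : ℝ) = c at *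
  generalize (S.card : ℝ) = s at *
  clear hq hq1 hmax hCS hx0 hs hne
  have hmu := mu_lo
  have hmu2 := mu_hi
  have hal := al_lo
  have hal2 := al_hi
  have hcs : 0.15 * s ≤ c := by
    have : (mu - 0.000000000000000001) * s * s ^ 2 ≤ c * s ^ 2 := by nlinarith
    have h' := le_of_mul_le_mul_right this (by positivity)
    nlinarith
  have hk := key_poly c r
  have hrs : c + r = s := by linarith
  rw [hrs] at hk
  have hqc : min c r ≤ c := min_le_left _ _
  have hqr : min c r ≤ r := min_le_right _ _
  have main : (1 + mu) * c * (c - al * s) ^ 2 + c * (c - min c r) * m ≤ 0.000000000000000001 * s ^ 3 := by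
    nlinarith
  have t1 : 0 ≤ c * (c - min c r) * m :=
    mul_nonneg (mul_nonneg hc0 (by linarith)) hm0
  have t2 : 0 ≤ (1 + mu) * c * (c - al * s) ^ 2 := by positivity
  have d1 : |c - al * s| ≤ 0.00000001 * s := by
    have : (c - al * s) ^ 2 ≤ (0.00000001 * s) ^ 2 := by
      have h1 : 0.15 * s * (c - al * s) ^ 2 ≤ (1 + mu) * c * (c - al * s) ^ 2 := by
        apply mul_le_mul_of_nonneg_right _ (sq_nonneg _)
        nlinarith
      have h2 : s * (c - al * s) ^ 2 ≤ s * (0.00000001 * s) ^ 2 := by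
        have : (0:ℝ) < s ^ 3 := by positivity
        nlinarith
      exact le_of_mul_le_mul_left h2 hs0
    exact abs_le_of_sq_le_sq this (by positivity)
  refine ⟨d1, ?_⟩
  rw [abs_le] at d1
  have d2 : c * (0.2 * s) * m ≤ 0.000000000000000001 * s ^ 3 := by
    have : c * (0.2 * s) * m ≤ c * (c - min c r) * m := by
      apply mul_le_mul_of_nonneg_right _ hm0
      apply mul_le_mul_of_nonneg_left _ hc0
      nlinarith
    linarith
  have d3 : c * m ≤ 0.000000000000000005 * s ^ 2 := by
    have : s * (c * m) ≤ s * (0.000000000000000005 * s ^ 2) := by nlinarith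
    exact le_of_mul_le_mul_left this hs0
  have : c ^ 2 * m ≤ s * (0.000000000000000005 * s ^ 2) := by
    have : c * (c * m) ≤ s * (0.000000000000000005 * s ^ 2) := mul_le_mul (by linarith) d3 (by positivity) hs0.le
    nlinarith
  have : (0:ℝ) < s ^ 3 := by positivity
  nlinarith

end symm
end PCyc

namespace PCyc
open Finset
lemma zm1 : ∀ i : ZMod 3, 2 + -i = -(i + 1) := by decide
lemma zm2 : ∀ i : ZMod 3, 2 * -i = - -i := by decide
lemma zm3 : ∀ i j : ZMod 3, -i + 3 + 2 * -j = 0 → i = j := by decide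
section lev
variable {V : Type} [DecidableEq V]

/-- A symmetric irreflexive ternary relation. -/
structure Sys (E : V → V → V → Prop) : Prop where
  swap : ∀ {x y z}, E x y z → E y x z
  rot : ∀ {x y z}, E x y z → E y z x
  ne : ∀ {x y z}, E x y z → x ≠ y

lemma Sys.swap' {E : V → V → V → Prop} (h : Sys E) {x y z : V} (e : E x y z) : E x z y :=
  h.swap (h.rot (h.rot e))
lemma Sys.rev {E : V → V → V → Prop} (h : Sys E) {x y z : V} (e : E x y z) : E z y x :=
  h.swap (h.rot e)
lemma Sys.swap_iff {E : V → V → V → Prop} (h : Sys E) {x y z : V} : E x y z ↔ E y x z :=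
  ⟨h.swap, h.swap⟩
lemma Sys.swap'_iff {E : V → V → V → Prop} (h : Sys E) {x y z : V} : E x y z ↔ E x z y :=
  ⟨h.swap', h.swap'⟩
lemma Sys.rot_iff {E : V → V → V → Prop} (h : Sys E) {x y z : V} : E x y z ↔ E y z x :=
  ⟨h.rot, fun e => h.rot (h.rot e)⟩

/-- Tight walks between ordered pairs. -/
def W (E : V → V → V → Prop) : ℕ → V → V → V → V → Prop
  | 0, x, y, u, v => x = u ∧ y = v
  | k + 1, x, y, u, v => ∃ z, E x y z ∧ W E k y z u v

variable {E : V → V → V → Prop}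

lemma W.trans {j k : ℕ} {x y u v p q : V} (h1 : W E j x y u v) (h2 : W E k u v p q) :
    W E (j + k) x y p q := by
  induction j generalizing x y with
  | zero => obtain ⟨rfl, rfl⟩ := h1; simpa using h2
  | succ j ih =>
    obtain ⟨z, hz, h⟩ := h1
    rw [Nat.succ_add]
    exact ⟨z, hz, ih h⟩

lemma W.one {x y z : V} (h : E x y z) : W E 1 x y y z := ⟨z, h, rfl, rfl⟩

lemma W.back (hE : Sys E) {k : ℕ} {x y u v : V} (h : W E k x y u v) : W E (2 * k) u v x y := by
  induction k generalizing x y with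
  | zero => obtain ⟨rfl, rfl⟩ := h; exact ⟨rfl, rfl⟩
  | succ k ih =>
    obtain ⟨z, hz, h⟩ := h
    have h1 := ih h
    have h2 : W E 2 y z x y := ⟨x, hE.rot hz, y, hE.rot (hE.rot hz), rfl, rfl⟩
    exact h1.trans h2

lemma W.rev (hE : Sys E) {k : ℕ} {x y u v : V} (h : W E k x y u v) : W E k v u y x := by
  induction k generalizing x y with
  | zero => obtain ⟨rfl, rfl⟩ := h; exact ⟨rfl, rfl⟩
  | succ k ih =>
    obtain ⟨z, hz, h⟩ := h
    exact (ih h).trans (W.one (hE.rev hz))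

/-- No short odd closed walks. -/
def NoOdd (E : V → V → V → Prop) (L : ℕ) : Prop :=
  ∀ m ≤ L, ∀ x y, W E m x y x y → 3 ∣ m

/-- The pair `(x, y)` has level `i` (with respect to the bulk of `A`). -/
def Lev (E : V → V → V → Prop) (A : Finset V) (N : ℝ) (k : ℕ) (x y : V) (i : ZMod 3) : Prop :=
  0.001 * N ^ 2 ≤ ∑ c ∈ A, ∑ d ∈ A, ind (∃ j ≤ k, (j : ZMod 3) = -i ∧ W E j x y c d)

variable {A B : Finset V} {N : ℝ}

lemma Lev.mono {k k' : ℕ} (h : k ≤ k') {x y : V} {i : ZMod 3} (hl : Lev E A N k x y i) :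
    Lev E A N k' x y i := by
  refine le_trans hl (sum_le_sum fun c _ => sum_le_sum fun d _ => ind_mono ?_)
  rintro ⟨j, hj, h1, h2⟩
  exact ⟨j, hj.trans h, h1, h2⟩

lemma Lev.next (hE : Sys E) {k : ℕ} {x y z : V} {i : ZMod 3} (hl : Lev E A N k x y i)
    (h : E x y z) : Lev E A N (k + 2) y z (i + 1) := by
  refine le_trans hl (sum_le_sum fun c _ => sum_le_sum fun d _ => ind_mono ?_)
  rintro ⟨j, hj, h1, h2⟩
  refine ⟨2 + j, by omega, ?_, ?_⟩
  · push_cast; rw [h1]; exact zm1 i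
  · exact ((W.one h).back hE).trans h2

lemma Lev.swap (hE : Sys E) {k : ℕ} {x y : V} {i : ZMod 3} (hl : Lev E A N k x y i) :
    Lev E A N (2 * k) y x (-i) := by
  unfold Lev at hl ⊢
  rw [sum_comm]
  refine le_trans hl (sum_le_sum fun c _ => sum_le_sum fun d _ => ind_mono ?_)
  rintro ⟨j, hj, h1, h2⟩
  refine ⟨2 * j, by omega, ?_, (h2.rev hE).back hE⟩
  push_cast; rw [h1]; exact zm2 i

/-- Missing triples. -/
noncomputable def Mf (E : V → V → V → Prop) (A B : Finset V) : ℝ :=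
  ∑ x ∈ A, ∑ x' ∈ A, ∑ y ∈ B, ind (¬ E x x' y)
noncomputable def mp (E : V → V → V → Prop) (A : Finset V) (x y : V) : ℝ :=
  ∑ c ∈ A, ind (¬ E x c y)
noncomputable def mB (E : V → V → V → Prop) (A : Finset V) (y : V) : ℝ :=
  ∑ c ∈ A, ∑ d ∈ A, ind (¬ E c d y)
noncomputable def mA (E : V → V → V → Prop) (A B : Finset V) (x : V) : ℝ :=
  ∑ c ∈ A, ∑ y ∈ B, ind (¬ E x c y)

lemma mA_nonneg (x : V) : 0 ≤ mA E A B x :=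
  sum_nonneg fun _ _ => sum_nonneg fun _ _ => ind_nonneg _
lemma mB_nonneg (x : V) : 0 ≤ mB E A x :=
  sum_nonneg fun _ _ => sum_nonneg fun _ _ => ind_nonneg _
lemma mp_nonneg (x y : V) : 0 ≤ mp E A x y :=
  sum_nonneg fun _ _ => ind_nonneg _
lemma Mf_nonneg : 0 ≤ Mf E A B :=
  sum_nonneg fun _ _ => sum_nonneg fun _ _ => sum_nonneg fun _ _ => ind_nonneg _

lemma Mf_eq_mA : Mf E A B = ∑ x ∈ A, mA E A B x := rfl
lemma mA_eq_mp (x : V) : mA E A B x = ∑ y ∈ B, mp E A x y := by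
  unfold mA mp; rw [sum_comm]
lemma mB_eq_mp (y : V) : mB E A y = ∑ x ∈ A, mp E A x y := rfl
lemma Mf_eq_mB : Mf E A B = ∑ y ∈ B, mB E A y := by
  rw [Mf_eq_mA]; simp_rw [mA_eq_mp, mB_eq_mp]; rw [sum_comm]

lemma connect (hE : Sys E) (hN : 0 < N) (hA : (A.card : ℝ) ≤ N) (hB : 0.3 * N ≤ B.card)
    (hM : Mf E A B ≤ 0.00000002 * N ^ 3) (P Q : V → V → Prop)
    (hP : 0.001 * N ^ 2 ≤ ∑ c ∈ A, ∑ d ∈ A, ind (P c d))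
    (hQ : 0.001 * N ^ 2 ≤ ∑ c ∈ A, ∑ d ∈ A, ind (Q c d)) :
    ∃ c d c' d', P c d ∧ Q c' d' ∧ W E 3 c d c' d' := by
  by_contra hcon
  push Not at hcon
  have h1 : ∑ c ∈ A, ∑ d ∈ A, ∑ c' ∈ A, ∑ d' ∈ A, ∑ y ∈ B, (ind (P c d) * ind (Q c' d'))
      ≤ ∑ c ∈ A, ∑ d ∈ A, ∑ c' ∈ A, ∑ d' ∈ A, ∑ y ∈ B,
        (ind (¬ E c d y) + ind (¬ E d c' y) + ind (¬ E c' d' y)) := by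
    refine sum_le_sum fun c _ => sum_le_sum fun d _ => sum_le_sum fun c' _ =>
      sum_le_sum fun d' _ => sum_le_sum fun y _ => ?_
    rw [← ind_and]
    by_cases hpq : P c d ∧ Q c' d'
    · rw [ind_pos hpq]
      have hn := hcon c d c' d' hpq.1 hpq.2
      have hn' : ¬ E c d y ∨ ¬ E d c' y ∨ ¬ E c' d' y := by
        by_contra hh
        push Not at hh
        obtain ⟨e1, e2, e3⟩ := hh
        exact hn ⟨y, e1, c', hE.swap' e2, d', hE.rot (hE.rot e3), rfl, rfl⟩
      rcases hn' with h | h | h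
      · rw [ind_pos h]; linarith [ind_nonneg (¬ E d c' y), ind_nonneg (¬ E c' d' y)]
      · rw [ind_pos h]; linarith [ind_nonneg (¬ E c d y), ind_nonneg (¬ E c' d' y)]
      · rw [ind_pos h]; linarith [ind_nonneg (¬ E d c' y), ind_nonneg (¬ E c d y)]
    · rw [ind_neg hpq]
      linarith [ind_nonneg (¬ E d c' y), ind_nonneg (¬ E c' d' y), ind_nonneg (¬ E c d y)]
  have h2 : ∑ c ∈ A, ∑ d ∈ A, ∑ c' ∈ A, ∑ d' ∈ A, ∑ y ∈ B, (ind (P c d) * ind (Q c' d'))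
      = B.card * ((∑ c ∈ A, ∑ d ∈ A, ind (P c d)) * (∑ c ∈ A, ∑ d ∈ A, ind (Q c d))) := by
    rw [sum_mul, mul_sum]
    refine sum_congr rfl fun c _ => ?_
    rw [sum_mul, mul_sum]
    refine sum_congr rfl fun d _ => ?_
    rw [mul_sum, mul_sum]
    refine sum_congr rfl fun c' _ => ?_
    rw [mul_sum, mul_sum]
    refine sum_congr rfl fun d' _ => ?_
    simp
  have h3 : ∑ c ∈ A, ∑ d ∈ A, ∑ c' ∈ A, ∑ d' ∈ A, ∑ y ∈ B,
        (ind (¬ E c d y) + ind (¬ E d c' y) + ind (¬ E c' d' y))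
      = 3 * ((A.card : ℝ) ^ 2 * Mf E A B) := by
    simp only [sum_add_distrib]
    have e1 : ∑ c ∈ A, ∑ d ∈ A, ∑ c' ∈ A, ∑ d' ∈ A, ∑ y ∈ B, ind (¬ E c d y)
        = (A.card : ℝ) ^ 2 * Mf E A B := by
      unfold Mf
      simp only [sum_const, nsmul_eq_mul, mul_sum]
      refine sum_congr rfl fun _ _ => sum_congr rfl fun _ _ => sum_congr rfl fun _ _ => by ring
    have e2 : ∑ c ∈ A, ∑ d ∈ A, ∑ c' ∈ A, ∑ d' ∈ A, ∑ y ∈ B, ind (¬ E d c' y)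
        = (A.card : ℝ) ^ 2 * Mf E A B := by
      unfold Mf
      simp only [sum_const, nsmul_eq_mul, mul_sum]
      refine sum_congr rfl fun _ _ => sum_congr rfl fun _ _ => sum_congr rfl fun _ _ => by ring
    have e3 : ∑ c ∈ A, ∑ d ∈ A, ∑ c' ∈ A, ∑ d' ∈ A, ∑ y ∈ B, ind (¬ E c' d' y)
        = (A.card : ℝ) ^ 2 * Mf E A B := by
      unfold Mf
      simp only [sum_const, nsmul_eq_mul, mul_sum]
      refine sum_congr rfl fun _ _ => sum_congr rfl fun _ _ => sum_congr rfl fun _ _ => by ring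
    rw [e1, e2, e3]; ring
  rw [h2, h3] at h1
  have h4 : (0.3 * N) * ((0.001 * N ^ 2) * (0.001 * N ^ 2)) ≤
      B.card * ((∑ c ∈ A, ∑ d ∈ A, ind (P c d)) * (∑ c ∈ A, ∑ d ∈ A, ind (Q c d))) := by
    refine mul_le_mul hB ?_ (by positivity) (by positivity)
    exact mul_le_mul hP hQ (by positivity) (le_trans (by positivity) hP)
  have h5 : (A.card : ℝ) ^ 2 * Mf E A B ≤ N ^ 2 * (0.00000002 * N ^ 3) := by
    refine mul_le_mul ?_ hM Mf_nonneg (by positivity)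
    exact pow_le_pow_left₀ (by positivity) hA 2
  have h6 : 0 < N ^ 5 := by positivity
  nlinarith

lemma lev_unique (hE : Sys E) (hO : NoOdd E 100) (hN : 0 < N) (hA : (A.card : ℝ) ≤ N)
    (hB : 0.3 * N ≤ B.card)
    (hM : Mf E A B ≤ 0.00000002 * N ^ 3) {x y : V} {i j : ZMod 3}
    (h1 : Lev E A N 30 x y i) (h2 : Lev E A N 30 x y j) : i = j := by
  obtain ⟨c, d, c', d', ⟨k1, hk1, e1, w1⟩, ⟨k2, hk2, e2, w2⟩, w⟩ := connect hE hN hA hB hM _ _ h1 h2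
  have hw := (w1.trans w).trans (w2.back hE)
  have h3 := hO _ (by omega) _ _ hw
  have h4 : ((k1 + 3 + 2 * k2 : ℕ) : ZMod 3) = 0 := (ZMod.natCast_eq_zero_iff _ _).mpr h3
  push_cast at h4
  rw [e1, e2] at h4
  exact zm3 i j h4

/-- Good `A`-`B` pair. -/
def ok (E : V → V → V → Prop) (A : Finset V) (N : ℝ) (x y : V) : Prop :=
  0.001 * N ^ 2 ≤ ∑ c ∈ A, ∑ d ∈ A, ind (E x y c ∧ E y c d)

lemma ok.lev {x y : V} (h : ok E A N x y) : Lev E A N 2 x y 1 := by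
  refine le_trans h (sum_le_sum fun c _ => sum_le_sum fun d _ => ind_mono ?_)
  rintro ⟨h1, h2⟩
  exact ⟨2, le_refl _, by decide, c, h1, d, h2, rfl, rfl⟩

lemma not_ok_ineq (hE : Sys E) {x y : V} (h : ¬ ok E A N x y) :
    (A.card : ℝ) ^ 2 - 0.001 * N ^ 2 ≤ A.card * mp E A x y + mB E A y := by
  unfold ok at h
  push Not at h
  have e : (A.card : ℝ) ^ 2 = ∑ c ∈ A, ∑ d ∈ A, (1 : ℝ) := by simp; ring
  have e2 : A.card * mp E A x y + mB E A y
      = ∑ c ∈ A, ∑ d ∈ A, (ind (¬ E x c y) + ind (¬ E c d y)) := by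
    simp only [sum_add_distrib, mp, mB, sum_const, nsmul_eq_mul, mul_sum]
  have : ∑ c ∈ A, ∑ d ∈ A, (1 : ℝ) ≤ ∑ c ∈ A, ∑ d ∈ A, (ind (¬ E x c y) + ind (¬ E c d y))
      + ∑ c ∈ A, ∑ d ∈ A, ind (E x y c ∧ E y c d) := by
    rw [← sum_add_distrib]
    refine sum_le_sum fun c _ => ?_
    rw [← sum_add_distrib]
    refine sum_le_sum fun d _ => ?_
    by_cases h1 : E x c y
    · by_cases h2 : E c d y
      · rw [ind_pos (p := E x y c ∧ E y c d) ⟨hE.swap' h1, hE.rot (hE.rot h2)⟩]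
        linarith [ind_nonneg (¬ E x c y), ind_nonneg (¬ E c d y)]
      · rw [ind_pos h2]; linarith [ind_nonneg (¬ E x c y), ind_nonneg (E x y c ∧ E y c d)]
    · rw [ind_pos h1]; linarith [ind_nonneg (¬ E c d y), ind_nonneg (E x y c ∧ E y c d)]
  rw [e2]
  rw [e]
  linarith

/-- Good `A`-`A` pair. -/
def okA (E : V → V → V → Prop) (A B : Finset V) (N : ℝ) (x x' : V) : Prop :=
  ∃ y ∈ B, E x x' y ∧ (ok E A N x y ∨ ok E A N x' y)

lemma okA.symm (hE : Sys E) {x x' : V} (h : okA E A B N x x') : okA E A B N x' x := by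
  obtain ⟨y, hy, e, h⟩ := h
  exact ⟨y, hy, hE.swap e, h.symm⟩

lemma okA.lev (hE : Sys E) {x x' : V} (h : okA E A B N x x') : Lev E A N 12 x x' 0 := by
  obtain ⟨y, hy, e, h | h⟩ := h
  · have h1 := (h.lev.next hE (hE.swap' e)).next hE (hE.rot (hE.swap' e))
    have h2 := h1.swap hE
    exact h2.mono (by norm_num)
  · have h1 := (h.lev.next hE (hE.rot e)).next hE (hE.rot (hE.rot e))
    exact h1.mono (by norm_num)

lemma AAA_bad (hE : Sys E) (hO : NoOdd E 100) (hN : 0 < N) (hA : (A.card : ℝ) ≤ N)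
    (hB : 0.3 * N ≤ B.card) (hM : Mf E A B ≤ 0.00000002 * N ^ 3) {x y z : V} (e : E x y z)
    (h1 : okA E A B N x y) (h2 : okA E A B N x z) : False := by
  have l1 := ((h1.lev hE).swap hE).next hE (hE.swap e)
  have := lev_unique hE hO hN hA hB hM (l1.mono (by norm_num)) ((h2.lev hE).mono (by norm_num))
  revert this; decide

lemma ABB_bad (hE : Sys E) (hO : NoOdd E 100) (hN : 0 < N) (hA : (A.card : ℝ) ≤ N)
    (hB : 0.3 * N ≤ B.card) (hM : Mf E A B ≤ 0.00000002 * N ^ 3) {x y z : V} (e : E x y z)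
    (h1 : ok E A N x y) (h2 : ok E A N x z) : False := by
  have l1 := (h1.lev.swap hE).next hE (hE.swap e)
  have := lev_unique hE hO hN hA hB hM (l1.mono (by norm_num)) (h2.lev.mono (by norm_num))
  revert this; decide

lemma lev_vAA (hE : Sys E) {v x y : V} (e : E v x y) (h : okA E A B N x y) :
    Lev E A N 30 v x 2 ∧ Lev E A N 30 v y 2 := by
  have key : ∀ {x y}, E v x y → okA E A B N x y → Lev E A N 30 v x 2 := by
    intro x y e h
    have l := ((h.lev hE).next hE (hE.rot e)).next hE (hE.rot (hE.rot e))
    exact l.mono (by norm_num)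
  exact ⟨key e h, key (hE.swap' e) (h.symm hE)⟩

lemma lev_vAB (hE : Sys E) {v x y : V} (e : E v x y) (h : ok E A N x y) :
    Lev E A N 30 v x 0 ∧ Lev E A N 8 v y 1 := by
  have l1 := h.lev.next hE (hE.rot e)
  have l2 := l1.next hE (hE.rot (hE.rot e))
  refine ⟨l2.mono (by norm_num), ?_⟩
  have l3 := l1.swap hE
  exact l3

lemma lev_vBB (hE : Sys E) (hO : NoOdd E 100) (hN : 0 < N) (hA : (A.card : ℝ) ≤ N)
    (hB : 0.3 * N ≤ B.card) (hM : Mf E A B ≤ 0.00000002 * N ^ 3) {v y z : V} (e : E v y z)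
    (h1 : Lev E A N 8 v y 1) (h2 : Lev E A N 8 v z 1) : False := by
  have l := ((h1.next hE e).next hE (hE.rot e)).swap hE
  have := lev_unique hE hO hN hA hB hM (l.mono (by norm_num)) (h2.mono (by norm_num))
  revert this; decide

end lev
end PCyc

namespace PCyc
open Finset
section cnt
variable {V : Type} [DecidableEq V] {E : V → V → V → Prop} {A B : Finset V} {N : ℝ}

/-- Missing triples off the diagonal. -/
noncomputable def Mo (E : V → V → V → Prop) (A B : Finset V) : ℝ :=
  ∑ x ∈ A, ∑ c ∈ A, ∑ y ∈ B, ind (x ≠ c ∧ ¬ E x c y)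
noncomputable def AAA (E : V → V → V → Prop) (A : Finset V) : ℝ :=
  ∑ x ∈ A, ∑ y ∈ A, ∑ z ∈ A, ind (E x y z)
noncomputable def ABB (E : V → V → V → Prop) (A B : Finset V) : ℝ :=
  ∑ x ∈ A, ∑ y ∈ B, ∑ z ∈ B, ind (E x y z)

lemma sum_diag_le (A : Finset V) (x : V) : ∑ c ∈ A, ind (x = c) ≤ 1 := by
  by_cases hx : x ∈ A
  · rw [sum_eq_single x]
    · exact ind_le_one _
    · intro c _ hc; exact ind_neg (fun h => hc h.symm)
    · intro h; exact absurd hx h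
  · rw [sum_eq_zero]
    · norm_num
    · intro c hc; apply ind_neg; rintro rfl; exact hx hc

lemma Mo_nonneg : 0 ≤ Mo E A B :=
  sum_nonneg fun _ _ => sum_nonneg fun _ _ => sum_nonneg fun _ _ => ind_nonneg _

lemma bad_sum (hE : Sys E) {K bt Cy : ℝ} (y : V) (hK : 0 ≤ K) (I : V → ℝ)
    (hI : ∀ x, I x = 0 ∨ I x = 1)
    (h : ∀ x ∈ A, I x = 1 → K ≤ ∑ c ∈ A, ind (x ≠ c ∧ ¬ E x c y))
    (hb : ∑ x ∈ A, I x ≤ bt) (hC : Cy ≤ 2 * K - bt) :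
    Cy * ∑ x ∈ A, I x ≤ ∑ x ∈ A, ∑ c ∈ A, ind (x ≠ c ∧ ¬ E x c y) := by
  set q : V → V → ℝ := fun x c => ind (x ≠ c ∧ ¬ E x c y) with hq
  have hI0 : ∀ x, 0 ≤ I x := fun x => by rcases hI x with h | h <;> rw [h] <;> norm_num
  have qs : ∀ x c, q x c = q c x := fun x c => ind_congr (by rw [ne_comm, hE.swap_iff])
  have h1 : ∑ x ∈ A, ∑ c ∈ A, (q x c * I x + q x c * I c - I x * I c) ≤
      ∑ x ∈ A, ∑ c ∈ A, q x c := by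
    refine sum_le_sum fun x _ => sum_le_sum fun c _ => ?_
    have h0 : 0 ≤ q x c := ind_nonneg _
    have h1 : q x c ≤ 1 := ind_le_one _
    rcases hI x with h | h <;> rcases hI c with h' | h' <;> rw [h, h'] <;> linarith
  have h2 : ∑ x ∈ A, ∑ c ∈ A, (q x c * I x + q x c * I c - I x * I c)
      = 2 * (∑ x ∈ A, I x * ∑ c ∈ A, q x c) - (∑ x ∈ A, I x) * (∑ x ∈ A, I x) := by
    simp only [sum_sub_distrib, sum_add_distrib]
    have e1 : ∑ x ∈ A, ∑ c ∈ A, q x c * I x = ∑ x ∈ A, I x * ∑ c ∈ A, q x c := by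
      refine sum_congr rfl fun x _ => ?_
      rw [mul_sum]; exact sum_congr rfl fun c _ => mul_comm _ _
    have e2 : ∑ x ∈ A, ∑ c ∈ A, q x c * I c = ∑ x ∈ A, I x * ∑ c ∈ A, q x c := by
      rw [sum_comm, ← e1]
      refine sum_congr rfl fun x _ => sum_congr rfl fun c _ => by rw [qs]
    rw [e1, e2, sum_mul_sum]; ring
  have h3 : K * ∑ x ∈ A, I x ≤ ∑ x ∈ A, I x * ∑ c ∈ A, q x c := by
    rw [mul_sum]
    refine sum_le_sum fun x hx => ?_
    rcases hI x with hh | hh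
    · rw [hh]; simp
    · rw [hh, one_mul, mul_one]; exact h x hx hh
  have h4 : 0 ≤ ∑ x ∈ A, I x := sum_nonneg fun x _ => hI0 x
  change _ ≤ ∑ x ∈ A, ∑ c ∈ A, q x c
  nlinarith

theorem final_count (hE : Sys E) (hO : NoOdd E 100) (hN : 1000000 ≤ N)
    (ha1 : 0.6339 * N ≤ A.card) (ha2 : A.card ≤ 0.6341 * N)
    (hb1 : 0.3658 * N ≤ B.card) (hb2 : B.card ≤ 0.3662 * N)
    (hM : Mf E A B ≤ 0.00000002 * N ^ 3) (hmA : ∀ x ∈ A, mA E A B x ≤ 0.0002 * N ^ 2)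
    (hmB : ∀ y ∈ B, mB E A y ≤ 0.0782 * N ^ 2) :
    AAA E A + 3 * ABB E A B ≤ 2.9 * Mo E A B := by
  have hN0 : 0 < N := by linarith
  set a : ℝ := (A.card : ℝ) with ha
  set b : ℝ := (B.card : ℝ) with hb
  have hAN : a ≤ N := by linarith
  have hBN : 0.3 * N ≤ b := by linarith
  set I : V → V → ℝ := fun x y => ind (¬ ok E A N x y) with hI
  have hI0 : ∀ x y, 0 ≤ I x y := fun x y => ind_nonneg _
  have hI01 : ∀ x y, I x y = 0 ∨ I x y = 1 := by
    intro x y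
    by_cases h : ok E A N x y
    · left; exact ind_neg (not_not.mpr h)
    · right; exact ind_pos h
  -- bad pairs have large missing degree
  have hmp : ∀ x, ∀ y ∈ B, I x y = 1 → 0.5085 * N ≤ mp E A x y := by
    intro x y hy h
    have hb : ¬ ok E A N x y := of_ind_pos (by change 0 < I x y; rw [h]; norm_num)
    have h1 := not_ok_ineq hE hb
    have h2 := hmB y hy
    by_contra hc
    push Not at hc
    have h3 : a * mp E A x y ≤ a * (0.5085 * N) := mul_le_mul_of_nonneg_left hc.le (by positivity)
    nlinarith
  have hmpo : ∀ x, ∀ y ∈ B, I x y = 1 → 0.508 * N ≤ ∑ c ∈ A, ind (x ≠ c ∧ ¬ E x c y) := by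
    intro x y hy h
    have h1 := hmp x y hy h
    have h2 : mp E A x y ≤ ∑ c ∈ A, ind (x ≠ c ∧ ¬ E x c y) + ∑ c ∈ A, ind (x = c) := by
      unfold mp
      rw [← sum_add_distrib]
      refine sum_le_sum fun c _ => ind_or_le ?_
      intro h; by_cases hh : x = c
      · right; exact hh
      · left; exact ⟨hh, h⟩
    have h3 := sum_diag_le A x
    linarith
  have hbeta : ∀ y ∈ B, ∑ x ∈ A, I x y ≤ 0.154 * N := by
    intro y hy
    have h1 : (0.508 * N) * ∑ x ∈ A, I x y ≤ mB E A y := by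
      rw [mB_eq_mp, mul_sum]
      refine sum_le_sum fun x _ => ?_
      rcases hI01 x y with h | h
      · rw [h]; simpa using mp_nonneg x y
      · rw [h]; linarith [hmp x y hy h]
    have h2 := hmB y hy
    by_contra hc
    push Not at hc
    have : (0.508 * N) * (0.154 * N) ≤ (0.508 * N) * ∑ x ∈ A, I x y :=
      mul_le_mul_of_nonneg_left hc.le (by positivity)
    nlinarith [sq_pos_of_pos hN0]
  set Bad := ∑ y ∈ B, ∑ x ∈ A, I x y with hBad
  have hBad0 : 0 ≤ Bad := sum_nonneg fun y _ => sum_nonneg fun x _ => hI0 x y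
  have hMoBad : 0.862 * N * Bad ≤ Mo E A B := by
    have : Mo E A B = ∑ y ∈ B, ∑ x ∈ A, ∑ c ∈ A, ind (x ≠ c ∧ ¬ E x c y) := by
      unfold Mo
      rw [sum_comm (s := B)]
      exact sum_congr rfl fun x _ => sum_comm
    rw [this, hBad, mul_sum]
    refine sum_le_sum fun y hy => ?_
    exact bad_sum hE y (K := 0.508 * N) (bt := 0.154 * N) (by positivity) (fun x => I x y)
      (fun x => hI01 x y) (fun x _ h => hmpo x y hy h) (hbeta y hy) (by linarith)
  have hABB : ABB E A B ≤ 2 * (b * Bad) := by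
    have h1 : ABB E A B ≤ ∑ x ∈ A, ∑ y ∈ B, ∑ z ∈ B, (I x y + I x z) := by
      refine sum_le_sum fun x _ => sum_le_sum fun y _ => sum_le_sum fun z _ => ind_or_le ?_
      intro e
      by_contra hc
      push Not at hc
      exact ABB_bad hE hO hN0 hAN hBN hM e hc.1 hc.2
    refine h1.trans (le_of_eq ?_)
    have h2 : Bad = ∑ x ∈ A, ∑ y ∈ B, I x y := sum_comm
    rw [h2]
    simp only [sum_add_distrib, sum_const, nsmul_eq_mul, ← mul_sum]
    ring
  -- AA pairs
  set J : V → V → ℝ := fun x c => ind (x ≠ c ∧ ¬ okA E A B N x c) with hJ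
  have hJ0 : ∀ x c, 0 ≤ J x c := fun x y => ind_nonneg _
  have hJ1 : ∀ x c, J x c ≤ 1 := fun x y => ind_le_one _
  have hJs : ∀ x c, J x c = J c x := by
    intro x c
    refine ind_congr ⟨fun h => ⟨h.1.symm, fun h' => h.2 (h'.symm hE)⟩,
      fun h => ⟨h.1.symm, fun h' => h.2 (h'.symm hE)⟩⟩
  have hJb : ∀ x, b * ∑ c ∈ A, J x c ≤
      ∑ c ∈ A, ∑ y ∈ B, ind (x ≠ c ∧ ¬ E x c y) + a * ∑ y ∈ B, I x y := by
    intro x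
    have : a * ∑ y ∈ B, I x y = ∑ c ∈ A, ∑ y ∈ B, I x y := by simp [ha]
    rw [this, ← sum_add_distrib, mul_sum]
    refine sum_le_sum fun c _ => ?_
    rw [← sum_add_distrib]
    have : b * J x c = ∑ y ∈ B, J x c := by simp [hb]
    rw [this]
    refine sum_le_sum fun y hy => ind_or_le ?_
    rintro ⟨h1, h2⟩
    by_contra hc
    push Not at hc
    exact h2 ⟨y, hy, hc.1 h1, Or.inl hc.2⟩
  have hdeg : ∀ x ∈ A, ∑ c ∈ A, J x c ≤ 0.0014 * N := by
    intro x hx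
    have h1 := hJb x
    have h2 : ∑ c ∈ A, ∑ y ∈ B, ind (x ≠ c ∧ ¬ E x c y) ≤ mA E A B x :=
      sum_le_sum fun c _ => sum_le_sum fun y _ => ind_mono fun h => h.2
    have h3 : (0.5085 * N) * ∑ y ∈ B, I x y ≤ mA E A B x := by
      rw [mA_eq_mp, mul_sum]
      refine sum_le_sum fun y hy => ?_
      rcases hI01 x y with h | h
      · rw [h]; simpa using mp_nonneg x y
      · rw [h]; linarith [hmp x y hy h]
    have h4 := hmA x hx
    have h5 : ∑ y ∈ B, I x y ≤ 0.0004 * N := by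
      by_contra hc
      push Not at hc
      have : (0.5085 * N) * (0.0004 * N) ≤ (0.5085 * N) * ∑ y ∈ B, I x y :=
        mul_le_mul_of_nonneg_left hc.le (by positivity)
      nlinarith [sq_pos_of_pos hN0]
    have h6 : a * ∑ y ∈ B, I x y ≤ (0.6341 * N) * (0.0004 * N) :=
      mul_le_mul ha2 h5 (sum_nonneg fun y _ => hI0 x y) (by positivity)
    by_contra hc
    push Not at hc
    have : (0.3658 * N) * (0.0014 * N) ≤ b * ∑ c ∈ A, J x c :=
      mul_le_mul hb1 hc.le (by positivity) (by positivity)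
    nlinarith [sq_pos_of_pos hN0]
  set R := ∑ x ∈ A, ∑ c ∈ A, J x c with hR
  have hR0 : 0 ≤ R := sum_nonneg fun y _ => sum_nonneg fun x _ => hJ0 _ _
  have hRb : b * R ≤ Mo E A B + a * Bad := by
    have h2 : Bad = ∑ x ∈ A, ∑ y ∈ B, I x y := sum_comm
    rw [hR, h2, mul_sum, mul_sum]
    unfold Mo
    rw [← sum_add_distrib]
    exact sum_le_sum fun x _ => hJb x
  have hAAA : AAA E A ≤ 3 * (0.0014 * N * R) := by
    have h1 : AAA E A ≤ ∑ x ∈ A, ∑ y ∈ A, ∑ z ∈ A,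
        (J x y * J x z + J x y * J y z + J x z * J y z) := by
      refine sum_le_sum fun x _ => sum_le_sum fun y _ => sum_le_sum fun z _ => ?_
      by_cases e : E x y z
      · rw [ind_pos e]
        have n1 := hE.ne e
        have n2 := hE.ne (hE.rot e)
        have n3 := hE.ne (hE.swap' e)
        have c1 : ¬ (okA E A B N x y ∧ okA E A B N x z) := fun h =>
          AAA_bad hE hO hN0 hAN hBN hM e h.1 h.2
        have c2 : ¬ (okA E A B N x y ∧ okA E A B N y z) := fun h =>
          AAA_bad hE hO hN0 hAN hBN hM (hE.swap e) (h.1.symm hE) h.2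
        have c3 : ¬ (okA E A B N x z ∧ okA E A B N y z) := fun h =>
          AAA_bad hE hO hN0 hAN hBN hM (hE.rot (hE.rot e)) (h.1.symm hE) (h.2.symm hE)
        have hp : ∀ {u v}, u ≠ v → ¬ okA E A B N u v → J u v = 1 := fun h h' => ind_pos ⟨h, h'⟩
        by_cases d1 : okA E A B N x y
        · have d2 : ¬ okA E A B N x z := fun h => c1 ⟨d1, h⟩
          have d3 : ¬ okA E A B N y z := fun h => c2 ⟨d1, h⟩
          rw [hp n3 d2, hp n2 d3]; linarith [hJ0 x y]
        · rw [hp n1 d1]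
          by_cases d2 : okA E A B N x z
          · have d3 : ¬ okA E A B N y z := fun h => c3 ⟨d2, h⟩
            rw [hp n2 d3]; linarith [hJ0 x z]
          · rw [hp n3 d2]; linarith [hJ0 y z]
      · rw [ind_neg e]
        have := hJ0
        have t1 := mul_nonneg (hJ0 x y) (hJ0 x z)
        have t2 := mul_nonneg (hJ0 x y) (hJ0 y z)
        have t3 := mul_nonneg (hJ0 x z) (hJ0 y z)
        linarith
    have e1 : ∑ x ∈ A, ∑ y ∈ A, ∑ z ∈ A, J x y * J x z
        = ∑ x ∈ A, (∑ y ∈ A, J x y) * (∑ z ∈ A, J x z) := by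
      refine sum_congr rfl fun x _ => ?_
      rw [sum_mul_sum]
    have e2 : ∑ x ∈ A, ∑ y ∈ A, ∑ z ∈ A, J x y * J y z
        = ∑ x ∈ A, (∑ y ∈ A, J x y) * (∑ z ∈ A, J x z) := by
      rw [sum_comm, ← e1]
      refine sum_congr rfl fun x _ => sum_congr rfl fun y _ => sum_congr rfl fun z _ => by
        rw [hJs x y]
    have e3 : ∑ x ∈ A, ∑ y ∈ A, ∑ z ∈ A, J x z * J y z
        = ∑ x ∈ A, (∑ y ∈ A, J x y) * (∑ z ∈ A, J x z) := by
      rw [← e2]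
      refine sum_congr rfl fun x _ => ?_
      rw [sum_comm]
      refine sum_congr rfl fun y _ => sum_congr rfl fun z _ => by rw [hJs y z]
    have e4 : ∑ x ∈ A, (∑ y ∈ A, J x y) * (∑ z ∈ A, J x z) ≤ 0.0014 * N * R := by
      rw [hR, mul_sum]
      refine sum_le_sum fun x hx => ?_
      exact mul_le_mul_of_nonneg_right (hdeg x hx) (sum_nonneg fun c _ => hJ0 x c)
    simp only [sum_add_distrib] at h1
    rw [e1, e2, e3] at h1
    linarith
  -- conclude
  have hMo := Mo_nonneg (E := E) (A := A) (B := B)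
  have f1 : b * Bad ≤ 0.3662 * N * Bad := mul_le_mul_of_nonneg_right hb2 hBad0
  have f2 : a * Bad ≤ 0.6341 * N * Bad := mul_le_mul_of_nonneg_right ha2 hBad0
  have f3 : 0.3658 * N * R ≤ b * R := mul_le_mul_of_nonneg_right hb1 hR0
  have f4 : N * Bad ≤ Mo E A B / 0.862 := by
    rw [le_div_iff₀ (by norm_num)]; linarith
  have f5 : N * R ≤ 4.9 * Mo E A B := by
    have : 0.3658 * (N * R) ≤ Mo E A B + 0.6341 * (N * Bad) := by linarith
    linarith
  linarith

end cnt
end PCyc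

namespace PCyc
open Finset

set_option maxHeartbeats 1000000 in
lemma vert_num {a b a1 a2 b1 eAA eAB eBB : ℝ} (ha : |a - al| ≤ 0.00004) (hb : |b - (1 - al)| ≤ 0.00004)
    (hab : a + b ≤ 1) (h1 : 0 ≤ a1) (h2 : 0 ≤ a2) (h3 : 0 ≤ b1) (h4 : b1 ≤ b) (h5 : a1 + a2 ≤ a)
    (h6 : eAA ≤ a1 ^ 2 + 0.00000001) (h7 : eAB ≤ a2 * b1 + 0.00000001) (h8 : eBB ≤ b ^ 2 - b1 ^ 2)
    (h9 : 3 * mu - 0.00003 ≤ eAA + 2 * eAB + eBB) :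
    (a * b - 0.0001 ≤ eAB ∧ eAA ≤ 0.001) ∨ (eAB ≤ 0.03 ∧ 0.324 ≤ eAA) := by
  rw [abs_le] at ha hb
  have l1 := al_lo
  have l2 := al_hi
  have m1 := mu_lo
  have m2 := mu_hi
  have hme := mu_eq
  obtain ⟨u, hu⟩ : ∃ u, u = a - a2 := ⟨_, rfl⟩
  obtain ⟨w, hw⟩ : ∃ w, w = b - b1 := ⟨_, rfl⟩
  have hu0 : 0 ≤ u := by linarith
  have hw0 : 0 ≤ w := by linarith
  have hua : u ≤ a := by linarith
  have hwb : w ≤ b := by linarith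
  have hau : a1 ≤ u := by linarith
  have ea2 : a2 = a - u := by linarith
  have eb1 : b1 = b - w := by linarith
  have hsq : a1 ^ 2 ≤ u ^ 2 := pow_le_pow_left₀ h1 hau 2
  rw [ea2, eb1] at h7
  rw [eb1] at h8
  have h2ab : 2 * (a * b) ≤ 3 * mu + 0.000023 := by
    have : a * b ≤ a * (1 - a) := mul_le_mul_of_nonneg_left (by linarith) (by linarith)
    have e : a * (1 - a) = al * (1 - al) + (a - al) * (1 - 2 * al) - (a - al) ^ 2 := by ring
    have : (a - al) * (1 - 2 * al) ≤ 0.00004 * 0.268 := by nlinarith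
    nlinarith [sq_nonneg (a - al)]
  have hG : (a - b) * w + b * u - u ^ 2 / 2 - u * w + w ^ 2 / 2 ≤ 0.000027 := by
    linarith
  have sw := sq_nonneg w
  have p1 : 0.2678 * w ≤ (a - b) * w := mul_le_mul_of_nonneg_right (by linarith) hw0
  have p2 : 0.3659 * u ≤ b * u := mul_le_mul_of_nonneg_right (by linarith) hu0
  rcases le_or_gt u 0.26 with hc | hc
  · left
    have q1 : u * w ≤ 0.26 * w := mul_le_mul_of_nonneg_right hc hw0
    have q2 : u * u ≤ 0.26 * u := mul_le_mul_of_nonneg_right hc hu0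
    have ub : u ≤ 0.00012 := by linarith only [hG, p1, p2, q1, q2, sw, hw0, hu0]
    have q3 : u * w ≤ 0.00012 * w := mul_le_mul_of_nonneg_right ub hw0
    have wb : w ≤ 0.000102 := by linarith only [hG, p1, p2, q3, q2, sw, hw0, hu0]
    have q4 : u ^ 2 ≤ 0.000001 := by
      have := pow_le_pow_left₀ hu0 ub 2
      linarith only [this]
    have q5 : b * w ≤ 0.3661 * w := mul_le_mul_of_nonneg_right (by linarith) hw0
    constructor
    · have q6 : b ^ 2 - (b - w) ^ 2 ≤ 2 * (b * w) := by linarith only [sw]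
      linarith
    · linarith
  · rcases le_or_gt u 0.56 with hd | hd
    · exfalso
      have q1 : 0 ≤ (u - 0.26) * (0.56 - u) := mul_nonneg (by linarith) (by linarith)
      have q2 := sq_nonneg (w - (u - (a - b)))
      have q3 : (a - b) ^ 2 ≤ 0.2682 ^ 2 := pow_le_pow_left₀ (by linarith) (by linarith) 2
      have q4 : 0.6339 * u ≤ a * u := mul_le_mul_of_nonneg_right (by linarith) hu0
      linarith only [hG, q1, q2, q3, q4, hc, hd]
    · right
      have q1 : (a - u) * (b - w) ≤ 0.0741 * 0.3661 :=
        mul_le_mul (by linarith) (by linarith) (by linarith) (by norm_num)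
      constructor
      · linarith
      · have q2 : 2 * ((a - u) * (b - w)) + (b ^ 2 - (b - w) ^ 2) ≤ b ^ 2 + (a - u) ^ 2 := by
          linarith [sq_nonneg ((a - u) - (b - w))]
        have q3 : b ^ 2 ≤ 0.3661 ^ 2 := pow_le_pow_left₀ (by linarith) (by linarith) 2
        have q4 : (a - u) ^ 2 ≤ 0.0741 ^ 2 := pow_le_pow_left₀ (by linarith) (by linarith) 2
        linarith

section vert
variable {V : Type} [DecidableEq V] {E : V → V → V → Prop} {A B : Finset V} {N : ℝ}

noncomputable def eAA (E : V → V → V → Prop) (A B : Finset V) (v : V) : ℝ :=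
  ∑ x ∈ A, ∑ y ∈ B, ind (E v x y)

lemma NB_le (hE : Sys E) (hN : 0 < N) (ha1 : 0.6339 * N ≤ A.card) (ha2 : (A.card : ℝ) ≤ 0.6341 * N)
    (hM : Mf E A B ≤ 0.0000000002 * N ^ 3) :
    ∑ x ∈ A, ∑ y ∈ B, ind (¬ ok E A N x y) ≤ 0.000000001 * N ^ 2 := by
  set a : ℝ := (A.card : ℝ) with ha
  have h1 : ∑ x ∈ A, ∑ y ∈ B, ((a ^ 2 - 0.001 * N ^ 2) * ind (¬ ok E A N x y)) ≤
      ∑ x ∈ A, ∑ y ∈ B, (a * mp E A x y + mB E A y) := by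
    refine sum_le_sum fun x _ => sum_le_sum fun y _ => ?_
    by_cases h : ok E A N x y
    · rw [ind_neg (not_not.mpr h), mul_zero]
      have := mp_nonneg (E := E) (A := A) x y
      have := mB_nonneg (E := E) (A := A) y
      positivity
    · rw [ind_pos h, mul_one]; exact not_ok_ineq hE h
  have h2 : ∑ x ∈ A, ∑ y ∈ B, (a * mp E A x y + mB E A y) = 2 * (a * Mf E A B) := by
    simp only [sum_add_distrib, ← mul_sum, ← mA_eq_mp, ← Mf_eq_mA, ← Mf_eq_mB, sum_const,
      nsmul_eq_mul]
    ring
  rw [h2] at h1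
  simp only [← mul_sum] at h1
  have h3 : a * Mf E A B ≤ (0.6341 * N) * (0.0000000002 * N ^ 3) :=
    mul_le_mul ha2 hM Mf_nonneg (by positivity)
  by_contra hc
  push Not at hc
  have h4 : 0.4 * N ^ 2 ≤ a ^ 2 - 0.001 * N ^ 2 := by nlinarith
  have h5 : (0.4 * N ^ 2) * (0.000000001 * N ^ 2) ≤
    (a ^ 2 - 0.001 * N ^ 2) * ∑ x ∈ A, ∑ y ∈ B, ind (¬ ok E A N x y) :=
    mul_le_mul h4 hc.le (by positivity) (le_trans (by positivity) h4)
  have : 0 < N ^ 4 := by positivity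
  nlinarith

lemma NA_le (hE : Sys E) (hN : 0 < N) (ha1 : 0.6339 * N ≤ A.card) (ha2 : (A.card : ℝ) ≤ 0.6341 * N)
    (hb1 : 0.3658 * N ≤ B.card)
    (hM : Mf E A B ≤ 0.0000000002 * N ^ 3) :
    ∑ x ∈ A, ∑ c ∈ A, ind (¬ okA E A B N x c) ≤ 0.000000003 * N ^ 2 := by
  have h0 := NB_le hE hN ha1 ha2 hM
  set a : ℝ := (A.card : ℝ) with ha
  set b : ℝ := (B.card : ℝ) with hb
  have h1 : b * ∑ x ∈ A, ∑ c ∈ A, ind (¬ okA E A B N x c) ≤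
      Mf E A B + a * ∑ x ∈ A, ∑ y ∈ B, ind (¬ ok E A N x y) := by
    have e1 : a * ∑ x ∈ A, ∑ y ∈ B, ind (¬ ok E A N x y)
        = ∑ x ∈ A, ∑ c ∈ A, ∑ y ∈ B, ind (¬ ok E A N x y) := by
      rw [mul_sum]; simp [ha]
    rw [e1, mul_sum]
    unfold Mf
    rw [← sum_add_distrib]
    refine sum_le_sum fun x _ => ?_
    rw [← sum_add_distrib, mul_sum]
    refine sum_le_sum fun c _ => ?_
    rw [← sum_add_distrib]
    have : b * ind (¬ okA E A B N x c) = ∑ y ∈ B, ind (¬ okA E A B N x c) := by simp [hb]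
    rw [this]
    refine sum_le_sum fun y hy => ind_or_le ?_
    intro h2
    by_contra hc
    push Not at hc
    exact h2 ⟨y, hy, hc.1, Or.inl hc.2⟩
  have h3 : a * ∑ x ∈ A, ∑ y ∈ B, ind (¬ ok E A N x y) ≤ (0.6341 * N) * (0.000000001 * N ^ 2) :=
    mul_le_mul ha2 h0 (sum_nonneg fun _ _ => sum_nonneg fun _ _ => ind_nonneg _) (by positivity)
  by_contra hc
  push Not at hc
  have h5 : (0.3658 * N) * (0.000000003 * N ^ 2) ≤
    b * ∑ x ∈ A, ∑ c ∈ A, ind (¬ okA E A B N x c) :=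
    mul_le_mul hb1 hc.le (by positivity) (by positivity)
  have : 0 < N ^ 3 := by positivity
  nlinarith

theorem vert (hE : Sys E) (hO : NoOdd E 100) (hN : 0 < N) (hd : Disjoint A B)
    (ha : |(A.card : ℝ) - al * N| ≤ 0.00004 * N) (hb : |(B.card : ℝ) - (1 - al) * N| ≤ 0.00004 * N)
    (hab : (A.card : ℝ) + B.card ≤ N) (hM : Mf E A B ≤ 0.0000000002 * N ^ 3) (v : V)
    (hv : (3 * mu - 0.00003) * N ^ 2 ≤ ∑ x ∈ A ∪ B, ∑ y ∈ A ∪ B, ind (E v x y)) :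
    ((A.card : ℝ) * B.card - 0.0001 * N ^ 2 ≤ eAA E A B v ∧ eAA E A A v ≤ 0.001 * N ^ 2) ∨
    (eAA E A B v ≤ 0.03 * N ^ 2 ∧ 0.324 * N ^ 2 ≤ eAA E A A v) := by
  have l1 := al_lo
  have l2 := al_hi
  have ha' := abs_le.mp ha
  have hb' := abs_le.mp hb
  have ha1 : 0.6339 * N ≤ A.card := by nlinarith
  have ha2 : (A.card : ℝ) ≤ 0.6341 * N := by nlinarith
  have hb1 : 0.3658 * N ≤ B.card := by nlinarith
  have hNB := NB_le hE hN ha1 ha2 hM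
  have hNA := NA_le hE hN ha1 ha2 hb1 hM
  have hAN : (A.card : ℝ) ≤ N := by linarith
  have hBN : 0.3 * N ≤ B.card := by linarith
  have hM2 : Mf E A B ≤ 0.00000002 * N ^ 3 := hM.trans (by gcongr; norm_num)
  set a1 := ∑ x ∈ A, ind (Lev E A N 30 v x 2) with ha1d
  set a2 := ∑ x ∈ A, ind (Lev E A N 30 v x 0) with ha2d
  set b1 := ∑ y ∈ B, ind (Lev E A N 8 v y 1) with hb1d
  have g1 : 0 ≤ a1 := sum_ind_nonneg _ _
  have g2 : 0 ≤ a2 := sum_ind_nonneg _ _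
  have g3 : 0 ≤ b1 := sum_ind_nonneg _ _
  have g4 : b1 ≤ B.card := sum_ind_le _ _
  have g5 : a1 + a2 ≤ A.card := by
    rw [ha1d, ha2d, ← sum_add_distrib]
    have : (A.card : ℝ) = ∑ x ∈ A, (1 : ℝ) := by simp
    rw [this]
    refine sum_le_sum fun x _ => ?_
    by_cases h1 : Lev E A N 30 v x 2
    · by_cases h2 : Lev E A N 30 v x 0
      · have := lev_unique hE hO hN hAN hBN hM2 h1 h2
        exact absurd this (by decide)
      · rw [ind_neg h2]; linarith [ind_le_one (Lev E A N 30 v x 2)]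
    · rw [ind_neg h1]; linarith [ind_le_one (Lev E A N 30 v x 0)]
  have g6 : eAA E A A v ≤ a1 ^ 2 + 0.000000003 * N ^ 2 := by
    refine le_trans ?_ (add_le_add le_rfl hNA)
    rw [sq, ha1d, sum_mul_sum, ← sum_add_distrib]
    unfold eAA
    refine sum_le_sum fun x _ => ?_
    rw [← sum_add_distrib]
    refine sum_le_sum fun y _ => ?_
    rw [← ind_and]
    refine ind_or_le fun e => ?_
    by_cases h : okA E A B N x y
    · left; exact lev_vAA hE e h
    · right; exact h
  have g7 : eAA E A B v ≤ a2 * b1 + 0.000000001 * N ^ 2 := by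
    refine le_trans ?_ (add_le_add le_rfl hNB)
    rw [ha2d, hb1d, sum_mul_sum, ← sum_add_distrib]
    unfold eAA
    refine sum_le_sum fun x _ => ?_
    rw [← sum_add_distrib]
    refine sum_le_sum fun y _ => ?_
    rw [← ind_and]
    refine ind_or_le fun e => ?_
    by_cases h : ok E A N x y
    · left; exact lev_vAB hE e h
    · right; exact h
  have g8 : eAA E B B v ≤ (B.card : ℝ) ^ 2 - b1 ^ 2 := by
    have e : (B.card : ℝ) ^ 2 = ∑ c ∈ B, ∑ d ∈ B, (1 : ℝ) := by simp; ring
    rw [e, sq b1, hb1d, sum_mul_sum, ← sum_sub_distrib]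
    unfold eAA
    refine sum_le_sum fun x _ => ?_
    rw [← sum_sub_distrib]
    refine sum_le_sum fun y _ => ?_
    rw [← ind_and, ← ind_not]
    exact ind_mono fun e h => lev_vBB hE hO hN hAN hBN hM2 e h.1 h.2
  have g9 : ∑ x ∈ A ∪ B, ∑ y ∈ A ∪ B, ind (E v x y)
      = eAA E A A v + 2 * eAA E A B v + eAA E B B v := by
    have e1 : ∑ x ∈ B, ∑ y ∈ A, ind (E v x y) = ∑ x ∈ A, ∑ y ∈ B, ind (E v x y) := by
      rw [sum_comm]
      exact sum_congr rfl fun x _ => sum_congr rfl fun y _ => ind_congr hE.swap'_iff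
    rw [sum_union hd]
    simp only [sum_union hd, sum_add_distrib]
    rw [e1]
    unfold eAA
    ring
  rw [g9] at hv
  have hN2 : 0 < N ^ 2 := by positivity
  have key := vert_num (a := A.card / N) (b := B.card / N) (a1 := a1 / N) (a2 := a2 / N)
    (b1 := b1 / N) (eAA := eAA E A A v / N ^ 2) (eAB := eAA E A B v / N ^ 2)
    (eBB := eAA E B B v / N ^ 2)
    (by
      have : (A.card : ℝ) / N - al = (A.card - al * N) / N := by field_simp
      rw [this, abs_div, abs_of_pos hN, div_le_iff₀ hN]; exact ha)
    (by
      have : (B.card : ℝ) / N - (1 - al) = (B.card - (1 - al) * N) / N := by field_simp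
      rw [this, abs_div, abs_of_pos hN, div_le_iff₀ hN]; exact hb)
    (by rw [← add_div, div_le_one hN]; exact hab)
    (by positivity) (by positivity) (by positivity)
    (by gcongr) (by rw [← add_div]; gcongr)
    (by
      rw [div_le_iff₀ hN2, add_mul, div_pow, div_mul_cancel₀ _ hN2.ne']
      refine g6.trans ?_; gcongr; norm_num)
    (by
      rw [div_le_iff₀ hN2, add_mul, div_mul_div_comm, ← sq, div_mul_cancel₀ _ hN2.ne']
      refine g7.trans ?_; gcongr; norm_num)
    (by
      rw [div_le_iff₀ hN2, div_pow, div_pow, ← sub_div, div_mul_cancel₀ _ hN2.ne']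
      exact g8)
    (by
      rw [mul_div_assoc', ← add_div, ← add_div, le_div_iff₀ hN2]; exact hv)
  rw [div_mul_div_comm, ← sq, div_le_iff₀ hN2, div_le_iff₀ hN2, le_div_iff₀ hN2,
    le_div_iff₀ hN2, sub_mul, div_mul_cancel₀ _ hN2.ne'] at key
  exact key
end vert
end PCyc

namespace PCyc
open Finset
section reb
variable {V : Type} [DecidableEq V] {E : V → V → V → Prop} {A B : Finset V} {N : ℝ}

lemma sum_patch {P' P X : Finset V} (h : P' ⊆ P ∪ X) (g : V → ℝ) (C : ℝ) (h0 : ∀ x, 0 ≤ g x)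
    (h1 : ∀ x, g x ≤ C) : ∑ x ∈ P', g x ≤ ∑ x ∈ P, g x + X.card * C := by
  calc ∑ x ∈ P', g x ≤ ∑ x ∈ P ∪ X, g x := sum_le_sum_of_subset_of_nonneg h fun x _ _ => h0 x
    _ ≤ ∑ x ∈ P, g x + ∑ x ∈ X, g x := by
        rw [← sum_union_inter]
        linarith [sum_nonneg (s := P ∩ X) fun x _ => h0 x]
    _ ≤ _ := by
        have := sum_le_card_nsmul X g C fun x _ => h1 x
        rw [nsmul_eq_mul] at this
        linarith

lemma sum_ind_le' (S : Finset V) (p : V → Prop) (h : (S.card : ℝ) ≤ N) : ∑ x ∈ S, ind (p x) ≤ N :=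
  (sum_ind_le S p).trans h

lemma sum_patch2 {P' P Q' Q X : Finset V} (h : P' ⊆ P ∪ X) (h' : Q' ⊆ Q ∪ X) (t : V → V → Prop)
    (hP : (P.card : ℝ) ≤ N) (hQ : (Q'.card : ℝ) ≤ N) :
    ∑ x ∈ P', ∑ y ∈ Q', ind (t x y) ≤ ∑ x ∈ P, ∑ y ∈ Q, ind (t x y) + 2 * (X.card * N) := by
  have h1 := sum_patch h (fun x => ∑ y ∈ Q', ind (t x y)) N (fun x => sum_ind_nonneg _ _)
    (fun x => sum_ind_le' _ _ hQ)
  have h2 : ∑ x ∈ P, ∑ y ∈ Q', ind (t x y) ≤ ∑ x ∈ P, (∑ y ∈ Q, ind (t x y) + X.card * 1) :=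
    sum_le_sum fun x _ => sum_patch h' _ 1 (fun y => ind_nonneg _) (fun y => ind_le_one _)
  rw [sum_add_distrib, sum_const, nsmul_eq_mul] at h2
  have h3 : (P.card : ℝ) * (X.card * 1) ≤ N * (X.card * 1) :=
    mul_le_mul_of_nonneg_right hP (by positivity)
  linarith

lemma sum2_le {P Q : Finset V} (t : V → V → Prop) (hP : (P.card : ℝ) ≤ N) (hQ : (Q.card : ℝ) ≤ N) :
    ∑ x ∈ P, ∑ y ∈ Q, ind (t x y) ≤ N * N := by
  have h := sum_le_card_nsmul P (fun x => ∑ y ∈ Q, ind (t x y)) N fun x _ => sum_ind_le' _ _ hQ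
  rw [nsmul_eq_mul] at h
  have : (P.card : ℝ) * N ≤ N * N := mul_le_mul_of_nonneg_right hP (le_trans (by positivity) hP)
  linarith

lemma sum_patch3 {P' P Q' Q X : Finset V} (h : P' ⊆ P ∪ X) (h' : Q' ⊆ Q ∪ X)
    (t : V → V → V → Prop)
    (hP' : (P'.card : ℝ) ≤ N) (hP : (P.card : ℝ) ≤ N) (hQ : (Q'.card : ℝ) ≤ N) :
    ∑ w ∈ P', ∑ x ∈ P', ∑ y ∈ Q', ind (t w x y) ≤
      ∑ w ∈ P, ∑ x ∈ P, ∑ y ∈ Q, ind (t w x y) + 3 * (X.card * N ^ 2) := by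
  have h1 := sum_patch h (fun w => ∑ x ∈ P', ∑ y ∈ Q', ind (t w x y)) (N * N)
    (fun x => sum_nonneg fun _ _ => sum_ind_nonneg _ _)
    (fun x => sum2_le _ hP' hQ)
  have h2 : ∑ w ∈ P, ∑ x ∈ P', ∑ y ∈ Q', ind (t w x y) ≤
      ∑ w ∈ P, (∑ x ∈ P, ∑ y ∈ Q, ind (t w x y) + 2 * (X.card * N)) :=
    sum_le_sum fun x _ => sum_patch2 h h' _ hP hQ
  rw [sum_add_distrib, sum_const, nsmul_eq_mul] at h2
  have h3 : (P.card : ℝ) * (2 * (X.card * N)) ≤ N * (2 * (X.card * N)) :=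
    mul_le_mul_of_nonneg_right hP (by have := le_trans (by positivity) hP; positivity)
  nlinarith

theorem rebalance (hE : Sys E) (hO : NoOdd E 100) (hN : 1000000 ≤ N) (hd : Disjoint A B)
    (ha : |(A.card : ℝ) - al * N| ≤ 0.00004 * N) (hb : |(B.card : ℝ) - (1 - al) * N| ≤ 0.00004 * N)
    (hab : (A.card : ℝ) + B.card ≤ N) (hM : Mf E A B ≤ 0.0000000002 * N ^ 3)
    (hv : ∀ v ∈ A ∪ B, (3 * mu - 0.00003) * N ^ 2 ≤ ∑ x ∈ A ∪ B, ∑ y ∈ A ∪ B, ind (E v x y)) :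
    ∃ A' B' : Finset V, Disjoint A' B' ∧ A' ∪ B' = A ∪ B ∧ 0.6339 * N ≤ A'.card ∧
      0.3658 * N ≤ B'.card ∧ AAA E A' + 3 * ABB E A' B' ≤ 2.9 * Mo E A' B' := by
  classical
  have l1 := al_lo
  have l2 := al_hi
  have hN0 : 0 < N := by linarith
  have ha' := abs_le.mp ha
  have hb' := abs_le.mp hb
  have ha1 : 0.63393 * N ≤ A.card := by nlinarith
  have ha2 : (A.card : ℝ) ≤ 0.63402 * N := by nlinarith
  have hb1 : 0.36598 * N ≤ B.card := by nlinarith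
  have hb2 : (B.card : ℝ) ≤ 0.36607 * N := by nlinarith
  have hN2 : 0 < N ^ 2 := by positivity
  have hmA : ∀ x, mA E A B x = A.card * B.card - eAA E A B x := by
    intro x
    unfold mA eAA
    simp only [ind_not, sum_sub_distrib]
    simp
  have hmB : ∀ y, mB E A y = (A.card : ℝ) ^ 2 - eAA E A A y := by
    intro y
    unfold mB eAA
    have : ∀ c d, E c d y ↔ E y c d := fun c d => ⟨fun h => hE.rot (hE.rot h), fun h => hE.rot h⟩
    simp only [ind_not, sum_sub_distrib, this]
    simp [sq]
  have hD := fun v hvS => vert hE hO hN0 hd ha hb hab hM v (hv v hvS)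
  set S := A ∪ B with hS
  have hScard : (S.card : ℝ) ≤ N := by
    rw [hS, card_union_of_disjoint hd]; push_cast; exact hab
  set A' := S.filter (fun v => 0.1 * N ^ 2 ≤ eAA E A B v) with hA'
  set B' := S.filter (fun v => ¬ 0.1 * N ^ 2 ≤ eAA E A B v) with hB'
  have hab2 : 0.23 * N ^ 2 ≤ (A.card : ℝ) * B.card := by
    have : (0.63393 * N) * (0.36598 * N) ≤ (A.card : ℝ) * B.card :=
      mul_le_mul ha1 hb1 (by positivity) (by positivity)
    nlinarith
  have haa1 : 0.4 * N ^ 2 ≤ (A.card : ℝ) ^ 2 := by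
    have := pow_le_pow_left₀ (by positivity) ha1 2
    nlinarith
  have haa2 : (A.card : ℝ) ^ 2 ≤ 0.402 * N ^ 2 := by
    have := pow_le_pow_left₀ (by positivity) ha2 2
    nlinarith
  have hA'l : ∀ x ∈ A', (A.card : ℝ) * B.card - 0.0001 * N ^ 2 ≤ eAA E A B x ∧
      eAA E A A x ≤ 0.001 * N ^ 2 := by
    intro x hx
    rw [hA', mem_filter] at hx
    rcases hD x hx.1 with h | h
    · exact h
    · exfalso; linarith [h.1, hx.2]
  have hB'l : ∀ x ∈ B', eAA E A B x ≤ 0.03 * N ^ 2 ∧ 0.324 * N ^ 2 ≤ eAA E A A x := by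
    intro x hx
    rw [hB', mem_filter] at hx
    rcases hD x hx.1 with h | h
    · exfalso; linarith [h.1, hx.2]
    · exact h
  have hdis : Disjoint A' B' := disjoint_filter_filter_not _ _ _
  have hun : A' ∪ B' = S := filter_union_filter_not_eq _ _
  set X := (A \ A') ∪ (B \ B') with hX
  have hX1 : ((A \ A').card : ℝ) ≤ 0.000000001 * N := by
    have h1 : ∑ x ∈ A \ A', (0.2 * N ^ 2) ≤ Mf E A B := by
      rw [Mf_eq_mA]
      refine le_trans (sum_le_sum (g := fun x => mA E A B x) fun x hx => ?_)
        (sum_le_sum_of_subset_of_nonneg sdiff_subset fun x _ _ => mA_nonneg x)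
      rw [mem_sdiff] at hx
      have hxB : x ∈ B' := by
        have : x ∈ A' ∪ B' := by rw [hun, hS]; exact mem_union_left _ hx.1
        rcases mem_union.mp this with h | h
        · exact absurd h hx.2
        · exact h
      rw [hmA]
      linarith [(hB'l x hxB).1]
    rw [sum_const, nsmul_eq_mul] at h1
    have h2 : ((A \ A').card : ℝ) * (0.2 * N ^ 2) ≤ (0.000000001 * N) * (0.2 * N ^ 2) := by
      linarith
    exact le_of_mul_le_mul_right h2 (by positivity)
  have hX2 : ((B \ B').card : ℝ) ≤ 0.000000001 * N := by
    have h1 : ∑ x ∈ B \ B', (0.2 * N ^ 2) ≤ Mf E A B := by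
      rw [Mf_eq_mB]
      refine le_trans (sum_le_sum (g := fun x => mB E A x) fun x hx => ?_)
        (sum_le_sum_of_subset_of_nonneg sdiff_subset fun x _ _ => mB_nonneg x)
      rw [mem_sdiff] at hx
      have hxB : x ∈ A' := by
        have : x ∈ A' ∪ B' := by rw [hun, hS]; exact mem_union_right _ hx.1
        rcases mem_union.mp this with h | h
        · exact h
        · exact absurd h hx.2
      rw [hmB]
      linarith [(hA'l x hxB).2]
    rw [sum_const, nsmul_eq_mul] at h1
    have h2 : ((B \ B').card : ℝ) * (0.2 * N ^ 2) ≤ (0.000000001 * N) * (0.2 * N ^ 2) := by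
      linarith
    exact le_of_mul_le_mul_right h2 (by positivity)
  have hXc : (X.card : ℝ) ≤ 0.000000002 * N := by
    have := card_union_le (A \ A') (B \ B')
    have h : (X.card : ℝ) ≤ (A \ A').card + (B \ B').card := by exact_mod_cast this
    linarith
  have sA : A' ⊆ A ∪ X := by
    intro x hx
    by_cases h : x ∈ A
    · exact mem_union_left _ h
    · refine mem_union_right _ (mem_union_right _ (mem_sdiff.mpr ⟨?_, ?_⟩))
      · have : x ∈ S := (mem_filter.mp hx).1
        rcases mem_union.mp this with h' | h'
        · exact absurd h' h
        · exact h'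
      · exact disjoint_left.mp hdis hx
  have sB : B' ⊆ B ∪ X := by
    intro x hx
    by_cases h : x ∈ B
    · exact mem_union_left _ h
    · refine mem_union_right _ (mem_union_left _ (mem_sdiff.mpr ⟨?_, ?_⟩))
      · have : x ∈ S := (mem_filter.mp hx).1
        rcases mem_union.mp this with h' | h'
        · exact h'
        · exact absurd h' h
      · exact disjoint_right.mp hdis hx
  have tA : A ⊆ A' ∪ X := by
    intro x hx
    by_cases h : x ∈ A'
    · exact mem_union_left _ h
    · exact mem_union_right _ (mem_union_left _ (mem_sdiff.mpr ⟨hx, h⟩))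
  have tB : B ⊆ B' ∪ X := by
    intro x hx
    by_cases h : x ∈ B'
    · exact mem_union_left _ h
    · exact mem_union_right _ (mem_union_right _ (mem_sdiff.mpr ⟨hx, h⟩))
  have cle : ∀ {P Q : Finset V}, P ⊆ Q ∪ X → (P.card : ℝ) ≤ Q.card + 0.000000002 * N := by
    intro P Q h
    have h1 := (card_le_card h).trans (card_union_le Q X)
    have h2 : (P.card : ℝ) ≤ Q.card + X.card := by exact_mod_cast h1
    linarith
  have cA := cle sA
  have cB := cle sB
  have cA2 := cle tA
  have cB2 := cle tB
  have hA'N : (A'.card : ℝ) ≤ N := by linarith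
  have hB'N : (B'.card : ℝ) ≤ N := by linarith
  have hAN : (A.card : ℝ) ≤ N := by linarith
  have hXN : (X.card : ℝ) * N ≤ 0.000000002 * N ^ 2 := by
    have := mul_le_mul_of_nonneg_right hXc hN0.le
    linarith
  refine ⟨A', B', hdis, hun, by linarith, by linarith, ?_⟩
  refine final_count hE hO hN (by linarith) (by linarith) (by linarith) (by linarith) ?_ ?_ ?_
  · have h1 := sum_patch3 sA sB (fun x x' y => ¬ E x x' y) hA'N hAN hB'N
    have h2 : (X.card : ℝ) * N ^ 2 ≤ 0.000000002 * N * N ^ 2 := mul_le_mul_of_nonneg_right hXc hN2.le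
    have h3 : Mf E A' B' ≤ Mf E A B + 3 * (X.card * N ^ 2) := h1
    have : 0 < N ^ 3 := by positivity
    linarith
  · intro x hx
    have h1 := sum_patch2 sA sB (fun c y => ¬ E x c y) hAN hB'N
    have h3 : mA E A' B' x ≤ mA E A B x + 2 * (X.card * N) := h1
    rw [hmA] at h3
    linarith [(hA'l x hx).1]
  · intro y hy
    have h1 := sum_patch2 sA sA (fun c d => ¬ E c d y) hAN hA'N
    have h3 : mB E A' y ≤ mB E A y + 2 * (X.card * N) := h1
    rw [hmB] at h3
    linarith [(hB'l y hy).2]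
end reb
end PCyc

namespace PCyc
open Finset
section gen
variable {V : Type} [DecidableEq V] {E : V → V → V → Prop} {A B : Finset V} {N : ℝ}

lemma AAA_nonneg : 0 ≤ AAA E A :=
  sum_nonneg fun _ _ => sum_nonneg fun _ _ => sum_ind_nonneg _ _
lemma ABB_nonneg : 0 ≤ ABB E A B :=
  sum_nonneg fun _ _ => sum_nonneg fun _ _ => sum_ind_nonneg _ _

lemma Mf_le_Mo : Mf E A B ≤ Mo E A B + A.card * B.card := by
  have h1 : Mf E A B ≤ ∑ x ∈ A, ∑ c ∈ A, ∑ y ∈ B, (ind (x ≠ c ∧ ¬ E x c y) + ind (x = c)) := by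
    refine sum_le_sum fun x _ => sum_le_sum fun c _ => sum_le_sum fun y _ => ind_or_le ?_
    intro h
    by_cases hh : x = c
    · right; exact hh
    · left; exact ⟨hh, h⟩
  simp only [sum_add_distrib, sum_const, nsmul_eq_mul, ← mul_sum] at h1
  have h2 : ∑ x ∈ A, ∑ c ∈ A, ind (x = c) ≤ A.card := by
    have := sum_le_card_nsmul A (fun x => ∑ c ∈ A, ind (x = c)) 1 fun x _ => sum_diag_le A x
    simpa using this
  have h3 : (B.card : ℝ) * ∑ x ∈ A, ∑ c ∈ A, ind (x = c) ≤ B.card * A.card :=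
    mul_le_mul_of_nonneg_left h2 (by positivity)
  have : Mo E A B = ∑ x ∈ A, ∑ c ∈ A, ∑ y ∈ B, ind (x ≠ c ∧ ¬ E x c y) := rfl
  linarith

/-- Decomposition of the number of edges. -/
lemma AAA_split (hE : Sys E) {S : Finset V} (hd : Disjoint A B) (hS : A ∪ B = S) :
    AAA E S = AAA E A + 3 * ∑ x ∈ A, ∑ y ∈ A, ∑ z ∈ B, ind (E x y z) + 3 * ABB E A B + AAA E B := by
  unfold AAA ABB
  rw [sum3_split hd hS]
  have e1 : ∑ x ∈ A, ∑ y ∈ B, ∑ z ∈ A, ind (E x y z) = ∑ x ∈ A, ∑ y ∈ A, ∑ z ∈ B, ind (E x y z) := by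
    refine sum_congr rfl fun x _ => ?_
    rw [sum_comm]
    exact sum_congr rfl fun y _ => sum_congr rfl fun z _ => ind_congr hE.swap'_iff
  have e2 : ∑ x ∈ B, ∑ y ∈ A, ∑ z ∈ A, ind (E x y z) = ∑ x ∈ A, ∑ y ∈ A, ∑ z ∈ B, ind (E x y z) := by
    rw [← e1, sum_comm]
    exact sum_congr rfl fun y _ => sum_congr rfl fun z _ => sum_congr rfl fun w _ =>
      ind_congr hE.swap_iff
  have e3 : ∑ x ∈ B, ∑ y ∈ A, ∑ z ∈ B, ind (E x y z) = ∑ x ∈ A, ∑ y ∈ B, ∑ z ∈ B, ind (E x y z) := by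
    rw [sum_comm]
    exact sum_congr rfl fun y _ => sum_congr rfl fun z _ => sum_congr rfl fun w _ =>
      ind_congr hE.swap_iff
  have e4 : ∑ x ∈ B, ∑ y ∈ B, ∑ z ∈ A, ind (E x y z) = ∑ x ∈ A, ∑ y ∈ B, ∑ z ∈ B, ind (E x y z) := by
    rw [← e3]
    refine sum_congr rfl fun x _ => ?_
    rw [sum_comm]
    exact sum_congr rfl fun y _ => sum_congr rfl fun z _ => ind_congr hE.swap'_iff
  rw [e1, e2, e3, e4]
  ring

/-- `AAB` count in terms of missing. -/
lemma AAB_eq (hE : Sys E) :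
    ∑ x ∈ A, ∑ y ∈ A, ∑ z ∈ B, ind (E x y z) = ((A.card : ℝ) ^ 2 - A.card) * B.card - Mo E A B := by
  have h1 : ∀ x y z, ind (E x y z) = 1 - ind (x = y) - ind (x ≠ y ∧ ¬ E x y z) := by
    intro x y z
    by_cases h : x = y
    · have : ¬ E x y z := fun e => hE.ne e h
      rw [ind_neg this, ind_pos h, ind_neg (fun hh => hh.1 h)]; norm_num
    · rw [ind_neg h]
      by_cases e : E x y z
      · rw [ind_pos e, ind_neg (fun hh => hh.2 e)]; norm_num
      · rw [ind_neg e, ind_pos ⟨h, e⟩]; norm_num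
  unfold Mo
  simp only [h1, sum_sub_distrib, sum_const, nsmul_eq_mul, ← mul_sum, mul_one]
  have h2 : ∑ x ∈ A, ∑ c ∈ A, ind (x = c) = A.card := by
    have : ∀ x ∈ A, ∑ c ∈ A, ind (x = c) = 1 := by
      intro x hx
      rw [sum_eq_single x]
      · exact ind_pos rfl
      · intro c _ hc; exact ind_neg (fun h => hc h.symm)
      · intro h; exact absurd hx h
    rw [sum_congr rfl this]; simp
  rw [h2]
  simp
  ring

lemma AAA_remove (hE : Sys E) {U Z : Finset V} (hZ : Z ⊆ U) :
    AAA E U ≤ AAA E (U \ Z) + 3 * ∑ v ∈ Z, eAA E U U v := by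
  have hd : Disjoint (U \ Z) Z := sdiff_disjoint
  have hu : (U \ Z) ∪ Z = U := sdiff_union_of_subset hZ
  have h1 := AAA_split hE hd hu
  have hsub : U \ Z ⊆ U := sdiff_subset
  have p1 : ∑ x ∈ U \ Z, ∑ y ∈ U \ Z, ∑ z ∈ Z, ind (E x y z) = ∑ v ∈ Z, eAA E (U \ Z) (U \ Z) v := by
    unfold eAA
    rw [sum_comm (s := Z)]
    refine sum_congr rfl fun x _ => ?_
    rw [sum_comm]
    exact sum_congr rfl fun y _ => sum_congr rfl fun z _ => ind_congr
      ⟨fun h => hE.rot (hE.rot h), fun h => hE.rot h⟩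
  have p2 : ABB E (U \ Z) Z = ∑ v ∈ Z, eAA E (U \ Z) Z v := by
    unfold ABB eAA
    rw [sum_comm]
    exact sum_congr rfl fun y _ => sum_congr rfl fun z _ => sum_congr rfl fun w _ =>
      ind_congr hE.swap_iff
  have p3 : AAA E Z = ∑ v ∈ Z, eAA E Z Z v := rfl
  have p4 : ∀ v, eAA E U U v = eAA E (U \ Z) (U \ Z) v + 2 * eAA E (U \ Z) Z v + eAA E Z Z v := by
    intro v
    have e1 : ∑ x ∈ Z, ∑ y ∈ U \ Z, ind (E v x y) = ∑ x ∈ U \ Z, ∑ y ∈ Z, ind (E v x y) := by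
      rw [sum_comm]
      exact sum_congr rfl fun x _ => sum_congr rfl fun y _ => ind_congr hE.swap'_iff
    have : eAA E U U v = eAA E ((U \ Z) ∪ Z) ((U \ Z) ∪ Z) v := by rw [hu]
    rw [this]
    unfold eAA
    rw [sum_union hd]
    simp only [sum_union hd, sum_add_distrib]
    rw [e1]
    ring
  have n1 : 0 ≤ ∑ v ∈ Z, eAA E (U \ Z) Z v :=
    sum_nonneg fun _ _ => sum_nonneg fun _ _ => sum_ind_nonneg _ _
  have n2 : 0 ≤ ∑ v ∈ Z, eAA E Z Z v :=
    sum_nonneg fun _ _ => sum_nonneg fun _ _ => sum_ind_nonneg _ _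
  simp only [p4, sum_add_distrib, ← mul_sum]
  rw [h1, p1, p2, p3]
  linarith

/-- Cherry hypergraph. -/
def ChE (f : V → V → ZMod 3) (x y z : V) : Prop :=
  x ≠ y ∧ y ≠ z ∧ x ≠ z ∧ (Ch f x y z ∨ Ch f y z x ∨ Ch f x z y)

variable {f : V → V → ZMod 3}

lemma Ch.symm (hf : Anti f) {x y z : V} (h : Ch f x y z) : Ch f y x z :=
  ⟨by rw [hf, h.1]; rfl, h.2.2, h.2.1⟩

lemma ChE_sys (hf : Anti f) : Sys (ChE f) := by
  refine ⟨?_, ?_, fun h => h.1⟩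
  · rintro x y z ⟨h1, h2, h3, h⟩
    refine ⟨h1.symm, h3, h2, ?_⟩
    rcases h with h | h | h
    · exact Or.inl (h.symm hf)
    · exact Or.inr (Or.inr h)
    · exact Or.inr (Or.inl h)
  · rintro x y z ⟨h1, h2, h3, h⟩
    refine ⟨h2, h3.symm, h1.symm, ?_⟩
    rcases h with h | h | h
    · exact Or.inr (Or.inr (h.symm hf))
    · exact Or.inl h
    · exact Or.inr (Or.inl (h.symm hf))

lemma zstep1 : ∀ a b : ZMod 3, a = 0 → b = 1 → b = a + 1 := by decide
lemma zstep2 : ∀ a b c : ZMod 3, b = 0 → c = -a → c = 1 → b = a + 1 := by decide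
lemma zstep3 : ∀ a b c : ZMod 3, a = 1 → c = -b → c = 1 → b = a + 1 := by decide

lemma ChE_step (hf : Anti f) {x y z : V} (h : ChE f x y z) : f y z = f x y + 1 := by
  obtain ⟨_, _, _, h | h | h⟩ := h
  · exact zstep1 _ _ h.1 h.2.2
  · exact zstep2 _ _ _ h.1 (hf x y) h.2.1
  · exact zstep3 _ _ _ h.2.1 (hf y z) h.2.2

lemma W_val (hs : ∀ x y z, E x y z → f y z = f x y + 1) {k : ℕ} {x y u v : V}
    (h : W E k x y u v) : f u v = f x y + k := by
  induction k generalizing x y with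
  | zero => obtain ⟨rfl, rfl⟩ := h; simp
  | succ k ih =>
    obtain ⟨z, hz, h⟩ := h
    rw [ih h, hs _ _ _ hz]; push_cast; ring

lemma ChE_noOdd (hf : Anti f) (L : ℕ) : NoOdd (ChE f) L := by
  intro m _ x y h
  have := W_val (E := ChE f) (f := f) (fun x y z e => ChE_step hf e) h
  rw [← ZMod.natCast_eq_zero_iff]
  simpa using this

lemma AAA_ChE_le (S : Finset V) : AAA (ChE f) S ≤ 3 * T f S := by
  have h1 : AAA (ChE f) S ≤ ∑ x ∈ S, ∑ y ∈ S, ∑ z ∈ S,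
      (ind (Ch f x y z) + ind (Ch f y z x) + ind (Ch f x z y)) := by
    refine sum_le_sum fun x _ => sum_le_sum fun y _ => sum_le_sum fun z _ => ?_
    by_cases h : ChE f x y z
    · rw [ind_pos h]
      have n1 := ind_nonneg (Ch f x y z)
      have n2 := ind_nonneg (Ch f y z x)
      have n3 := ind_nonneg (Ch f x z y)
      obtain ⟨_, _, _, h | h | h⟩ := h <;> rw [ind_pos h] <;> linarith
    · rw [ind_neg h]
      have n1 := ind_nonneg (Ch f x y z)
      have n2 := ind_nonneg (Ch f y z x)
      have n3 := ind_nonneg (Ch f x z y)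
      linarith
  simp only [sum_add_distrib] at h1
  have e1 : ∑ x ∈ S, ∑ y ∈ S, ∑ z ∈ S, ind (Ch f y z x) = T f S := by
    unfold T
    rw [sum_comm]
    exact sum_congr rfl fun x _ => sum_comm
  have e2 : ∑ x ∈ S, ∑ y ∈ S, ∑ z ∈ S, ind (Ch f x z y) = T f S := by
    unfold T
    exact sum_congr rfl fun x _ => sum_comm
  rw [e1, e2] at h1
  have : ∑ x ∈ S, ∑ y ∈ S, ∑ z ∈ S, ind (Ch f x y z) = T f S := rfl
  linarith

lemma z01 : ∀ a : ZMod 3, a = 0 → a = 1 → False := by decide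
lemma z01n : ∀ a b : ZMod 3, a = 1 → b = -a → b = 1 → False := by decide
lemma z01m : ∀ a b : ZMod 3, a = 0 → b = -a → b = 1 → False := by decide

lemma AAA_ChE_ge (hf : Anti f) (S : Finset V) : 3 * T f S - 3 * (S.card : ℝ) ^ 2 ≤ AAA (ChE f) S := by
  have h1 : ∑ x ∈ S, ∑ y ∈ S, ∑ z ∈ S,
      (ind (Ch f x y z) + ind (Ch f y z x) + ind (Ch f x z y)) ≤
      ∑ x ∈ S, ∑ y ∈ S, ∑ z ∈ S, (ind (ChE f x y z) + ind (x = y) + ind (y = z) + ind (x = z)) := by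
    refine sum_le_sum fun x _ => sum_le_sum fun y _ => sum_le_sum fun z _ => ?_
    have nn := fun p => ind_nonneg p
    by_cases hxy : x = y
    · subst hxy
      by_cases c1 : Ch f x x z
      · have c2 : ¬ Ch f x z x := fun h => z01 _ h.1 c1.2.1
        rw [ind_neg c2, ind_pos (p := x = x) rfl]
        linarith [nn (ChE f x x z), nn (x = z), ind_le_one (Ch f x x z)]
      · rw [ind_neg c1, ind_pos (p := x = x) rfl]
        by_cases c2 : Ch f x z x
        · exact absurd c2.2.1 (by rw [hf.self]; decide)
        · rw [ind_neg c2]; linarith [nn (ChE f x x z), nn (x = z)]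
    · by_cases hyz : y = z
      · subst hyz
        rw [ind_pos (p := y = y) rfl]
        have c1 : ¬ Ch f x y y := fun h => z01 _ h.1 h.2.1
        rw [ind_neg c1]
        linarith [nn (ChE f x y y), nn (x = y), ind_le_one (Ch f y y x)]
      · by_cases hxz : x = z
        · subst hxz
          rw [ind_pos (p := x = x) rfl]
          have c1 : ¬ Ch f x y x := fun h => by
            have := h.2.1; rw [hf.self] at this; exact absurd this (by decide)
          have c2 : ¬ Ch f y x x := fun h => z01 _ h.1 h.2.1
          rw [ind_neg c1, ind_neg c2]
          linarith [nn (ChE f x y x), nn (x = y), nn (y = x), ind_le_one (Ch f x x y)]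
        · rw [ind_neg hxy, ind_neg hyz, ind_neg hxz]
          by_cases c1 : Ch f x y z
          · have c2 : ¬ Ch f y z x := fun h => z01 _ h.1 c1.2.2
            have c3 : ¬ Ch f x z y := fun h => z01 _ h.1 c1.2.1
            rw [ind_neg c2, ind_neg c3, ind_pos (p := ChE f x y z) ⟨hxy, hyz, hxz, Or.inl c1⟩]
            linarith [ind_le_one (Ch f x y z)]
          · rw [ind_neg c1]
            by_cases c2 : Ch f y z x
            · have c3 : ¬ Ch f x z y := fun h => z01n _ _ h.2.1 (hf x y) c2.2.1
              rw [ind_neg c3, ind_pos (p := ChE f x y z) ⟨hxy, hyz, hxz, Or.inr (Or.inl c2)⟩]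
              linarith [ind_le_one (Ch f y z x)]
            · rw [ind_neg c2]
              have := ind_mono (p := Ch f x z y) (q := ChE f x y z)
                fun h => ⟨hxy, hyz, hxz, Or.inr (Or.inr h)⟩
              linarith
  simp only [sum_add_distrib] at h1
  have e1 : ∑ x ∈ S, ∑ y ∈ S, ∑ z ∈ S, ind (Ch f y z x) = T f S := by
    unfold T
    rw [sum_comm]
    exact sum_congr rfl fun x _ => sum_comm
  have e2 : ∑ x ∈ S, ∑ y ∈ S, ∑ z ∈ S, ind (Ch f x z y) = T f S := by
    unfold T
    exact sum_congr rfl fun x _ => sum_comm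
  rw [e1, e2] at h1
  have e0 : ∑ x ∈ S, ∑ y ∈ S, ∑ z ∈ S, ind (Ch f x y z) = T f S := rfl
  have d : ∑ x ∈ S, ∑ c ∈ S, ind (x = c) ≤ S.card := by
    have := sum_le_card_nsmul S (fun x => ∑ c ∈ S, ind (x = c)) 1 fun x _ => sum_diag_le S x
    simpa using this
  have d1 : ∑ x ∈ S, ∑ y ∈ S, ∑ z ∈ S, ind (x = y) ≤ (S.card : ℝ) ^ 2 := by
    simp only [sum_const, nsmul_eq_mul, ← mul_sum]
    rw [sq]; gcongr
  have d2 : ∑ x ∈ S, ∑ y ∈ S, ∑ z ∈ S, ind (y = z) ≤ (S.card : ℝ) ^ 2 := by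
    simp only [sum_const, nsmul_eq_mul, ← mul_sum]
    rw [sq]; gcongr
  have d3 : ∑ x ∈ S, ∑ y ∈ S, ∑ z ∈ S, ind (x = z) ≤ (S.card : ℝ) ^ 2 := by
    simp only [sum_const, nsmul_eq_mul, ← mul_sum]
    rw [sq]; gcongr
  have : AAA (ChE f) S = ∑ x ∈ S, ∑ y ∈ S, ∑ z ∈ S, ind (ChE f x y z) := rfl
  linarith
end gen
end PCyc

namespace PCyc
open Finset
section stab
variable {V : Type} [DecidableEq V] [Fintype V] {f : V → V → ZMod 3}

/-- Approximate structure. -/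
def PP (f : V → V → ZMod 3) : Prop :=
  ∃ A : Finset V, |(A.card : ℝ) - al * Fintype.card V| ≤ 0.00003 * Fintype.card V ∧
    Mo (ChE f) A (univ \ A) ≤ 0.0000000001 * (Fintype.card V : ℝ) ^ 3

lemma low_deg (hf : Anti f) {n : ℝ} (hn : n = Fintype.card V) (hbig : 10000000000000000000 ≤ n)
    (hT : (mu - 0.000000000000000001) * n ^ 3 ≤ T f univ) (Z : Finset V)
    (hZ : ∀ v ∈ Z, eAA (ChE f) univ univ v ≤ (3 * mu - 0.00001) * n ^ 2) :
    (Z.card : ℝ) ≤ 0.000000000001 * n := by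
  by_contra hc
  push Not at hc
  have hn0 : 0 < n := by linarith
  have m1 := mu_lo
  have m2 := mu_hi
  obtain ⟨k, hk⟩ : ∃ k : ℕ, k = ⌈0.000000000001 * n⌉₊ := ⟨_, rfl⟩
  have hk1 : 0.000000000001 * n ≤ k := by rw [hk]; exact Nat.le_ceil _
  have hk2 : (k : ℝ) ≤ 0.000000000002 * n := by
    have := Nat.ceil_lt_add_one (a := 0.000000000001 * n) (by positivity)
    rw [← hk] at this
    linarith
  have hkZ : k ≤ Z.card := by rw [hk]; exact Nat.ceil_le.mpr hc.le
  obtain ⟨Y, hYZ, hYc⟩ := exists_subset_card_eq hkZ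
  have h1 := AAA_remove (ChE_sys hf) (subset_univ Y)
  have h2 := AAA_ChE_ge hf (univ : Finset V)
  have h3 := AAA_ChE_le (f := f) (univ \ Y)
  have h4 := T_le hf (univ \ Y)
  have hc1 : ((univ \ Y).card : ℝ) = n - k := by
    rw [cast_card_sdiff (subset_univ _), hYc, hn, card_univ]
  have h5 : ∑ v ∈ Y, eAA (ChE f) univ univ v ≤ k * ((3 * mu - 0.00001) * n ^ 2) := by
    have := sum_le_card_nsmul Y _ _ fun v hv => hZ v (hYZ hv)
    rwa [nsmul_eq_mul, hYc] at this
  rw [hc1] at h4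
  rw [card_univ, ← hn] at h2
  have h6 : 3 * n ^ 2 ≤ 0.000000000000000001 * n ^ 3 := by
    have : 10000000000000000000 * n ^ 2 ≤ n * n ^ 2 := mul_le_mul_of_nonneg_right hbig (by positivity)
    nlinarith [sq_nonneg n]
  obtain ⟨t, ht⟩ : ∃ t : ℝ, (k : ℝ) = t * n := ⟨k / n, by field_simp⟩
  rw [ht] at h4 h5 hk1 hk2
  have ht1 : 0.000000000001 ≤ t := le_of_mul_le_mul_right hk1 hn0
  have ht2 : t ≤ 0.000000000002 := le_of_mul_le_mul_right hk2 hn0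
  have h7 : (3 * (mu - 0.000000000000000001) - 0.000000000000000001) * n ^ 3 ≤ (3 * mu * (1 - t) ^ 3 + 3 * t * (3 * mu - 0.00001)) * n ^ 3 := by
    have e1 : (n - t * n) ^ 3 = (1 - t) ^ 3 * n ^ 3 := by ring
    rw [e1] at h4
    nlinarith
  have h8 := le_of_mul_le_mul_right h7 (by positivity)
  have h9 : (1 - t) ^ 3 ≤ 1 - 3 * t + 3 * t * 0.000000000002 := by
    have : t ^ 2 ≤ t * 0.000000000002 := by rw [sq]; exact mul_le_mul_of_nonneg_left ht2 (by linarith)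
    have : 0 ≤ t ^ 3 := by positivity
    nlinarith
  have h10 : mu * (1 - t) ^ 3 ≤ mu * (1 - 3 * t + 3 * t * 0.000000000002) :=
    mul_le_mul_of_nonneg_left h9 (by linarith)
  have h11 : mu * t ≤ 0.2 * t := mul_le_mul_of_nonneg_right (by linarith) (by linarith)
  linarith

set_option maxHeartbeats 1000000 in
lemma improve (hf : Anti f) {n : ℝ} (hn : n = Fintype.card V) (hbig : 10000000000000000000 ≤ n)
    (hT : (mu - 0.000000000000000001) * n ^ 3 ≤ T f univ) (A : Finset V)
    (hA : |(A.card : ℝ) - al * n| ≤ 0.00003 * n)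
    (hM : Mo (ChE f) A (univ \ A) ≤ 0.0000000001 * n ^ 3 + 3 * n ^ 2) : PP f := by
  classical
  have hn0 : 0 < n := by linarith
  have m1 := mu_lo
  have m2 := mu_hi
  have l1 := al_lo
  have l2 := al_hi
  have h6 : 3 * n ^ 2 ≤ 0.000000000000000001 * n ^ 3 := by
    have : 10000000000000000000 * n ^ 2 ≤ n * n ^ 2 := mul_le_mul_of_nonneg_right hbig (by positivity)
    nlinarith [sq_nonneg n]
  have hn3 : 0 < n ^ 3 := by positivity
  have hn2 : 0 < n ^ 2 := by positivity
  have hE := ChE_sys hf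
  have hO := ChE_noOdd hf 100
  set E := ChE f with hEdef
  set Z : Finset V := univ.filter fun v => eAA E univ univ v ≤ (3 * mu - 0.00001) * n ^ 2 with hZ
  have hZc := low_deg hf hn hbig hT Z fun v hv => (mem_filter.mp hv).2
  set S : Finset V := univ \ Z with hS
  have hcard : ∀ P : Finset V, (P.card : ℝ) ≤ n := by
    intro P; rw [hn]; exact_mod_cast card_le_univ P
  have hSc : (S.card : ℝ) = n - Z.card := by
    rw [hS, cast_card_sdiff (subset_univ _), hn, card_univ]
  have hAZ : (A.card : ℝ) - Z.card ≤ (A \ Z).card := by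
    have := le_card_sdiff Z A
    have h : (A.card : ℝ) ≤ (A \ Z).card + Z.card := by
      have : A.card ≤ (A \ Z).card + Z.card := by omega
      exact_mod_cast this
    linarith
  have hAZ' : ((A \ Z).card : ℝ) ≤ A.card := by exact_mod_cast card_le_card sdiff_subset
  set B := (univ \ A) \ Z with hB
  have hd : Disjoint (A \ Z) B := by
    rw [disjoint_left]; intro x hx hx'
    simp only [hB, mem_sdiff, mem_univ, true_and] at hx hx'
    exact hx'.1 hx.1
  have hun : (A \ Z) ∪ B = S := by
    ext x; simp only [hB, hS, mem_union, mem_sdiff, mem_univ, true_and]; tauto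
  have hsum : ((A \ Z).card : ℝ) + B.card = n - Z.card := by
    rw [← hSc, ← hun, card_union_of_disjoint hd]; push_cast; rfl
  have hZ0 : (0 : ℝ) ≤ Z.card := by positivity
  have hA' := abs_le.mp hA
  have hMf : Mf E (A \ Z) B ≤ 0.0000000002 * n ^ 3 := by
    have h1 : Mf E (A \ Z) B ≤ Mf E A (univ \ A) := by
      unfold Mf
      refine (sum_le_sum_of_subset_of_nonneg sdiff_subset fun _ _ _ =>
        sum_nonneg fun _ _ => sum_ind_nonneg _ _).trans (sum_le_sum fun x _ => ?_)
      refine (sum_le_sum_of_subset_of_nonneg sdiff_subset fun _ _ _ =>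
        sum_ind_nonneg _ _).trans (sum_le_sum fun y _ => ?_)
      exact sum_le_sum_of_subset_of_nonneg sdiff_subset fun _ _ _ => ind_nonneg _
    have h2 := Mf_le_Mo (E := E) (A := A) (B := univ \ A)
    have h3 : (A.card : ℝ) * ((univ : Finset V) \ A).card ≤ n * n :=
      mul_le_mul (hcard _) (hcard _) (by positivity) hn0.le
    nlinarith
  have hdeg : ∀ v ∈ (A \ Z) ∪ B, (3 * mu - 0.00003) * n ^ 2 ≤
      ∑ x ∈ (A \ Z) ∪ B, ∑ y ∈ (A \ Z) ∪ B, ind (E v x y) := by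
    intro v hv
    rw [hun] at hv ⊢
    have hv' : ¬ eAA E univ univ v ≤ (3 * mu - 0.00001) * n ^ 2 := by
      rw [hS, mem_sdiff, hZ, mem_filter] at hv
      intro h; exact hv.2 ⟨mem_univ _, h⟩
    push Not at hv'
    have h1 := sum_patch2 (N := n) (P' := univ) (Q' := univ) (P := S) (Q := S) (X := Z)
      (by intro x _; simp only [hS, mem_union, mem_sdiff, mem_univ, true_and]; tauto)
      (by intro x _; simp only [hS, mem_union, mem_sdiff, mem_univ, true_and]; tauto)
      (fun x y => E v x y) (hcard _) (hcard _)
    have h2 : eAA E univ univ v = ∑ x, ∑ y, ind (E v x y) := rfl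
    have h3 : (Z.card : ℝ) * n ≤ 0.000000000001 * n * n := mul_le_mul_of_nonneg_right hZc hn0.le
    rw [← h2] at h1
    nlinarith
  obtain ⟨A1, B1, hd1, hun1, ha1, hb1, hcount⟩ := rebalance hE hO (by linarith) hd
    (abs_le.mpr ⟨by linarith, by linarith⟩) (abs_le.mpr ⟨by linarith, by linarith⟩)
    (by linarith) hMf hdeg
  rw [hun] at hun1
  have e1 := AAA_split hE hd1 hun1
  rw [AAB_eq hE] at e1
  have e2 : AAA E B1 ≤ 3 * T f B1 := AAA_ChE_le (f := f) B1
  have e3 := T_le hf B1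
  have e4 := AAA_remove hE (subset_univ Z)
  have e5 : 3 * T f univ - 3 * ((univ : Finset V).card : ℝ) ^ 2 ≤ AAA E univ := AAA_ChE_ge hf (univ : Finset V)
  rw [card_univ, ← hn] at e5
  have e6 : ∑ v ∈ Z, eAA E univ univ v ≤ 0.000000000001 * n ^ 3 := by
    have h1 : ∑ v ∈ Z, eAA E univ univ v ≤ Z.card * n ^ 2 := by
      have := sum_le_card_nsmul Z (fun v => eAA E univ univ v) (n * n)
        fun v _ => sum2_le _ (hcard _) (hcard _)
      rw [nsmul_eq_mul, ← sq] at this; exact this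
    have h2 : (Z.card : ℝ) * n ^ 2 ≤ 0.000000000001 * n * n ^ 2 := mul_le_mul_of_nonneg_right hZc hn2.le
    nlinarith
  have hMo := Mo_nonneg (E := E) (A := A1) (B := B1)
  have hs1 : (A1.card : ℝ) + B1.card = n - Z.card := by
    rw [← hSc, ← hun1, card_union_of_disjoint hd1]; push_cast; rfl
  have hk := key_poly (A1.card : ℝ) B1.card
  rw [hs1] at hk
  have hcube : mu * (n - Z.card) ^ 3 ≤ mu * n ^ 3 := by
    refine mul_le_mul_of_nonneg_left (pow_le_pow_left₀ ?_ (by linarith) 3) (by linarith)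
    rw [← hSc]; positivity
  have hprod : 0 ≤ (A1.card : ℝ) * B1.card := by positivity
  set d := (A1.card : ℝ) - al * (n - Z.card) with hdd
  have hmain : 0.1 * Mo E A1 B1 + 3 * ((1 + mu) * A1.card * d ^ 2) ≤ 0.0000000000031 * n ^ 3 := by
    linarith only [e1, e2, e3, e4, e5, e6, hT, hk, hcube, hprod, hcount, h6, hn3]
  have hq0 : 0 ≤ (1 + mu) * A1.card * d ^ 2 := by positivity
  have hq : (0.6339 * n) * d ^ 2 ≤ (1 + mu) * A1.card * d ^ 2 := by
    refine mul_le_mul_of_nonneg_right ?_ (sq_nonneg _)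
    have h : 0 ≤ mu * (A1.card : ℝ) := mul_nonneg (by linarith only [m1]) (Nat.cast_nonneg _)
    linarith only [h, ha1]
  have hd2 : d ^ 2 ≤ (0.000002 * n) ^ 2 := by
    have h : n * d ^ 2 ≤ n * (0.000002 * n) ^ 2 := by
      linarith only [hmain, hq, hMo, hn3]
    exact le_of_mul_le_mul_left h hn0
  have hd3 := abs_le_of_sq_le_sq hd2 (by positivity)
  have hd4 := abs_le.mp hd3
  refine ⟨A1, ?_, ?_⟩
  · rw [← hn, abs_le]
    have q1 : al * Z.card ≤ 1 * Z.card := mul_le_mul_of_nonneg_right (by linarith only [l2]) hZ0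
    have q2 : 0 ≤ al * Z.card := mul_nonneg (by linarith only [l1]) hZ0
    constructor <;> linarith only [q1, q2, hd4.1, hd4.2, hdd, hZc, hn0]
  · rw [← hn]
    have h1 := sum_patch3 (N := n) (P' := A1) (P := A1) (Q' := univ \ A1) (Q := B1) (X := Z)
      subset_union_left (by
        intro x hx
        by_cases hxz : x ∈ Z
        · exact mem_union_right _ hxz
        · have hx' : x ∈ A1 ∪ B1 := by rw [hun1, hS]; exact mem_sdiff.mpr ⟨mem_univ _, hxz⟩
          rcases mem_union.mp hx' with h | h
          · exact absurd h (mem_sdiff.mp hx).2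
          · exact mem_union_left _ h)
      (fun x c y => x ≠ c ∧ ¬ E x c y) (hcard _) (hcard _) (hcard _)
    have h2 : (Z.card : ℝ) * n ^ 2 ≤ 0.000000000001 * n * n ^ 2 := mul_le_mul_of_nonneg_right hZc hn2.le
    have h3 : Mo E A1 (univ \ A1) ≤ Mo E A1 B1 + 3 * (Z.card * n ^ 2) := h1
    linarith only [h2, h3, hmain, hq0, hn3]

theorem colour_stable (hbig : (10000000000000000000 : ℝ) ≤ Fintype.card V) :
    ∀ f : V → V → ZMod 3, Anti f → (mu - 0.000000000000000001) * (Fintype.card V : ℝ) ^ 3 ≤ T f univ → PP f := by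
  have hn0 : (0 : ℝ) < Fintype.card V := by linarith
  refine zykov (univ : Finset V)
    (fun f => (mu - 0.000000000000000001) * (Fintype.card V : ℝ) ^ 3 ≤ T f univ → PP f) ?_ ?_
  · intro f hf hs hT
    have hne : (univ : Finset V).Nonempty := by
      rw [← card_pos, card_univ]; exact_mod_cast hn0
    obtain ⟨A, _, h1, h2⟩ := symm_stable hf hs hne (by rw [card_univ]; exact hT)
    rw [card_univ] at h1 h2
    refine ⟨A, h1.trans (by gcongr; norm_num), ?_⟩
    refine le_trans ?_ (h2.trans (by gcongr; norm_num))
    refine sum_le_sum fun x hx => sum_le_sum fun y hy => sum_le_sum fun z hz => ind_mono ?_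
    rintro ⟨hne, hnE⟩ hC
    have hz' := (mem_sdiff.mp hz).2
    exact hnE ⟨hne, fun h => hz' (h ▸ hy), fun h => hz' (h ▸ hx), Or.inl hC⟩
  · intro f hf u _ v _ hle hQ hT
    obtain ⟨A, h1, h2⟩ := hQ (hT.trans hle)
    refine improve hf rfl hbig hT A h1 ?_
    refine le_trans ?_ (add_le_add h2 le_rfl)
    have hc : ∀ P : Finset V, (P.card : ℝ) ≤ Fintype.card V := by
      intro P; exact_mod_cast card_le_univ P
    have hsub : ∀ P : Finset V, P ⊆ (P \ {u}) ∪ {u} := by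
      intro P x hx
      by_cases h : x = u
      · exact mem_union_right _ (mem_singleton.mpr h)
      · exact mem_union_left _ (mem_sdiff.mpr ⟨hx, by simpa using h⟩)
    have h3 := sum_patch3 (N := (Fintype.card V : ℝ)) (hsub A) (hsub (univ \ A))
      (fun x c y => x ≠ c ∧ ¬ ChE f x c y) (hc _) (hc _) (hc _)
    rw [card_singleton] at h3
    have h4 : ∑ x ∈ A \ {u}, ∑ c ∈ A \ {u}, ∑ y ∈ (univ \ A) \ {u}, ind (x ≠ c ∧ ¬ ChE f x c y)
        ≤ Mo (ChE (clone f u v)) A (univ \ A) := by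
      unfold Mo
      refine le_trans (sum_le_sum fun x hx => ?_) (sum_le_sum_of_subset_of_nonneg sdiff_subset fun _ _ _ =>
        sum_nonneg fun _ _ => sum_ind_nonneg _ _)
      refine le_trans (sum_le_sum fun y hy => ?_) (sum_le_sum_of_subset_of_nonneg sdiff_subset fun _ _ _ =>
        sum_ind_nonneg _ _)
      refine le_trans (sum_le_sum fun z hz => ?_) (sum_le_sum_of_subset_of_nonneg sdiff_subset fun _ _ _ =>
        ind_nonneg _)
      have nx : x ≠ u := by simpa using (mem_sdiff.mp hx).2
      have ny : y ≠ u := by simpa using (mem_sdiff.mp hy).2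
      have nz : z ≠ u := by simpa using (mem_sdiff.mp hz).2
      apply le_of_eq
      apply ind_congr
      unfold ChE Ch
      rw [clone_of_ne f nx ny, clone_of_ne f nx nz, clone_of_ne f ny nz, clone_of_ne f nz ny,
        clone_of_ne f ny nx, clone_of_ne f nz nx]
    have h5 : Mo (ChE f) A (univ \ A) = ∑ x ∈ A, ∑ c ∈ A, ∑ y ∈ univ \ A, ind (x ≠ c ∧ ¬ ChE f x c y) := rfl
    rw [h5]
    push_cast at h3
    linarith
end stab
end PCyc

namespace PCyc
open Finset
section clean
variable {V : Type} [DecidableEq V] [Fintype V] {E : V → V → V → Prop}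

lemma W.split {i j : ℕ} {x y u v : V} (h : W E (i + j) x y u v) :
    ∃ p q, W E i x y p q ∧ W E j p q u v := by
  induction i generalizing x y with
  | zero => exact ⟨x, y, ⟨rfl, rfl⟩, by simpa using h⟩
  | succ i ih =>
    rw [Nat.succ_add] at h
    obtain ⟨z, hz, h⟩ := h
    obtain ⟨p, q, h1, h2⟩ := ih h
    exact ⟨p, q, ⟨z, hz, h1⟩, h2⟩

lemma W.mono {K : V → V → V → Prop} (hK : ∀ x y z, K x y z → E x y z) {k : ℕ} {x y u v : V}
    (h : W K k x y u v) : W E k x y u v := by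
  induction k generalizing x y with
  | zero => exact h
  | succ k ih =>
    obtain ⟨z, hz, h⟩ := h
    exact ⟨z, hK _ _ _ hz, ih h⟩

/-- codegree -/
noncomputable def cod (E : V → V → V → Prop) (x y : V) : ℝ := ∑ z, ind (E x y z)

/-- ordered shadow size -/
noncomputable def shad (E : V → V → V → Prop) : ℝ := ∑ x, ∑ y, ind (∃ z, E x y z)

lemma sum_ind_eq_and (a : V) (p : V → Prop) : ∑ x, ind (x = a ∧ p x) = ind (p a) := by
  rw [Finset.sum_eq_single a]
  · apply ind_congr; simp
  · intro b _ hb; exact ind_neg (fun h => hb h.1)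
  · intro h; exact absurd (mem_univ _) h

lemma clean (hE : Sys E) {e : ℝ} (he : 0 < e) :
    ∃ K : V → V → V → Prop, Sys K ∧ (∀ x y z, K x y z → E x y z) ∧
      (∀ x y z, K x y z → e ≤ cod K x y) ∧
      AAA E univ - 6 * e * (Fintype.card V : ℝ) ^ 2 ≤ AAA K univ := by
  classical
  let X := {K : V → V → V → Prop // Sys K ∧ ∀ x y z, K x y z → E x y z}
  haveI : Nonempty X := ⟨⟨E, hE, fun _ _ _ h => h⟩⟩
  obtain ⟨⟨K, hK, hKE⟩, hmax⟩ := Finite.exists_max fun K : X => AAA K.1 univ - 6 * e * shad K.1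
  have sh0 : 0 ≤ shad K := sum_nonneg fun _ _ => sum_ind_nonneg _ _
  have sh1 : shad E ≤ (Fintype.card V : ℝ) ^ 2 := by
    have := sum2_le (P := (univ : Finset V)) (Q := (univ : Finset V)) (N := (Fintype.card V : ℝ)) (fun x y => ∃ z, E x y z)
      (by rw [card_univ]) (by rw [card_univ])
    rw [sq]; exact this
  refine ⟨K, hK, hKE, ?_, ?_⟩
  · intro a b c habc
    by_contra hlt
    push Not at hlt
    set K' : V → V → V → Prop := fun x y z => K x y z ∧
      ¬ ((x = a ∨ y = a ∨ z = a) ∧ (x = b ∨ y = b ∨ z = b)) with hK'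
    have hS : Sys K' := by
      refine ⟨?_, ?_, ?_⟩
      · rintro x y z ⟨h1, h2⟩; exact ⟨hK.swap h1, by tauto⟩
      · rintro x y z ⟨h1, h2⟩; exact ⟨hK.rot h1, by tauto⟩
      · rintro x y z ⟨h1, h2⟩; exact hK.ne h1
    have hm := hmax ⟨K', hS, fun x y z h => hKE _ _ _ h.1⟩
    simp only at hm
    have hsh : shad K' + 1 ≤ shad K := by
      have h1 : (1 : ℝ) = ∑ x, ∑ y, ind (x = a ∧ (y = b ∧ True)) := by
        have : ∀ x, ∑ y, ind (x = a ∧ (y = b ∧ True)) = ind (x = a ∧ True) := by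
          intro x
          by_cases hx : x = a
          · simp only [hx, true_and]; rw [sum_ind_eq_and b fun _ => True]
          · simp [hx, ind_neg]
        simp_rw [this]
        rw [sum_ind_eq_and a fun _ => True, ind_pos trivial]
      unfold shad
      rw [h1, ← sum_add_distrib]
      refine sum_le_sum fun x _ => ?_
      rw [← sum_add_distrib]
      refine sum_le_sum fun y _ => ?_
      by_cases hx : x = a ∧ y = b
      · obtain ⟨rfl, rfl⟩ := hx
        rw [ind_neg, ind_pos (by simp), ind_pos ⟨c, habc⟩]
        · norm_num
        · rintro ⟨z, hz, h⟩; exact h (by simp)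
      · rw [ind_neg (p := x = a ∧ (y = b ∧ True)) (by tauto), add_zero]
        exact ind_mono fun ⟨z, h, _⟩ => ⟨z, h⟩
    have hdrop : AAA K univ - AAA K' univ ≤ 6 * cod K a b := by
      have h0 : ∀ x y z, ind (K x y z) ≤ ind (K' x y z) +
          (ind (x = a ∧ (y = b ∧ K a b z)) + ind (x = b ∧ (y = a ∧ K a b z)) +
          ind (x = a ∧ (z = b ∧ K a b y)) + ind (x = b ∧ (z = a ∧ K a b y)) +
          ind (y = a ∧ (z = b ∧ K a b x)) + ind (y = b ∧ (z = a ∧ K a b x))) := by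
        intro x y z
        have n1 := ind_nonneg (x = a ∧ (y = b ∧ K a b z))
        have n2 := ind_nonneg (x = b ∧ (y = a ∧ K a b z))
        have n3 := ind_nonneg (x = a ∧ (z = b ∧ K a b y))
        have n4 := ind_nonneg (x = b ∧ (z = a ∧ K a b y))
        have n5 := ind_nonneg (y = a ∧ (z = b ∧ K a b x))
        have n6 := ind_nonneg (y = b ∧ (z = a ∧ K a b x))
        have n7 := ind_nonneg (K' x y z)
        by_cases hk : K x y z
        · rw [ind_pos hk]
          have hab := hK.ne habc
          by_cases hh : (x = a ∨ y = a ∨ z = a) ∧ (x = b ∨ y = b ∨ z = b)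
          · obtain ⟨h1, h2⟩ := hh
            rcases h1 with rfl | rfl | rfl <;> rcases h2 with rfl | rfl | rfl
            · exact absurd rfl hab
            · rw [ind_pos (p := x = x ∧ (y = y ∧ K x y z)) ⟨rfl, rfl, hk⟩]; linarith
            · rw [ind_pos (p := x = x ∧ (z = z ∧ K x z y)) ⟨rfl, rfl, hK.swap' hk⟩]; linarith
            · rw [ind_pos (p := x = x ∧ (y = y ∧ K y x z)) ⟨rfl, rfl, hK.swap hk⟩]; linarith
            · exact absurd rfl hab
            · rw [ind_pos (p := y = y ∧ (z = z ∧ K y z x)) ⟨rfl, rfl, hK.rot hk⟩]; linarith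
            · rw [ind_pos (p := x = x ∧ (z = z ∧ K z x y)) ⟨rfl, rfl, hK.rot (hK.rot hk)⟩]; linarith
            · rw [ind_pos (p := y = y ∧ (z = z ∧ K z y x)) ⟨rfl, rfl, hK.rev hk⟩]; linarith
            · exact absurd rfl hab
          · rw [ind_pos (p := K' x y z) ⟨hk, hh⟩]; linarith
        · rw [ind_neg hk]; linarith
      have h1 : AAA K univ ≤ AAA K' univ + 6 * cod K a b := by
        have h2 : ∀ (s t : V), ∑ x, ∑ y, ∑ z, ind (x = s ∧ (y = t ∧ K a b z)) = cod K a b := by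
          intro s t
          have e1 : ∀ x, ∑ y, ∑ z, ind (x = s ∧ (y = t ∧ K a b z)) = ∑ z, ind (x = s ∧ K a b z) := by
            intro x
            rw [sum_comm]
            refine sum_congr rfl fun z _ => ?_
            rw [← sum_ind_eq_and t fun y => (x = s ∧ K a b z)]
            exact sum_congr rfl fun y _ => ind_congr (by tauto)
          simp_rw [e1]
          rw [sum_comm]
          refine sum_congr rfl fun z _ => ?_
          exact sum_ind_eq_and s fun x => K a b z
        have h3 : ∀ (s t : V), ∑ x, ∑ y, ∑ z, ind (x = s ∧ (z = t ∧ K a b y)) = cod K a b := by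
          intro s t
          rw [← h2 s t]
          refine sum_congr rfl fun x _ => ?_
          rw [sum_comm]
        have h4 : ∀ (s t : V), ∑ x, ∑ y, ∑ z, ind (y = s ∧ (z = t ∧ K a b x)) = cod K a b := by
          intro s t
          rw [← h3 s t, sum_comm]
        have h5 : AAA K univ ≤ ∑ x, ∑ y, ∑ z, (ind (K' x y z) +
          (ind (x = a ∧ (y = b ∧ K a b z)) + ind (x = b ∧ (y = a ∧ K a b z)) +
          ind (x = a ∧ (z = b ∧ K a b y)) + ind (x = b ∧ (z = a ∧ K a b y)) +
          ind (y = a ∧ (z = b ∧ K a b x)) + ind (y = b ∧ (z = a ∧ K a b x)))) :=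
          sum_le_sum fun x _ => sum_le_sum fun y _ => sum_le_sum fun z _ => h0 x y z
        simp only [sum_add_distrib, h2, h3, h4] at h5
        have h6 : AAA K' univ = ∑ x, ∑ y, ∑ z, ind (K' x y z) := rfl
        linarith
      linarith
    nlinarith
  · have := hmax ⟨E, hE, fun _ _ _ h => h⟩
    simp only at this
    nlinarith

lemma two_step {K : V → V → V → Prop} (hK : Sys K) {e : ℝ} (he : 0 < e)
    (hc : ∀ x y z, K x y z → e ≤ cod K x y) {x y c : V} (h : K x y c) :
    e ^ 2 ≤ ∑ z, ∑ w, ind (K x y z ∧ K y z w) := by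
  have h1 : e * cod K x y ≤ ∑ z, ∑ w, ind (K x y z ∧ K y z w) := by
    unfold cod
    rw [mul_sum]
    refine sum_le_sum fun z _ => ?_
    by_cases hz : K x y z
    · rw [ind_pos hz, mul_one]
      refine (hc y z x (hK.rot hz)).trans (sum_le_sum fun w _ => ind_mono fun h => ⟨hz, h⟩)
    · rw [ind_neg hz, mul_zero]; exact sum_ind_nonneg _ _
  have h2 := hc _ _ _ h
  nlinarith

lemma short {K : V → V → V → Prop} (hK : Sys K) {e : ℝ} (he : 0 < e)
    (hc : ∀ x y z, K x y z → e ≤ cod K x y) {M : ℕ}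
    (hM : (Fintype.card V : ℝ) ^ 2 < (M + 1) * e ^ 2) {k : ℕ} {x y u v : V}
    (h : W K k x y u v) : ∃ j ≤ 7 * M, W K j x y u v := by
  classical
  set d : V → V → ℕ := fun p q => sInf {k | W K k x y p q} with hd
  have hd1 : ∀ {k p q}, W K k x y p q → W K (d p q) x y p q := by
    intro k p q h; exact Nat.sInf_mem (s := {k | W K k x y p q}) ⟨k, h⟩
  have hd2 : ∀ {k p q}, W K k x y p q → d p q ≤ k := by
    intro k p q h; exact Nat.sInf_le (s := {k | W K k x y p q}) h
  refine ⟨d u v, ?_, hd1 h⟩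
  by_contra hlt
  push Not at hlt
  have key : ∀ t ∈ range (M + 1), e ^ 2 ≤ ∑ z, ∑ w, ind ((d z w + 4) / 7 = t) := by
    intro t ht
    have ht' : t ≤ M := by have := mem_range.mp ht; omega
    have hw := hd1 h
    obtain ⟨j, hj⟩ : ∃ j, d u v = 7 * t + (j + 1) := ⟨d u v - 7 * t - 1, by omega⟩
    rw [hj] at hw
    obtain ⟨p, q, w1, w2⟩ := hw.split
    have hdp : d p q = 7 * t := by
      have h1 := hd2 w1
      have h2 := hd2 ((hd1 w1).trans w2)
      omega
    obtain ⟨c, hpc, _⟩ := w2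
    refine (two_step hK he hc hpc).trans (sum_le_sum fun z _ => sum_le_sum fun w _ => ind_mono ?_)
    rintro ⟨h1, h2⟩
    have w3 : W K 2 p q z w := ⟨z, h1, w, h2, rfl, rfl⟩
    have h3 := hd2 (w1.trans w3)
    have h4 := hd2 ((hd1 (w1.trans w3)).trans (w3.back hK))
    omega
  have h1 : ∑ t ∈ range (M + 1), e ^ 2 ≤ ∑ t ∈ range (M + 1), ∑ z, ∑ w, ind ((d z w + 4) / 7 = t) :=
    sum_le_sum key
  rw [sum_const, card_range, nsmul_eq_mul, sum_comm] at h1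
  have h2 : ∑ z, ∑ t ∈ range (M + 1), ∑ w, ind ((d z w + 4) / 7 = t) ≤ (Fintype.card V : ℝ) ^ 2 := by
    have h3 : ∀ z ∈ (univ : Finset V), ∑ t ∈ range (M + 1), ∑ w, ind ((d z w + 4) / 7 = t) ≤ (Fintype.card V : ℝ) := by
      intro z _
      rw [sum_comm]
      have h4 : ∀ w ∈ (univ : Finset V), ∑ t ∈ range (M + 1), ind ((d z w + 4) / 7 = t) ≤ 1 := by
        intro w _
        by_cases hm : (d z w + 4) / 7 ∈ range (M + 1)
        · rw [sum_eq_single_of_mem _ hm]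
          · exact ind_le_one _
          · intro b _ hb; exact ind_neg fun h => hb h.symm
        · rw [sum_eq_zero]
          · norm_num
          · intro b hb; exact ind_neg fun h => hm (h ▸ hb)
      have := sum_le_card_nsmul _ _ _ h4
      simpa [card_univ] using this
    have := sum_le_card_nsmul _ _ _ h3
    rw [nsmul_eq_mul, card_univ] at this
    rw [sq]; exact this
  push_cast at h1
  linarith

lemma zz1 : ∀ i j : ZMod 3, i + 2 * j = 0 → i = j := by decide
lemma zz2 : ∀ s a b : ZMod 3, s = 0 ∨ s = 1 ∨ s = 2 := by decide

theorem colouring (hE : Sys E) {e : ℝ} (he : 0 < e) {M : ℕ}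
    (hM : (Fintype.card V : ℝ) ^ 2 < (M + 1) * e ^ 2) (hO : NoOdd E (21 * M + 1)) :
    ∃ (f : V → V → ZMod 3) (K : V → V → V → Prop), Anti f ∧ Sys K ∧ (∀ x y z, K x y z → E x y z) ∧
      (∀ x y z, K x y z → ChE f x y z) ∧
      AAA E univ - 6 * e * (Fintype.card V : ℝ) ^ 2 ≤ AAA K univ := by
  classical
  obtain ⟨K, hK, hKE, hc, hA⟩ := clean hE he
  let s : Setoid (V × V) :=
    { r := fun p q => ∃ k, W K k p.1 p.2 q.1 q.2
      iseqv := ⟨fun p => ⟨0, rfl, rfl⟩, fun ⟨k, h⟩ => ⟨_, h.back hK⟩,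
        fun ⟨k, h⟩ ⟨j, h'⟩ => ⟨_, h.trans h'⟩⟩ }
  let r : V → V → V × V := fun x y => (Quotient.mk s (x, y)).out
  have hr : ∀ x y, ∃ j ≤ 7 * M, W K j (r x y).1 (r x y).2 x y := by
    intro x y
    obtain ⟨k, h⟩ := Quotient.mk_out (s := s) (x, y)
    exact short hK he hc hM h
  choose g hg1 hg2 using hr
  have hstep : ∀ x y z, K x y z → (g y z : ZMod 3) = g x y + 1 := by
    intro x y z h
    have hrr : r y z = r x y := by
      have : (Quotient.mk s (y, z)) = Quotient.mk s (x, y) :=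
        Quotient.sound ⟨_, (W.one h).back hK⟩
      show (Quotient.mk s (y, z)).out = (Quotient.mk s (x, y)).out
      rw [this]
    have w1 := ((hg2 x y).trans (W.one h))
    have w2 := hg2 y z
    rw [hrr] at w2
    have w3 := (w1.trans (w2.back hK)).mono hKE
    have h1 := hg1 x y
    have h2 := hg1 y z
    have h3 := hO _ (by omega) _ _ w3
    have h4 : (((g x y + 1 + 2 * g y z : ℕ)) : ZMod 3) = 0 := (ZMod.natCast_eq_zero_iff _ _).mpr h3
    push_cast at h4
    exact (zz1 _ _ h4).symm
  set f : V → V → ZMod 3 := fun x y => (g y x : ZMod 3) - g x y with hf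
  have hAnti : Anti f := by intro x y; simp only [hf]; ring
  have hf1 : ∀ x y z, K x y z → f y z = f x y + 1 := by
    intro x y z h
    have h1 := hstep _ _ _ h
    have h2 := hstep _ _ _ (hK.rev h)
    simp only [hf]
    rw [h1, h2]
    have : (3 : ZMod 3) = 0 := by decide
    linear_combination (-1 : ZMod 3) * this
  refine ⟨f, K, hAnti, hK, hKE, ?_, hA⟩
  intro x y z h
  have e1 := hf1 _ _ _ h
  have e2 := hf1 _ _ _ (hK.rot h)
  rw [e1] at e2
  have a1 := hAnti x y
  have a2 := hAnti y z
  have a3 := hAnti z x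
  refine ⟨hK.ne h, hK.ne (hK.rot h), hK.ne (hK.swap' h), ?_⟩
  unfold Ch
  rw [a1, a2, a3, e2, e1]
  generalize f x y = s
  revert s
  decide
end clean
end PCyc

namespace PCyc
open Finset
section hyp
variable {V : Type} [DecidableEq V]

/-- edge relation of a hypergraph -/
def EH (H : Finset (Finset V)) (x y z : V) : Prop := ({x, y, z} : Finset V) ∈ H

lemma card3_ne {x y z : V} (h : ({x, y, z} : Finset V).card = 3) : x ≠ y ∧ y ≠ z ∧ x ≠ z := by
  refine ⟨?_, ?_, ?_⟩ <;> rintro rfl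
  · have := card_le_two (a := x) (b := z)
    simp at h; omega
  · have := card_le_two (a := x) (b := y)
    simp at h; omega
  · have := card_le_two (a := y) (b := x)
    simp at h
    omega

lemma EH_sys {H : Finset (Finset V)} (hH : ∀ e ∈ H, e.card = 3) : Sys (EH H) := by
  refine ⟨?_, ?_, ?_⟩
  · intro x y z h
    unfold EH at *
    rwa [insert_comm y x]
  · intro x y z h
    unfold EH at *
    rw [insert_comm, pair_comm x z] at h
    exact h
  · intro x y z h
    exact (card3_ne (hH _ h)).1

lemma W.seq {E : V → V → V → Prop} {k : ℕ} {x y u v : V} (h : W E k x y u v) :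
    ∃ s : ℕ → V, s 0 = x ∧ s 1 = y ∧ s k = u ∧ s (k + 1) = v ∧
      ∀ i < k, E (s i) (s (i + 1)) (s (i + 2)) := by
  induction k generalizing x y with
  | zero =>
    obtain ⟨rfl, rfl⟩ := h
    exact ⟨fun i => if i = 0 then x else y, by simp, by simp, by simp, by simp, by simp⟩
  | succ k ih =>
    obtain ⟨z, hz, h⟩ := h
    obtain ⟨s, h0, h1, h2, h3, h4⟩ := ih h
    refine ⟨fun i => if i = 0 then x else s (i - 1), by simp, by simp [h0], by simp [h2], by simp [h3], ?_⟩
    intro i hi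
    rcases Nat.eq_zero_or_pos i with rfl | hp
    · simp [h0, h1, hz]
    · have := h4 (i - 1) (by omega)
      have e1 : i - 1 + 1 = i := by omega
      have e2 : i - 1 + 2 = i + 1 := by omega
      rw [e1, e2] at this
      simp [hp.ne', this]

lemma walk_cycle {H : Finset (Finset V)} {m : ℕ} (hm : 3 ≤ m) {x y : V} (h : W (EH H) m x y x y) :
    HasPseudocycle H m := by
  haveI : NeZero m := ⟨by omega⟩
  obtain ⟨s, h0, h1, h2, h3, h4⟩ := h.seq
  have hs : ∀ j ≤ m + 1, s (j % m) = s j := by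
    intro j hj
    rcases lt_or_ge j m with hl | hl
    · rw [Nat.mod_eq_of_lt hl]
    · rcases Nat.eq_or_lt_of_le hl with he | hl
      · subst he; rw [Nat.mod_self, h0, h2]
      · have : j = m + 1 := by omega
        subst this
        rw [Nat.add_mod_left, Nat.mod_eq_of_lt (by omega), h1, h3]
  refine ⟨fun i => s i.val, fun i => ?_⟩
  have hi := ZMod.val_lt i
  have v1 : (i + 1).val = (i.val + 1) % m := by
    rw [ZMod.val_add, ZMod.val_one'' (by omega)]
  have v2 : (i + 2).val = (i.val + 2) % m := by
    have : (2 : ZMod m).val = 2 := by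
      have := ZMod.val_natCast m 2
      rw [Nat.mod_eq_of_lt (by omega)] at this
      exact_mod_cast this
    rw [ZMod.val_add, this]
  simp only [v1, v2]
  rw [hs _ (by omega), hs _ (by omega)]
  exact h4 _ hi

lemma noOdd_of {H : Finset (Finset V)} (hH : ∀ e ∈ H, e.card = 3) {l : ℕ}
    (h : NoShortOddPseudocycle H l) : NoOdd (EH H) l := by
  intro m hm x y hw
  have hE := EH_sys hH
  by_contra h3
  rcases lt_or_ge m 3 with hl | hl
  · have : m = 0 ∨ m = 1 ∨ m = 2 := by omega
    rcases this with rfl | rfl | rfl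
    · exact h3 (by simp)
    · obtain ⟨z, hz, h1, h2⟩ := hw
      exact hE.ne hz h1.symm
    · obtain ⟨z, hz, w, hw, h1, h2⟩ := hw
      exact hE.ne (hE.swap' hz) h1.symm
  · exact h m hl hm h3 (walk_cycle hl hw)

lemma perm_E {E : V → V → V → Prop} (hE : Sys E) {x y z a b c : V}
    (h : ({x, y, z} : Finset V) = {a, b, c}) (e : E a b c) : E x y z := by
  have hab := hE.ne e
  have hbc := hE.ne (hE.rot e)
  have hac := hE.ne (hE.swap' e)
  have ha : a ∈ ({x, y, z} : Finset V) := by rw [h]; simp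
  have hb : b ∈ ({x, y, z} : Finset V) := by rw [h]; simp
  have hc : c ∈ ({x, y, z} : Finset V) := by rw [h]; simp
  simp only [mem_insert, mem_singleton] at ha hb hc
  have e1 := hE.rot e
  have e2 := hE.rot e1
  have e3 := hE.swap e
  have e4 := hE.swap e1
  have e5 := hE.swap e2
  rcases ha with rfl | rfl | rfl <;> rcases hb with rfl | rfl | rfl <;>
    rcases hc with rfl | rfl | rfl <;> first | assumption | exact absurd rfl hab | exact absurd rfl hbc | exact absurd rfl hac

variable [Fintype V]

open Classical in
/-- hypergraph of a relation -/
noncomputable def HE (E : V → V → V → Prop) : Finset (Finset V) :=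
  univ.filter fun e => ∃ x y z, e = {x, y, z} ∧ E x y z

lemma EH_HE {E : V → V → V → Prop} (hE : Sys E) {x y z : V} : EH (HE E) x y z ↔ E x y z := by
  classical
  unfold EH HE
  rw [mem_filter]
  constructor
  · rintro ⟨_, a, b, c, h, e⟩; exact perm_E hE h e
  · intro h; exact ⟨mem_univ _, x, y, z, rfl, h⟩

lemma HE_card {E : V → V → V → Prop} (hE : Sys E) : ∀ e ∈ HE E, e.card = 3 := by
  classical
  intro e he
  unfold HE at he
  rw [mem_filter] at he
  obtain ⟨_, a, b, c, rfl, e⟩ := he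
  exact card_eq_three.mpr ⟨a, b, c, hE.ne e, hE.ne (hE.swap' e), hE.ne (hE.rot e), rfl⟩

lemma fibre6 {e : Finset V} (he : e.card = 3) :
    ∑ x, ∑ y, ∑ z, ind (({x, y, z} : Finset V) = e) = 6 := by
  classical
  obtain ⟨a, b, c, hab, hac, hbc, rfl⟩ := card_eq_three.mp he
  have h1 : ∀ x y z, ind (({x, y, z} : Finset V) = {a, b, c}) =
      ind (x = a ∧ (y = b ∧ z = c)) + ind (x = a ∧ (y = c ∧ z = b)) +
      ind (x = b ∧ (y = a ∧ z = c)) + ind (x = b ∧ (y = c ∧ z = a)) +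
      ind (x = c ∧ (y = a ∧ z = b)) + ind (x = c ∧ (y = b ∧ z = a)) := by
    intro x y z
    have key : (({x, y, z} : Finset V) = {a, b, c}) ↔ ((x = a ∧ (y = b ∧ z = c)) ∨ (x = a ∧ (y = c ∧ z = b)) ∨
      (x = b ∧ (y = a ∧ z = c)) ∨ (x = b ∧ (y = c ∧ z = a)) ∨
      (x = c ∧ (y = a ∧ z = b)) ∨ (x = c ∧ (y = b ∧ z = a))) := by
      constructor
      · intro h
        have ha : a ∈ ({x, y, z} : Finset V) := by rw [h]; simp
        have hb : b ∈ ({x, y, z} : Finset V) := by rw [h]; simp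
        have hc : c ∈ ({x, y, z} : Finset V) := by rw [h]; simp
        simp only [mem_insert, mem_singleton] at ha hb hc
        rcases ha with rfl | rfl | rfl <;> rcases hb with rfl | rfl | rfl <;>
          rcases hc with rfl | rfl | rfl <;> first | exact absurd rfl hab | exact absurd rfl hbc | exact absurd rfl hac | simp
      · rintro (⟨rfl, rfl, rfl⟩ | ⟨rfl, rfl, rfl⟩ | ⟨rfl, rfl, rfl⟩ | ⟨rfl, rfl, rfl⟩ | ⟨rfl, rfl, rfl⟩ | ⟨rfl, rfl, rfl⟩) <;>
          (ext t; simp only [mem_insert, mem_singleton] <;> tauto)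
    by_cases hx : ({x, y, z} : Finset V) = {a, b, c}
    · rw [ind_pos hx]
      rcases key.mp hx with ⟨rfl, rfl, rfl⟩ | ⟨rfl, rfl, rfl⟩ | ⟨rfl, rfl, rfl⟩ | ⟨rfl, rfl, rfl⟩ | ⟨rfl, rfl, rfl⟩ | ⟨rfl, rfl, rfl⟩ <;>
        simp [ind, hab, hac, hbc, hab.symm, hac.symm, hbc.symm]
    · rw [ind_neg hx]
      rw [key] at hx
      simp only [not_or] at hx
      obtain ⟨a1, a2, a3, a4, a5, a6⟩ := hx
      rw [ind_neg a1, ind_neg a2, ind_neg a3, ind_neg a4, ind_neg a5, ind_neg a6]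
      norm_num
  have h2 : ∀ s t r : V, ∑ x, ∑ y, ∑ z, ind (x = s ∧ (y = t ∧ z = r)) = 1 := by
    intro s t r
    have e1 : ∀ x y, ∑ z, ind (x = s ∧ (y = t ∧ z = r)) = ind (x = s ∧ y = t) := by
      intro x y
      rw [← sum_ind_eq_and r fun _ => (x = s ∧ y = t)]
      exact sum_congr rfl fun z _ => ind_congr (by tauto)
    have e2 : ∀ x, ∑ y, ind (x = s ∧ y = t) = ind (x = s ∧ True) := by
      intro x
      rw [← sum_ind_eq_and t fun _ => (x = s ∧ True)]
      exact sum_congr rfl fun z _ => ind_congr (by tauto)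
    simp_rw [e1, e2]
    rw [sum_ind_eq_and s fun _ => True, ind_pos trivial]
  simp_rw [h1, sum_add_distrib, h2]
  norm_num

lemma six_card {H : Finset (Finset V)} (hH : ∀ e ∈ H, e.card = 3) :
    AAA (EH H) univ = 6 * (H.card : ℝ) := by
  classical
  have h1 : ∀ x y z, ind (EH H x y z) = ∑ e ∈ H, ind (({x, y, z} : Finset V) = e) := by
    intro x y z
    by_cases h : EH H x y z
    · rw [ind_pos h, sum_eq_single_of_mem _ h, ind_pos rfl]
      intro b _ hb; exact ind_neg fun h => hb h.symm
    · rw [ind_neg h, sum_eq_zero]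
      intro e he; exact ind_neg fun h' => h (by unfold EH; rw [h']; exact he)
  unfold AAA
  simp_rw [h1]
  have h2 : ∑ x : V, ∑ y : V, ∑ z : V, ∑ e ∈ H, ind (({x, y, z} : Finset V) = e) =
      ∑ e ∈ H, ∑ x : V, ∑ y : V, ∑ z : V, ind (({x, y, z} : Finset V) = e) := by
    have a1 : ∀ x y : V, ∑ z : V, ∑ e ∈ H, ind (({x, y, z} : Finset V) = e) =
      ∑ e ∈ H, ∑ z : V, ind (({x, y, z} : Finset V) = e) := fun x y => sum_comm
    simp_rw [a1]
    have a2 : ∀ x : V, ∑ y : V, ∑ e ∈ H, ∑ z : V, ind (({x, y, z} : Finset V) = e) =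
      ∑ e ∈ H, ∑ y : V, ∑ z : V, ind (({x, y, z} : Finset V) = e) := fun x => sum_comm
    simp_rw [a2]
    exact sum_comm
  rw [h2, sum_congr rfl fun e he => fibre6 (hH e he)]
  simp [mul_comm]

/-- a step function forces length divisible by three -/
lemma step_good {H : Finset (Finset V)} {f : V → V → ZMod 3}
    (hf : ∀ x y z, EH H x y z → f y z = f x y + 1) (l : ℕ) : NoShortOddPseudocycle H l := by
  intro m hm _ h3 ⟨v, hv⟩
  haveI : NeZero m := ⟨by omega⟩
  have h1 : ∑ i : ZMod m, f (v (i + 1)) (v (i + 1 + 1)) = ∑ i : ZMod m, f (v i) (v (i + 1)) :=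
    Equiv.sum_comp (Equiv.addRight (1 : ZMod m)) fun i => f (v i) (v (i + 1))
  have h2 : ∀ i : ZMod m, f (v (i + 1)) (v (i + 1 + 1)) = f (v i) (v (i + 1)) + 1 := by
    intro i
    have : i + 1 + 1 = i + 2 := by ring
    rw [this]
    exact hf _ _ _ (hv i)
  simp_rw [h2, sum_add_distrib] at h1
  simp [ZMod.card] at h1
  exact h3 ((ZMod.natCast_eq_zero_iff _ _).mp h1)

lemma hom_good {H H' : Finset (Finset V)} (φ : V → V)
    (hφ : ∀ x y z, EH H' x y z → EH H (φ x) (φ y) (φ z)) {l : ℕ} (h : NoShortOddPseudocycle H l) :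
    NoShortOddPseudocycle H' l := by
  intro m hm hl h3 ⟨v, hv⟩
  exact h m hm hl h3 ⟨fun i => φ (v i), fun i => hφ _ _ _ (hv i)⟩

/-- the improved relation -/
def Est (E : V → V → V → Prop) (A B : Finset V) (x y z : V) : Prop :=
  x ≠ y ∧ y ≠ z ∧ x ≠ z ∧ ((x ∈ A ∧ y ∈ A ∧ z ∈ B) ∨ (x ∈ A ∧ y ∈ B ∧ z ∈ A) ∨
    (x ∈ B ∧ y ∈ A ∧ z ∈ A) ∨ (x ∈ B ∧ y ∈ B ∧ z ∈ B ∧ E x y z))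

lemma Est_sys {E : V → V → V → Prop} (hE : Sys E) (A B : Finset V) : Sys (Est E A B) := by
  refine ⟨?_, ?_, fun h => h.1⟩
  · rintro x y z ⟨h1, h2, h3, h⟩
    refine ⟨h1.symm, h3, h2, ?_⟩
    rcases h with h | h | h | h
    · exact Or.inl ⟨h.2.1, h.1, h.2.2⟩
    · exact Or.inr (Or.inr (Or.inl ⟨h.2.1, h.1, h.2.2⟩))
    · exact Or.inr (Or.inl ⟨h.2.1, h.1, h.2.2⟩)
    · exact Or.inr (Or.inr (Or.inr ⟨h.2.1, h.1, h.2.2.1, hE.swap h.2.2.2⟩))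
  · rintro x y z ⟨h1, h2, h3, h⟩
    refine ⟨h2, h3.symm, h1.symm, ?_⟩
    rcases h with h | h | h | h
    · exact Or.inr (Or.inl ⟨h.2.1, h.2.2, h.1⟩)
    · exact Or.inr (Or.inr (Or.inl ⟨h.2.1, h.2.2, h.1⟩))
    · exact Or.inl ⟨h.2.1, h.2.2, h.1⟩
    · exact Or.inr (Or.inr (Or.inr ⟨h.2.1, h.2.2.1, h.1, hE.rot h.2.2.2⟩))

lemma Est_good {H : Finset (Finset V)} (hH : ∀ e ∈ H, e.card = 3) {A B : Finset V}
    (hd : Disjoint A B) {l : ℕ}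
    (h : NoShortOddPseudocycle H l) : NoShortOddPseudocycle (HE (Est (EH H) A B)) l := by
  classical
  have hE := EH_sys hH
  have hS := Est_sys hE A B
  have hdd : ∀ x, x ∈ A → x ∈ B → False := fun x h1 h2 => (disjoint_left.mp hd) h1 h2
  intro m hm hl h3 ⟨v, hv⟩
  haveI : NeZero m := ⟨by omega⟩
  have hv' : ∀ i, Est (EH H) A B (v i) (v (i + 1)) (v (i + 2)) := fun i => (EH_HE hS).mp (hv i)
  by_cases hex : ∃ i, v i ∈ B ∧ v (i + 1) ∈ B
  · obtain ⟨i0, hi0⟩ := hex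
    have hst : ∀ i, (v i ∈ B ∧ v (i + 1) ∈ B) → (v (i + 1) ∈ B ∧ v (i + 1 + 1) ∈ B) ∧ EH H (v i) (v (i + 1)) (v (i + 2)) := by
      rintro i ⟨h1, h2⟩
      have e : i + 1 + 1 = i + 2 := by ring
      rw [e]
      obtain ⟨_, _, _, h⟩ := hv' i
      rcases h with h | h | h | h
      · exact (hdd _ h.1 h1).elim
      · exact (hdd _ h.1 h1).elim
      · exact (hdd _ h.2.1 h2).elim
      · exact ⟨⟨h2, h.2.2.1⟩, h.2.2.2⟩
    have hall : ∀ k : ℕ, v (i0 + k) ∈ B ∧ v (i0 + k + 1) ∈ B := by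
      intro k
      induction k with
      | zero => simpa using hi0
      | succ k ih =>
        have := (hst _ ih).1
        push_cast
        rwa [← add_assoc]
    refine h m hm hl h3 ⟨v, fun j => ?_⟩
    have h1 := hall (j - i0).val
    rw [ZMod.natCast_zmod_val, add_sub_cancel] at h1
    exact (hst _ h1).2
  · push Not at hex
    set b : ZMod m → ℕ := fun i => if v i ∈ B then 1 else 0 with hb
    have hsum : ∀ i, b i + b (i + 1) + b (i + 1 + 1) = 1 := by
      intro i
      have e : i + 1 + 1 = i + 2 := by ring
      rw [e]
      simp only [hb]
      obtain ⟨_, _, _, h⟩ := hv' i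
      rcases h with ⟨h1, h2, h3⟩ | ⟨h1, h2, h3⟩ | ⟨h1, h2, h3⟩ | ⟨h1, h2, h3⟩
      · rw [if_neg fun h => hdd _ h1 h, if_neg fun h => hdd _ h2 h, if_pos h3]
      · rw [if_neg fun h => hdd _ h1 h, if_pos h2, if_neg fun h => hdd _ h3 h]
      · rw [if_pos h1, if_neg fun h => hdd _ h2 h, if_neg fun h => hdd _ h3 h]
      · exact absurd h2 (hex i h1)
    have s1 : ∑ i, b (i + 1) = ∑ i, b i := Equiv.sum_comp (Equiv.addRight (1 : ZMod m)) b
    have s2 : ∑ i, b (i + 1 + 1) = ∑ i, b (i + 1) :=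
      Equiv.sum_comp (Equiv.addRight (1 : ZMod m)) fun i => b (i + 1)
    have s3 : ∑ i, (b i + b (i + 1) + b (i + 1 + 1)) = m := by
      simp_rw [hsum]; simp [ZMod.card]
    rw [sum_add_distrib, sum_add_distrib, s2, s1] at s3
    exact h3 ⟨∑ i, b i, by omega⟩
end hyp
end PCyc

namespace PCyc
open Finset
section low
variable {V : Type} [DecidableEq V] [Fintype V]

lemma lower_T : ∀ k : ℕ, ∀ S : Finset V, S.card = k →
    ∃ f : V → V → ZMod 3, Anti f ∧ mu * (S.card : ℝ) ^ 3 - 3 * (S.card : ℝ) ^ 2 ≤ T f S := by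
  intro k
  induction k using Nat.strong_induction_on with
  | _ k ih =>
  intro S hS
  have m1 := mu_lo
  have m2 := mu_hi
  have l1 := al_lo
  have l2 := al_hi
  rcases Nat.eq_zero_or_pos k with hk | hk
  · subst hk
    refine ⟨fun _ _ => 0, fun _ _ => by simp, ?_⟩
    rw [hS]
    have := T_nonneg (fun _ _ : V => (0 : ZMod 3)) S
    simpa using this
  have hk1 : (1 : ℝ) ≤ k := by exact_mod_cast hk
  set a := ⌈al * k⌉₊ with ha
  have ha1 : al * k ≤ a := Nat.le_ceil _
  have ha2 : (a : ℝ) ≤ al * k + 1 := (Nat.ceil_lt_add_one (by positivity)).le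
  have hak : a ≤ S.card := by
    rw [hS, ha]
    apply Nat.ceil_le.mpr
    nlinarith
  obtain ⟨A, hAS, hAc⟩ := exists_subset_card_eq hak
  set B := S \ A with hB
  have hBc : (B.card : ℝ) = k - a := by
    rw [hB, cast_card_sdiff hAS, hS, hAc]
  have hapos : 0 < a := by
    have : (0 : ℝ) < a := lt_of_lt_of_le (by positivity) ha1
    exact_mod_cast this
  have hBlt : B.card < k := by
    have : (B.card : ℝ) < k := by
      rw [hBc]
      have : (0 : ℝ) < a := by exact_mod_cast hapos
      linarith
    exact_mod_cast this
  obtain ⟨g, hg, hgT⟩ := ih B.card hBlt B rfl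
  set f : V → V → ZMod 3 := fun x y => if x ∈ A then (if y ∈ A then 0 else 1) else
    (if y ∈ A then -1 else g x y) with hf
  refine ⟨f, ?_, ?_⟩
  · intro x y
    simp only [hf]
    by_cases hx : x ∈ A <;> by_cases hy : y ∈ A <;> simp [hx, hy]
    exact hg x y
  have hd : Disjoint A B := disjoint_sdiff
  have hu : A ∪ B = S := union_sdiff_of_subset hAS
  have h1 := sum3_split hd hu fun x y z => ind (Ch f x y z)
  have nn : ∀ P Q R : Finset V, 0 ≤ ∑ x ∈ P, ∑ y ∈ Q, ∑ z ∈ R, ind (Ch f x y z) := fun P Q R =>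
    sum_nonneg fun _ _ => sum_nonneg fun _ _ => sum_ind_nonneg _ _
  have h2 : ∑ x ∈ A, ∑ y ∈ A, ∑ z ∈ B, ind (Ch f x y z) = (a : ℝ) ^ 2 * B.card := by
    have : ∀ x ∈ A, ∀ y ∈ A, ∀ z ∈ B, ind (Ch f x y z) = 1 := by
      intro x hx y hy z hz
      have hz' : z ∉ A := (mem_sdiff.mp hz).2
      exact ind_pos ⟨by simp [hf, hx, hy], by simp [hf, hx, hz'], by simp [hf, hy, hz']⟩
    rw [sum_congr rfl fun x hx => sum_congr rfl fun y hy => sum_congr rfl fun z hz => this x hx y hy z hz]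
    simp [hAc]
    ring
  have h3 : ∑ x ∈ B, ∑ y ∈ B, ∑ z ∈ B, ind (Ch f x y z) = T g B := by
    unfold T
    refine sum_congr rfl fun x hx => sum_congr rfl fun y hy => sum_congr rfl fun z hz => ind_congr ?_
    have hx' : x ∉ A := (mem_sdiff.mp hx).2
    have hy' : y ∉ A := (mem_sdiff.mp hy).2
    have hz' : z ∉ A := (mem_sdiff.mp hz).2
    simp [Ch, hf, hx', hy', hz']
  have h4 : (a : ℝ) ^ 2 * B.card + T g B ≤ T f S := by
    have e : T f S = ∑ x ∈ S, ∑ y ∈ S, ∑ z ∈ S, ind (Ch f x y z) := rfl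
    rw [e, h1, h2, h3]
    have := nn A A A
    have := nn A B A
    have := nn A B B
    have := nn B A A
    have := nn B A B
    have := nn B B A
    linarith
  have hp := key_poly (a : ℝ) B.card
  have es : (a : ℝ) + B.card = k := by rw [hBc]; ring
  rw [es] at hp
  have hak' : (a : ℝ) ≤ k := by rw [hS] at hak; exact_mod_cast hak
  have hq : (1 + mu) * a * (a - al * k) ^ 2 ≤ 2 * k := by
    have q1 : (a - al * k) ^ 2 ≤ 1 := by
      rw [sq_le_one_iff_abs_le_one, abs_le]; constructor <;> linarith
    have q2 : (1 + mu) * a ≤ 2 * k := by nlinarith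
    have q3 : (0 : ℝ) ≤ (1 + mu) * a := by positivity
    nlinarith
  have hb : (B.card : ℝ) ^ 2 ≤ (0.4 * k) ^ 2 := by
    apply pow_le_pow_left₀ (by positivity)
    rw [hBc]; nlinarith
  rw [hS]
  nlinarith

/-- Maximality in terms of relations. -/
def MaxRel (E : V → V → V → Prop) (l : ℕ) : Prop :=
  ∀ E' : V → V → V → Prop, Sys E' → NoShortOddPseudocycle (HE E') l → AAA E' univ ≤ AAA E univ

lemma AAA_congr {E E' : V → V → V → Prop} (h : ∀ x y z, E x y z ↔ E' x y z) (S : Finset V) :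
    AAA E S = AAA E' S :=
  sum_congr rfl fun x _ => sum_congr rfl fun y _ => sum_congr rfl fun z _ => ind_congr (h x y z)

lemma maxRel_of {H : Finset (Finset V)} (hH : ∀ e ∈ H, e.card = 3) {l : ℕ}
    (hmax : ∀ H' : Finset (Finset V), (∀ e ∈ H', e.card = 3) →
          NoShortOddPseudocycle H' l → H'.card ≤ H.card) : MaxRel (EH H) l := by
  intro E' hE' hg
  have h1 := six_card (HE_card hE')
  have h2 := six_card hH
  rw [AAA_congr fun x y z => EH_HE hE'] at h1
  have h3 : ((HE E').card : ℝ) ≤ H.card := by exact_mod_cast hmax _ (HE_card hE') hg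
  linarith

lemma lower_AAA {E : V → V → V → Prop} {l : ℕ} (hm : MaxRel E l) :
    3 * mu * (Fintype.card V : ℝ) ^ 3 - 12 * (Fintype.card V : ℝ) ^ 2 ≤ AAA E univ := by
  obtain ⟨f, hf, hT⟩ := lower_T (V := V) _ univ rfl
  have hS := ChE_sys hf
  have h1 := hm _ hS (step_good (f := f) (fun x y z h => ChE_step hf ((EH_HE hS).mp h)) l)
  have h2 := AAA_ChE_ge hf univ
  rw [card_univ] at hT h2
  linarith

lemma deg_close {H : Finset (Finset V)} (hH : ∀ e ∈ H, e.card = 3) {l : ℕ}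
    (hg : NoShortOddPseudocycle H l) (hm : MaxRel (EH H) l) (u v : V) :
    eAA (EH H) univ univ v - 2 * Fintype.card V ≤ eAA (EH H) univ univ u := by
  classical
  have hE := EH_sys hH
  set E := EH H with hEd
  set φ : V → V := fun x => if x = u then v else x with hφ
  set E' : V → V → V → Prop := fun x y z => E (φ x) (φ y) (φ z) with hE'
  have hS : Sys E' := by
    refine ⟨fun h => hE.swap h, fun h => hE.rot h, ?_⟩
    intro x y z h hxy
    exact hE.ne h (by rw [hxy])
  have h1 := hm E' hS (hom_good φ (fun x y z h => (EH_HE hS).mp h) hg)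
  have hd : Disjoint ({u} : Finset V) (univ \ {u}) := disjoint_sdiff
  have hu : ({u} : Finset V) ∪ (univ \ {u}) = univ := union_sdiff_of_subset (subset_univ _)
  have h2 := AAA_split hS hd hu
  have h3 := AAA_remove hE (subset_univ ({u} : Finset V))
  rw [sum_singleton] at h3
  have hφn : ∀ x ∈ univ \ ({u} : Finset V), φ x = x := by
    intro x hx
    have : x ≠ u := by simpa using hx
    simp [hφ, this]
  have h4 : AAA E' (univ \ {u}) = AAA E (univ \ {u}) := by
    refine sum_congr rfl fun x hx => sum_congr rfl fun y hy => sum_congr rfl fun z hz => ?_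
    simp only [hE', hφn x hx, hφn y hy, hφn z hz]
  have h5 : ABB E' {u} (univ \ {u}) = ∑ y ∈ univ \ {u}, ∑ z ∈ univ \ {u}, ind (E v y z) := by
    unfold ABB
    rw [sum_singleton]
    refine sum_congr rfl fun y hy => sum_congr rfl fun z hz => ?_
    have : φ u = v := by simp [hφ]
    simp only [hE', this, hφn y hy, hφn z hz]
  have hc : ∀ P : Finset V, (P.card : ℝ) ≤ Fintype.card V := by
    intro P; exact_mod_cast card_le_univ P
  have h6 := sum_patch2 (N := (Fintype.card V : ℝ)) (P' := univ) (Q' := univ) (P := univ \ {u}) (Q := univ \ {u}) (X := {u})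
      (by intro x _; simp only [mem_union, mem_sdiff, mem_univ, true_and]; tauto)
      (by intro x _; simp only [mem_union, mem_sdiff, mem_univ, true_and]; tauto)
      (fun x y => E v x y) (hc _) (hc _)
  rw [← h5, card_singleton] at h6
  have h7 : eAA E univ univ v = ∑ x, ∑ y, ind (E v x y) := rfl
  rw [← h7] at h6
  have h8 := AAA_nonneg (E := E') (A := {u})
  have h9 : 0 ≤ ∑ x ∈ ({u} : Finset V), ∑ y ∈ ({u} : Finset V), ∑ z ∈ univ \ {u}, ind (E' x y z) :=
    sum_nonneg fun _ _ => sum_nonneg fun _ _ => sum_ind_nonneg _ _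
  push_cast at h6
  linarith

lemma zero_of_sum3 {P Q R : Finset V} {p : V → V → V → Prop}
    (h : ∑ x ∈ P, ∑ y ∈ Q, ∑ z ∈ R, ind (p x y z) ≤ 0) {x y z : V} (hx : x ∈ P) (hy : y ∈ Q) (hz : z ∈ R) :
    ¬ p x y z := by
  intro hp
  have h1 := single_le_sum (f := fun x => ∑ y ∈ Q, ∑ z ∈ R, ind (p x y z))
    (fun _ _ => sum_nonneg fun _ _ => sum_ind_nonneg _ _) hx
  have h2 := single_le_sum (f := fun y => ∑ z ∈ R, ind (p x y z))
    (fun _ _ => sum_ind_nonneg _ _) hy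
  have h3 := single_le_sum (f := fun z => ind (p x y z))
    (fun _ _ => ind_nonneg _) hz
  rw [ind_pos hp] at h3
  linarith

theorem main {H : Finset (Finset V)} (hH : ∀ e ∈ H, e.card = 3) {l : ℕ} (hl : 21 * 10 ^ 38 + 1 ≤ l)
    (hbig : (100000000000000000000 : ℝ) ≤ Fintype.card V)
    (hg : NoShortOddPseudocycle H l) (hm : MaxRel (EH H) l) :
    ∃ A B : Finset V, A.Nonempty ∧ B.Nonempty ∧ Disjoint A B ∧ A ∪ B = univ ∧
      Mo (EH H) A B ≤ 0 ∧ AAA (EH H) A ≤ 0 ∧ ABB (EH H) A B ≤ 0 := by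
  classical
  have hE := EH_sys hH
  have hO := noOdd_of hH hg
  have hdc := deg_close hH hg hm
  have hlow := lower_AAA hm
  have hEst := fun (A B : Finset V) (hd : Disjoint A B) =>
    hm (Est (EH H) A B) (Est_sys hE A B) (Est_good hH hd hg)
  have m1 := mu_lo
  have m2 := mu_hi
  have l1 := al_lo
  have l2 := al_hi
  generalize EH H = E at *
  set n : ℝ := (Fintype.card V : ℝ) with hn
  have hn0 : 0 < n := by linarith only [hbig]
  have hn2 : 0 < n ^ 2 := by positivity
  have hn3 : 0 < n ^ 3 := by positivity
  have h32 : 100000000000000000000 * n ^ 2 ≤ n ^ 3 := by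
    have : 100000000000000000000 * n ^ 2 ≤ n * n ^ 2 := mul_le_mul_of_nonneg_right hbig hn2.le
    linarith only [this]
  have h21 : 100000000000000000000 * n ≤ n ^ 2 := by
    have : 100000000000000000000 * n ≤ n * n := mul_le_mul_of_nonneg_right hbig hn0.le
    linarith only [this]
  -- colouring
  obtain ⟨f, K, hf, hK, hKE, hKC, hKA⟩ := colouring (e := 0.0000000000000000001 * n) hE (by positivity) (M := 10 ^ 38)
    (by
      have e1 : (((10 ^ 38 : ℕ) : ℝ) + 1) * (0.0000000000000000001 * n) ^ 2 = n ^ 2 + 0.00000000000000000000000000000000000001 * n ^ 2 := by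
        push_cast; ring
      rw [e1]; linarith only [hn2])
    (fun m hm' => hO m (hm'.trans hl))
  have hKA' : AAA E univ - 0.0000000000000000006 * n ^ 3 ≤ AAA K univ := by
    have e1 : 6 * (0.0000000000000000001 * n) * n ^ 2 = 0.0000000000000000006 * n ^ 3 := by ring
    rw [← e1]; exact hKA
  have c1 : AAA K univ ≤ AAA (ChE f) univ :=
    sum_le_sum fun x _ => sum_le_sum fun y _ => sum_le_sum fun z _ => ind_mono (hKC x y z)
  have c2 := AAA_ChE_le (f := f) univ
  have c3 := T_le hf univ
  rw [card_univ, ← hn] at c3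
  have hT : (mu - 0.000000000000000001) * n ^ 3 ≤ T f univ := by
    linarith only [hKA', c1, c2, hlow, h32, hn3]
  obtain ⟨A, hA1, hA2⟩ := colour_stable (by rw [← hn]; linarith only [hbig]) f hf hT
  rw [← hn] at hA1 hA2
  set B := univ \ A with hB
  have hd : Disjoint A B := disjoint_sdiff
  have hu : A ∪ B = univ := union_sdiff_of_subset (subset_univ _)
  have hBc : (B.card : ℝ) = n - A.card := by
    rw [hB, cast_card_sdiff (subset_univ _), hn, card_univ]
  have hcard : ∀ P : Finset V, (P.card : ℝ) ≤ n := by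
    intro P; rw [hn]; exact_mod_cast card_le_univ P
  have hMo : Mo E A B ≤ Mo (ChE f) A B + (AAA (ChE f) univ - AAA K univ) := by
    have e1 : AAA (ChE f) univ = AAA K univ + ∑ x, ∑ y, ∑ z, ind (ChE f x y z ∧ ¬ K x y z) := by
      unfold AAA
      simp only [← sum_add_distrib]
      refine sum_congr rfl fun x _ => sum_congr rfl fun y _ => sum_congr rfl fun z _ => ?_
      by_cases hk : K x y z
      · rw [ind_pos hk, ind_pos (hKC _ _ _ hk), ind_neg (fun h => h.2 hk)]; norm_num
      · rw [ind_neg hk, zero_add]; exact ind_congr (by tauto)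
    have e2 : ∑ x ∈ A, ∑ y ∈ A, ∑ z ∈ B, ind (ChE f x y z ∧ ¬ K x y z) ≤
        ∑ x, ∑ y, ∑ z, ind (ChE f x y z ∧ ¬ K x y z) := by
      refine (sum_le_sum_of_subset_of_nonneg (subset_univ _) fun _ _ _ =>
        sum_nonneg fun _ _ => sum_ind_nonneg _ _).trans (sum_le_sum fun x _ => ?_)
      refine (sum_le_sum_of_subset_of_nonneg (subset_univ _) fun _ _ _ =>
        sum_ind_nonneg _ _).trans (sum_le_sum fun y _ => ?_)
      exact sum_le_sum_of_subset_of_nonneg (subset_univ _) fun _ _ _ => ind_nonneg _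
    have e3 : Mo E A B ≤ Mo (ChE f) A B + ∑ x ∈ A, ∑ y ∈ A, ∑ z ∈ B, ind (ChE f x y z ∧ ¬ K x y z) := by
      unfold Mo
      simp only [← sum_add_distrib]
      refine sum_le_sum fun x _ => sum_le_sum fun y _ => sum_le_sum fun z _ => ind_or_le ?_
      rintro ⟨h1, h2⟩
      by_cases hc : ChE f x y z
      · exact Or.inr ⟨hc, fun h => h2 (hKE _ _ _ h)⟩
      · exact Or.inl ⟨h1, hc⟩
    linarith only [e1, e2, e3]
  have hMf : Mf E A B ≤ 0.0000000002 * n ^ 3 := by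
    have h2 := Mf_le_Mo (E := E) (A := A) (B := B)
    have h3 : (A.card : ℝ) * B.card ≤ n * n :=
      mul_le_mul (hcard _) (hcard _) (by positivity) hn0.le
    linarith only [h2, h3, hMo, hA2, c2, c3, hKA', hlow, h32, hn3]
  have hdeg : ∀ v ∈ A ∪ B, (3 * mu - 0.00003) * n ^ 2 ≤
      ∑ x ∈ A ∪ B, ∑ y ∈ A ∪ B, ind (E v x y) := by
    intro v _
    rw [hu]
    have hex : ∃ w ∈ (univ : Finset V), (3 * mu - 0.00001) * n ^ 2 ≤ eAA E univ univ w := by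
      by_contra hc
      push Not at hc
      have s1 := sum_le_card_nsmul (univ : Finset V) (fun w => eAA E univ univ w) _ fun w hw => (hc w hw).le
      rw [nsmul_eq_mul, card_univ, ← hn] at s1
      have s2 : AAA E univ = ∑ w, eAA E univ univ w := rfl
      rw [s2] at hlow
      have s3 : n * ((3 * mu - 0.00001) * n ^ 2) = 3 * mu * n ^ 3 - 0.00001 * n ^ 3 := by ring
      rw [s3] at s1
      linarith only [s1, hlow, h32, hn3]
    obtain ⟨w, _, hw⟩ := hex
    have := hdc v w
    have e : eAA E univ univ v = ∑ x, ∑ y, ind (E v x y) := rfl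
    rw [← e]
    linarith only [this, hw, h21, hn2]
  have hA1' := abs_le.mp hA1
  obtain ⟨A1, B1, hd1, hun1, ha1, hb1, hcount⟩ := rebalance hE (fun m hm' => hO m (by
      have : (100 : ℕ) ≤ 21 * 10 ^ 38 + 1 := by norm_num
      omega)) (N := n) (by linarith only [hbig]) hd
    (abs_le.mpr ⟨by linarith only [hA1'.1, hn0], by linarith only [hA1'.2, hn0]⟩)
    (abs_le.mpr ⟨by linarith only [hA1'.2, hn0, hBc], by linarith only [hA1'.1, hn0, hBc]⟩)
    (by linarith only [hBc]) hMf hdeg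
  rw [hu] at hun1
  have x1 := AAA_split hE hd1 hun1
  rw [AAB_eq hE] at x1
  have hS := Est_sys hE A1 B1
  have x2 := AAA_split hS hd1 hun1
  rw [AAB_eq hS] at x2
  have x3 := hEst A1 B1 hd1
  have x4 : Mo (Est E A1 B1) A1 B1 = 0 := by
    unfold Mo
    refine sum_eq_zero fun x hx => sum_eq_zero fun y hy => sum_eq_zero fun z hz => ind_neg ?_
    rintro ⟨h1, h2⟩
    have := disjoint_left.mp hd1
    exact h2 ⟨h1, fun h => this hy (h ▸ hz), fun h => this hx (h ▸ hz), Or.inl ⟨hx, hy, hz⟩⟩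
  have x5 : AAA E B1 ≤ AAA (Est E A1 B1) B1 := by
    refine sum_le_sum fun x hx => sum_le_sum fun y hy => sum_le_sum fun z hz => ind_mono ?_
    intro h
    exact ⟨hE.ne h, hE.ne (hE.rot h), hE.ne (hE.swap' h), Or.inr (Or.inr (Or.inr ⟨hx, hy, hz, h⟩))⟩
  have x6 := AAA_nonneg (E := Est E A1 B1) (A := A1)
  have x7 := ABB_nonneg (E := Est E A1 B1) (A := A1) (B := B1)
  have y1 := AAA_nonneg (E := E) (A := A1)
  have y2 := ABB_nonneg (E := E) (A := A1) (B := B1)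
  have hMo0 : Mo E A1 B1 ≤ 0 := by
    linarith only [x1, x2, x3, x4, x5, x6, x7, hcount]
  refine ⟨A1, B1, ?_, ?_, hd1, hun1, hMo0, ?_, ?_⟩
  · rw [← card_pos]
    have : (0 : ℝ) < A1.card := by linarith only [ha1, hn0]
    exact_mod_cast this
  · rw [← card_pos]
    have : (0 : ℝ) < B1.card := by linarith only [hb1, hn0]
    exact_mod_cast this
  · linarith only [hMo0, y1, y2, hcount]
  · linarith only [hMo0, y1, y2, hcount]
end low
end PCyc

/-- Structure of extremal hypergraphs without short odd pseudocycles: the vertex set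
splits into nonempty parts `A, B` such that every `AAB` triple is an edge, while no edge
is an `AAA` or `ABB` triple. -/
theorem partition_of_extremal :
    ∃ ℓ₀ : ℕ, ∀ ℓ : ℕ, ℓ₀ ≤ ℓ → ∃ n₀ : ℕ, ∀ n : ℕ, n₀ ≤ n →
      ∀ H : Finset (Finset (Fin n)), (∀ e ∈ H, e.card = 3) →
        NoShortOddPseudocycle H ℓ →
        (∀ H' : Finset (Finset (Fin n)), (∀ e ∈ H', e.card = 3) →
          NoShortOddPseudocycle H' ℓ → H'.card ≤ H.card) →
        ∃ A B : Finset (Fin n), A.Nonempty ∧ B.Nonempty ∧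
          Disjoint A B ∧ A ∪ B = Finset.univ ∧
          (∀ x ∈ A, ∀ y ∈ A, ∀ z ∈ B, x ≠ y → ({x, y, z} : Finset (Fin n)) ∈ H) ∧
          (∀ e ∈ H, ¬ e ⊆ A) ∧
          (∀ e ∈ H, ¬ ((e ∩ A).card = 1 ∧ (e ∩ B).card = 2)) := by
  refine ⟨21 * 10 ^ 38 + 1, fun l hl => ⟨10 ^ 20, fun n hn H hH hg hmax => ?_⟩⟩
  have hbig : (100000000000000000000 : ℝ) ≤ Fintype.card (Fin n) := by
    rw [Fintype.card_fin]
    have : ((10 ^ 20 : ℕ) : ℝ) ≤ n := by exact_mod_cast hn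
    push_cast at this
    linarith
  obtain ⟨A, B, h1, h2, hd, hu, hM, hA, hB⟩ :=
    PCyc.main hH hl hbig hg (PCyc.maxRel_of hH hmax)
  refine ⟨A, B, h1, h2, hd, hu, ?_, ?_, ?_⟩
  · intro x hx y hy z hz hxy
    by_contra hc
    exact PCyc.zero_of_sum3 hM hx hy hz ⟨hxy, hc⟩
  · intro e he hs
    obtain ⟨a, b, c, _, _, _, rfl⟩ := Finset.card_eq_three.mp (hH e he)
    exact PCyc.zero_of_sum3 hA (hs (by simp)) (hs (by simp)) (hs (by simp)) he
  · rintro e he ⟨ha, hb⟩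
    obtain ⟨a, ha'⟩ := Finset.card_eq_one.mp ha
    obtain ⟨b, c, hbc, hb'⟩ := Finset.card_eq_two.mp hb
    have e1 : e = {a, b, c} := by
      have : e = (e ∩ A) ∪ (e ∩ B) := by
        rw [← Finset.inter_union_distrib_left, hu, Finset.inter_univ]
      rw [this, ha', hb']
      rfl
    have ma : a ∈ e ∩ A := by rw [ha']; simp
    have mb : b ∈ e ∩ B := by rw [hb']; simp
    have mc : c ∈ e ∩ B := by rw [hb']; simp
    rw [e1] at he
    exact PCyc.zero_of_sum3 hB (Finset.mem_inter.mp ma).2 (Finset.mem_inter.mp mb).2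
      (Finset.mem_inter.mp mc).2 he
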